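/- Suppose K = K_1 (the special but non-hyperspecial maximal compact open subgroup of G) and the residue field of F has exactly p elements (q = p). Then for every weight sigma of K, the universal supersingular quotient (ind_K^G sigma)/(T_sigma) is not an irreducible representation of G, where T_sigma := T + 1 if sigma is one-dimensional of the form chi∘det for a smooth character chi of E^1 = {x in E^* : x*xbar = 1}, and T_sigma := T otherwise. -/

import Mathlib

open scoped Classical

noncomputable section

namespace U21

/-- The arithmetic setting: `E` is the unramified quadratic extension of a non-archimedean
local field `F` of odd residue characteristic `p`, with residue field of `F` of cardinality
`q = p ^ fdeg`.  The field `E` is encoded through its valuation subring `O = o_E`, a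
uniformizer `ϖ`, the maximal ideal `mI` (so that `p_E^k` is `ϖ ^ k * O`), and the nontrivial
`F`-automorphism `conj` of `E` (which induces the `q`-power Frobenius on the residue field
of `E`, of cardinality `q ^ 2`). -/
structure Setting where
  p : ℕ
  q : ℕ
  fdeg : ℕ
  hp : p.Prime
  hodd : p ≠ 2
  hfdeg : 0 < fdeg
  hq : q = p ^ fdeg
  E : Type
  [fieldE : Field E]
  conj : E →+* E
  conj_invol : ∀ x, conj (conj x) = x
  conj_ne : conj ≠ RingHom.id E
  O : Subring E
  val_ring : ∀ x : E, x ≠ 0 → x ∈ O ∨ x⁻¹ ∈ O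
  conj_O : ∀ x, x ∈ O → conj x ∈ O
  ϖ : E
  unif_mem : ϖ ∈ O
  unif_ne : ϖ ≠ 0
  unif_conj : conj ϖ = ϖ
  unif_not_unit : ¬ IsUnit (⟨ϖ, unif_mem⟩ : O)
  disc : ∀ x : E, x ≠ 0 → ∃ (n : ℤ) (u : Oˣ), x = (u : O) * ϖ ^ n
  mI : Ideal O
  hmI : ∀ x : O, x ∈ mI ↔ ∃ y ∈ O, (x : E) = ϖ * y
  [fin_res : Fintype (O ⧸ mI)]
  card_res : Fintype.card (O ⧸ mI) = q ^ 2
  res_frob : ∀ x : O, Ideal.Quotient.mk mI ⟨conj x, conj_O x x.2⟩ = (Ideal.Quotient.mk mI x) ^ q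
  complete : ∀ a : ℕ → E,
    (∀ k : ℕ, ∃ N, ∀ m ≥ N, ∀ n ≥ N, ∃ w ∈ O, a m - a n = ϖ ^ k * w) →
    ∃ L : E, ∀ k : ℕ, ∃ N, ∀ n ≥ N, ∃ w ∈ O, a n - L = ϖ ^ k * w

attribute [instance] Setting.fieldE Setting.fin_res

namespace Setting

variable (S : Setting)

/-- 3×3 matrices over `E`. -/
abbrev M3 := Matrix (Fin 3) (Fin 3) S.E

/-- The antidiagonal matrix `β` of the Hermitian form. -/
def betaM : S.M3 := !![0,0,1;0,1,0;1,0,0]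

/-- The fractional ideal `p_E ^ k ⊆ E` (for `k : ℤ`). -/
def pE (k : ℤ) : Set S.E := {z | ∃ w ∈ S.O, z = S.ϖ ^ k * w}

/-- The unramified unitary group `G = U(2,1)(E/F)`, as a subgroup of `GL₃(E)`:
`g ∈ G` iff `g.transpose * β * conj g = β`. -/
def Gsub : Subgroup (Matrix.GeneralLinearGroup (Fin 3) S.E) where
  carrier := {g | ((g : S.M3)).transpose * S.betaM * ((g : S.M3).map S.conj) = S.betaM}
  one_mem' := by
    simp [Matrix.map_one (⇑S.conj) (map_zero S.conj) (map_one S.conj)]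
  mul_mem' := by
    intro a b ha hb
    simp only [Set.mem_setOf_eq, Units.val_mul, Matrix.transpose_mul, Matrix.map_mul] at ha hb ⊢
    calc ((b : S.M3)).transpose * ((a : S.M3)).transpose * S.betaM * ((a : S.M3).map S.conj * (b : S.M3).map S.conj)
        = ((b : S.M3)).transpose * (((a : S.M3)).transpose * S.betaM * (a : S.M3).map S.conj) * ((b : S.M3).map S.conj) := by
          simp only [mul_assoc]
      _ = S.betaM := by rw [ha]; exact hb
  inv_mem' := by
    intro a ha
    simp only [Set.mem_setOf_eq] at ha ⊢
    have hA : IsUnit ((a : S.M3)) := a.isUnit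
    have hdet : IsUnit ((a : S.M3)).det := (Matrix.isUnit_iff_isUnit_det _).mp hA
    have hAc : IsUnit (((a : S.M3)).map ⇑S.conj) := by
      rw [← RingHom.mapMatrix_apply]; exact hA.map _
    have hdetc : IsUnit ((((a : S.M3)).map ⇑S.conj).det) := (Matrix.isUnit_iff_isUnit_det _).mp hAc
    have hdetT : IsUnit ((((a : S.M3)).transpose).det) := by rw [Matrix.det_transpose]; exact hdet
    have hmapinv : ((a : S.M3)⁻¹).map ⇑S.conj = (((a : S.M3)).map ⇑S.conj)⁻¹ := by
      symm
      apply Matrix.inv_eq_left_inv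
      rw [← Matrix.map_mul, Matrix.nonsing_inv_mul _ hdet,
        Matrix.map_one (⇑S.conj) (map_zero S.conj) (map_one S.conj)]
    rw [Matrix.coe_units_inv, Matrix.transpose_nonsing_inv, hmapinv]
    conv_lhs => rw [← ha]
    calc (((a:S.M3)).transpose)⁻¹ * (((a:S.M3)).transpose * S.betaM * ((a:S.M3)).map ⇑S.conj) * (((a:S.M3)).map ⇑S.conj)⁻¹
        = (((a:S.M3)).transpose)⁻¹ * ((a:S.M3)).transpose * S.betaM *
            (((a:S.M3)).map ⇑S.conj * (((a:S.M3)).map ⇑S.conj)⁻¹) := by simp only [mul_assoc]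
      _ = S.betaM := by
          rw [Matrix.nonsing_inv_mul _ hdetT, Matrix.mul_nonsing_inv _ hdetc, one_mul, mul_one]

/-- The group `G = U(2,1)(E/F)`. -/
abbrev GG := ↥S.Gsub

/-- The matrix of an element of `G`. -/
def mat (g : S.GG) : S.M3 := ((g : Matrix.GeneralLinearGroup (Fin 3) S.E) : S.M3)

/-- The upper unipotent matrix `n(x,y)`. -/
def nM (x y : S.E) : S.M3 := !![1, x, y; 0, 1, -S.conj x; 0, 0, 1]

/-- The lower unipotent matrix `n'(x,y)`. -/
def n'M (x y : S.E) : S.M3 := !![1, 0, 0; x, 1, 0; y, -S.conj x, 1]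

/-- The diagonal matrix `h(x) = diag(x, -x̄x⁻¹, x̄⁻¹)`. -/
def hM (x : S.E) : S.M3 := !![x, 0, 0; 0, -S.conj x * x⁻¹, 0; 0, 0, (S.conj x)⁻¹]

/-- The subgroup `N` of `G` (unipotent radical of the upper triangular Borel), as a set. -/
def Nset : Set S.GG := {g | ∃ x y : S.E, x * S.conj x + y + S.conj y = 0 ∧ S.mat g = S.nM x y}

/-- The subgroup `N_k = {n(x,y) : y ∈ p_E^k}`, as a set. -/
def Nk (k : ℤ) : Set S.GG :=
  {g | ∃ x y : S.E, x * S.conj x + y + S.conj y = 0 ∧ y ∈ S.pE k ∧ S.mat g = S.nM x y}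

/-- The subgroup `N'` of `G`, as a set. -/
def N'set : Set S.GG := {g | ∃ x y : S.E, x * S.conj x + y + S.conj y = 0 ∧ S.mat g = S.n'M x y}

/-- The subgroup `N'_k = {n'(x,y) : y ∈ p_E^k}`, as a set. -/
def N'k (k : ℤ) : Set S.GG :=
  {g | ∃ x y : S.E, x * S.conj x + y + S.conj y = 0 ∧ y ∈ S.pE k ∧ S.mat g = S.n'M x y}

/-- The diagonal subgroup `H` of `G`, as a set. -/
def Hset : Set S.GG := {g | ∃ a b c : S.E, S.mat g = !![a,0,0;0,b,0;0,0,c]}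

/-- The hyperspecial maximal compact subgroup `K₀ = G ∩ GL₃(o_E)`, as a set. -/
def K0set : Set S.GG := {g | ∀ i j, S.mat g i j ∈ S.O}

/-- The special (non-hyperspecial) maximal compact subgroup `K₁`, as a set. -/
def K1set : Set S.GG :=
  {g | S.mat g 0 0 ∈ S.O ∧ S.mat g 0 1 ∈ S.O ∧ S.mat g 0 2 ∈ S.pE (-1) ∧
       S.mat g 1 0 ∈ S.pE 1 ∧ S.mat g 1 1 ∈ S.O ∧ S.mat g 1 2 ∈ S.O ∧
       S.mat g 2 0 ∈ S.pE 1 ∧ S.mat g 2 1 ∈ S.pE 1 ∧ S.mat g 2 2 ∈ S.O}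

/-- The Iwahori subgroup `I_{K₀}` (preimage of the Borel of `Γ_{K₀}`), as a set. -/
def IK0 : Set S.GG :=
  {g | g ∈ S.K0set ∧ S.mat g 1 0 ∈ S.pE 1 ∧ S.mat g 2 0 ∈ S.pE 1 ∧ S.mat g 2 1 ∈ S.pE 1}

/-- The pro-p Iwahori subgroup `I_{1,K₀}`, as a set. -/
def I1K0 : Set S.GG :=
  {g | g ∈ S.IK0 ∧ S.mat g 0 0 - 1 ∈ S.pE 1 ∧ S.mat g 1 1 - 1 ∈ S.pE 1 ∧ S.mat g 2 2 - 1 ∈ S.pE 1}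

/-- The opposite pro-p Iwahori subgroup `I'_{1,K₀}`, as a set. -/
def I1'K0 : Set S.GG :=
  {g | g ∈ S.K0set ∧ S.mat g 0 1 ∈ S.pE 1 ∧ S.mat g 0 2 ∈ S.pE 1 ∧ S.mat g 1 2 ∈ S.pE 1 ∧
       S.mat g 0 0 - 1 ∈ S.pE 1 ∧ S.mat g 1 1 - 1 ∈ S.pE 1 ∧ S.mat g 2 2 - 1 ∈ S.pE 1}

/-- The maximal normal pro-p subgroup `K₀¹` of `K₀` (principal congruence subgroup), as a set. -/
def Kone0 : Set S.GG := {g | ∀ i j, S.mat g i j - (1 : S.M3) i j ∈ S.pE 1}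

/-- The Iwahori subgroup `I_{K₁}`, as a set. -/
def IK1 : Set S.GG := {g | g ∈ S.K1set ∧ S.mat g 2 0 ∈ S.pE 2}

/-- The pro-p Iwahori subgroup `I_{1,K₁}`, as a set. -/
def I1K1 : Set S.GG :=
  {g | g ∈ S.IK1 ∧ S.mat g 0 0 - 1 ∈ S.pE 1 ∧ S.mat g 1 1 - 1 ∈ S.pE 1 ∧ S.mat g 2 2 - 1 ∈ S.pE 1}

/-- The opposite pro-p Iwahori subgroup `I'_{1,K₁}`, as a set. -/
def I1'K1 : Set S.GG :=
  {g | g ∈ S.K1set ∧ S.mat g 0 2 ∈ S.O ∧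
       S.mat g 0 0 - 1 ∈ S.pE 1 ∧ S.mat g 1 1 - 1 ∈ S.pE 1 ∧ S.mat g 2 2 - 1 ∈ S.pE 1}

/-- The maximal normal pro-p subgroup `K₁¹` of `K₁`, as a set. -/
def Kone1 : Set S.GG :=
  {g | g ∈ S.K1set ∧ S.mat g 0 2 ∈ S.O ∧ S.mat g 2 0 ∈ S.pE 2 ∧
       S.mat g 0 0 - 1 ∈ S.pE 1 ∧ S.mat g 1 1 - 1 ∈ S.pE 1 ∧ S.mat g 2 2 - 1 ∈ S.pE 1}

/-- The congruence subgroup of level `n` (used to express smoothness), as a set. -/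
def cong (n : ℕ) : Set S.GG := {g | ∀ i j, S.mat g i j - (1 : S.M3) i j ∈ S.pE n}

def alphaM : S.M3 := !![S.ϖ⁻¹, 0, 0; 0, 1, 0; 0, 0, S.ϖ]

def alphaMinv : S.M3 := !![S.ϖ, 0, 0; 0, 1, 0; 0, 0, S.ϖ⁻¹]

lemma alpha_mul_inv : S.alphaM * S.alphaMinv = 1 := by
  ext i j
  fin_cases i <;> fin_cases j <;>
    simp [alphaM, alphaMinv, Matrix.mul_apply, Fin.sum_univ_three, Matrix.one_apply,
      Matrix.vecHead, Matrix.vecTail, inv_mul_cancel₀ S.unif_ne, mul_inv_cancel₀ S.unif_ne]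

lemma alpha_inv_mul : S.alphaMinv * S.alphaM = 1 := by
  ext i j
  fin_cases i <;> fin_cases j <;>
    simp [alphaM, alphaMinv, Matrix.mul_apply, Fin.sum_univ_three, Matrix.one_apply,
      Matrix.vecHead, Matrix.vecTail, inv_mul_cancel₀ S.unif_ne, mul_inv_cancel₀ S.unif_ne]

def alphaU : Matrix.GeneralLinearGroup (Fin 3) S.E :=
  ⟨S.alphaM, S.alphaMinv, S.alpha_mul_inv, S.alpha_inv_mul⟩

lemma alphaU_mem : S.alphaU ∈ S.Gsub := by
  show ((S.alphaU : S.M3)).transpose * S.betaM * ((S.alphaU : S.M3).map S.conj) = S.betaM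
  have : (S.alphaU : S.M3) = S.alphaM := rfl
  rw [this]
  ext i j
  fin_cases i <;> fin_cases j <;>
    simp [alphaM, betaM, Matrix.mul_apply, Fin.sum_univ_three, Matrix.map_apply,
      Matrix.transpose_apply, Matrix.vecHead, Matrix.vecTail, map_inv₀, S.unif_conj,
      inv_mul_cancel₀ S.unif_ne, mul_inv_cancel₀ S.unif_ne]

/-- The element `α = diag(ϖ⁻¹, 1, ϖ)` of `G`. -/
def alphaE : S.GG := ⟨S.alphaU, S.alphaU_mem⟩

lemma beta_mul_beta : S.betaM * S.betaM = 1 := by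
  ext i j
  fin_cases i <;> fin_cases j <;>
    simp [betaM, Matrix.mul_apply, Fin.sum_univ_three, Matrix.one_apply,
      Matrix.vecHead, Matrix.vecTail]

def betaU : Matrix.GeneralLinearGroup (Fin 3) S.E :=
  ⟨S.betaM, S.betaM, S.beta_mul_beta, S.beta_mul_beta⟩

lemma betaU_mem : S.betaU ∈ S.Gsub := by
  show ((S.betaU : S.M3)).transpose * S.betaM * ((S.betaU : S.M3).map S.conj) = S.betaM
  have : (S.betaU : S.M3) = S.betaM := rfl
  rw [this]
  ext i j
  fin_cases i <;> fin_cases j <;>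
    simp [betaM, Matrix.mul_apply, Fin.sum_univ_three, Matrix.map_apply, Matrix.transpose_apply,
      Matrix.vecHead, Matrix.vecTail]

/-- The element `β` of `G`. -/
def betaE : S.GG := ⟨S.betaU, S.betaU_mem⟩

/-- The element `β' = β * α⁻¹` of `G`. -/
def betaPr : S.GG := S.betaE * S.alphaE⁻¹

/-- A finite set `U` is a set of representatives for the cosets `A/B`. -/
def IsReps (A B : Set S.GG) (U : Finset S.GG) : Prop :=
  (↑U : Set S.GG) ⊆ A ∧ ∀ a ∈ A, ∃! u, u ∈ U ∧ a⁻¹ * u ∈ B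

/-- The residue field `k_E` of `E`. -/
abbrev kE := S.O ⧸ S.mI

/-- The residue map `o_E → k_E`. -/
def resmap : S.O →+* S.kE := Ideal.Quotient.mk S.mI

/-- The group `L_{q³} = {(x,t) ∈ k_E² : x x̄ + t + t̄ = 0}` (where `x̄ = x^q`). -/
def Lbig : Set (S.kE × S.kE) := {z | z.1 * z.1 ^ S.q + z.2 + z.2 ^ S.q = 0}

/-- The group `L_q = {(0,t) ∈ k_E² : t + t̄ = 0}`. -/
def Lsmall : Set (S.kE × S.kE) := {z | z.1 = 0 ∧ z.2 + z.2 ^ S.q = 0}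

/-- `L_{q^t}` for `t ∈ {1,3}`. -/
def Lof (t : ℕ) : Set (S.kE × S.kE) := if t = 3 then S.Lbig else S.Lsmall

end Setting

/-- A choice of one of the two maximal compact open subgroups `K ∈ {K₀, K₁}` of `G`,
together with its maximal normal pro-p subgroup `K¹`, the (pro-p) Iwahori subgroups
`I_K ⊇ I_{1,K}`, the opposite pro-p Iwahori `I'_{1,K}`, the element
`β_K ∈ K ∩ {β, β'}`, and the integers `n_K, m_K, t_K`. -/
structure Chamber (S : Setting) where
  K : Subgroup S.GG
  KoneS : Set S.GG
  IK : Set S.GG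
  I1 : Set S.GG
  I1' : Set S.GG
  βK : S.GG
  nK : ℤ
  mK : ℤ
  tK : ℕ
  cases :
    ((K : Set S.GG) = S.K0set ∧ KoneS = S.Kone0 ∧ IK = S.IK0 ∧ I1 = S.I1K0 ∧ I1' = S.I1'K0 ∧
      βK = S.betaE ∧ nK = 0 ∧ mK = 1 ∧ tK = 3) ∨
    ((K : Set S.GG) = S.K1set ∧ KoneS = S.Kone1 ∧ IK = S.IK1 ∧ I1 = S.I1K1 ∧ I1' = S.I1'K1 ∧
      βK = S.betaPr ∧ nK = -1 ∧ mK = 2 ∧ tK = 1)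

namespace Chamber

variable {S : Setting} (C : Chamber S)

/-- `H₀ = H ∩ I_K`. -/
def H0 : Set S.GG := S.Hset ∩ C.IK

/-- `H₁ = H ∩ I_{1,K}`. -/
def H1 : Set S.GG := S.Hset ∩ C.I1

end Chamber

section RepTheory

variable {S : Setting} (C : Chamber S)
variable (𝔽 : Type) [Field 𝔽]

section Generic

variable {G₀ : Type} [Monoid G₀] {V : Type} [AddCommGroup V] [Module 𝔽 V]

/-- A submodule is invariant under a representation. -/
def Invt (ρ : Representation 𝔽 G₀ V) (Ssub : Submodule 𝔽 V) : Prop :=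
  ∀ g v, v ∈ Ssub → ρ g v ∈ Ssub

/-- The subrepresentation generated by a vector (the span of its orbit). -/
def orbitSpan (ρ : Representation 𝔽 G₀ V) (v : V) : Submodule 𝔽 V :=
  Submodule.span 𝔽 {w | ∃ g, w = ρ g v}

/-- The subrepresentation generated by a vector under a subset `A` of the group. -/
def orbitSpanOn (ρ : Representation 𝔽 G₀ V) (A : Set G₀) (v : V) : Submodule 𝔽 V :=
  Submodule.span 𝔽 {w | ∃ g ∈ A, w = ρ g v}

/-- The quotient of a representation by an invariant submodule `N` is irreducible:
equivalently (by the lattice correspondence), `N ≠ ⊤` and any invariant submodule lying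
between `N` and `⊤` equals `N` or `⊤`. -/
def QuotientIrreducible (ρ : Representation 𝔽 G₀ V) (N : Submodule 𝔽 V) : Prop :=
  N ≠ ⊤ ∧ ∀ Ssub : Submodule 𝔽 V, Invt 𝔽 ρ Ssub → N ≤ Ssub → Ssub = N ∨ Ssub = ⊤

/-- The submodule of vectors invariant under all elements of the subset `A`. -/
def invariantsOn (ρ : Representation 𝔽 G₀ V) (A : Set G₀) : Submodule 𝔽 V where
  carrier := {v | ∀ g ∈ A, ρ g v = v}
  add_mem' := by
    intro a b ha hb g hg
    rw [map_add, ha g hg, hb g hg]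
  zero_mem' := by
    intro g hg
    rw [map_zero]
  smul_mem' := by
    intro c a ha g hg
    rw [map_smul, ha g hg]

/-- The space `Hom_G(ρ₁, ρ₂)` of equivariant linear maps, as a submodule of the linear maps. -/
def EquivHomSub {V₂ : Type} [AddCommGroup V₂] [Module 𝔽 V₂]
    (ρ₁ : Representation 𝔽 G₀ V) (ρ₂ : Representation 𝔽 G₀ V₂) :
    Submodule 𝔽 (V →ₗ[𝔽] V₂) where
  carrier := {φ | ∀ g x, φ (ρ₁ g x) = ρ₂ g (φ x)}
  add_mem' := by
    intro a b ha hb g x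
    simp only [LinearMap.add_apply, ha g x, hb g x, map_add]
  zero_mem' := by
    intro g x
    simp only [LinearMap.zero_apply, map_zero]
  smul_mem' := by
    intro c a ha g x
    simp only [LinearMap.smul_apply, ha g x, map_smul]

end Generic

section Weight

variable (W : Type) [AddCommGroup W] [Module 𝔽 W]
variable (σ : Representation 𝔽 ↥C.K W)

/-- Extension of `σ` to all of `G` (by `1` outside `K`); used to avoid coercion issues. -/
def sigma' : S.GG → Module.End 𝔽 W := fun g => if h : g ∈ C.K then σ ⟨g, h⟩ else 1

/-- `σ` is a weight of `K`: an irreducible smooth representation of `K` over `𝔽`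
factoring through `Γ_K = K / K¹` (automatically finite dimensional). -/
def IsWeight : Prop :=
  Nontrivial W ∧ FiniteDimensional 𝔽 W ∧
  (∀ Ssub : Submodule 𝔽 W, (∀ (k : ↥C.K) (w : W), w ∈ Ssub → σ k w ∈ Ssub) → Ssub = ⊥ ∨ Ssub = ⊤) ∧
  (∀ (g : S.GG) (hg : g ∈ C.K), g ∈ C.KoneS → σ ⟨g, hg⟩ = LinearMap.id)

/-- `σ` is one dimensional of the form `χ ∘ det`. -/
def IsDetWeight : Prop :=
  Module.finrank 𝔽 W = 1 ∧
  ∃ c : S.E → 𝔽, ∀ (g : S.GG) (hg : g ∈ C.K) (w : W), σ ⟨g, hg⟩ w = c ((S.mat g).det) • w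

/-- `j_σ : σ → σ` is the composition of the coinvariant projection `σ → σ_{I'_{1,K}}`
with the inverse of the natural isomorphism `σ^{I_{1,K}} ≅ σ_{I'_{1,K}}`:
it restricts to the identity on `σ^{I_{1,K}}` and kills the augmentation part of
`σ` with respect to `I'_{1,K}`. -/
def IsJ (jσ : W →ₗ[𝔽] W) : Prop :=
  (∀ w : W, (∀ g ∈ C.I1, sigma' C 𝔽 W σ g w = w) → jσ w = w) ∧
  (∀ (w : W) (g : S.GG), g ∈ C.I1' → jσ (sigma' C 𝔽 W σ g w - w) = 0)

/-- The defining conditions of the compact induction `ind_K^G σ`: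
`K`-equivariance on the left and compact support (finitely many cosets `K g`). -/
def IndCarrier : Set (S.GG → W) :=
  {f | (∀ (k : S.GG) (hk : k ∈ C.K) (g : S.GG), f (k * g) = σ ⟨k, hk⟩ (f g)) ∧
       ∃ s : Finset S.GG, ∀ g : S.GG, f g ≠ 0 → ∃ k ∈ C.K, ∃ t ∈ s, g = k * t}

/-- The compact induction `ind_K^G σ`, as a submodule of `G → W`. -/
def IndSub : Submodule 𝔽 (S.GG → W) where
  carrier := IndCarrier C 𝔽 W σ
  add_mem' := by
    rintro f g ⟨hf1, sf, hf2⟩ ⟨hg1, sg, hg2⟩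
    refine ⟨fun k hk x => by simp [hf1 k hk x, hg1 k hk x], sf ∪ sg, fun x hx => ?_⟩
    by_cases h : f x ≠ 0
    · obtain ⟨k, hk, t, ht, rfl⟩ := hf2 x h
      exact ⟨k, hk, t, Finset.mem_union_left _ ht, rfl⟩
    · push_neg at h
      have hgx : g x ≠ 0 := by
        intro h0
        apply hx
        simp [Pi.add_apply, h, h0]
      obtain ⟨k, hk, t, ht, rfl⟩ := hg2 x hgx
      exact ⟨k, hk, t, Finset.mem_union_right _ ht, rfl⟩
  zero_mem' := ⟨fun k hk g => by simp, ∅, fun g hg => absurd rfl hg⟩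
  smul_mem' := by
    rintro c f ⟨hf1, sf, hf2⟩
    refine ⟨fun k hk g => by simp [hf1 k hk g], sf, fun x hx => ?_⟩
    refine hf2 x ?_
    intro h0
    apply hx
    simp [h0]

lemma indAct_mem (g : S.GG) {f : S.GG → W} (hf : f ∈ IndCarrier C 𝔽 W σ) :
    (fun x => f (x * g)) ∈ IndCarrier C 𝔽 W σ := by
  obtain ⟨h1, s, h2⟩ := hf
  refine ⟨fun k hk x => ?_, s.image (· * g⁻¹), ?_⟩
  · show f (k * x * g) = _
    rw [mul_assoc]
    exact h1 k hk (x * g)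
  intro x hx
  obtain ⟨k, hk, t, ht, hxg⟩ := h2 (x * g) hx
  refine ⟨k, hk, t * g⁻¹, Finset.mem_image_of_mem _ ht, ?_⟩
  rw [← mul_assoc, ← hxg, mul_assoc, mul_inv_cancel, mul_one]

/-- The representation of `G` on `ind_K^G σ` by right translation. -/
def indRep : Representation 𝔽 S.GG ↥(IndSub C 𝔽 W σ) where
  toFun g :=
    { toFun := fun f => ⟨fun x => (f : S.GG → W) (x * g), indAct_mem C 𝔽 W σ g f.2⟩
      map_add' := fun f1 f2 => Subtype.ext (funext fun x => rfl)
      map_smul' := fun c f => Subtype.ext (funext fun x => rfl) }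
  map_one' := LinearMap.ext fun f => Subtype.ext (funext fun x => by simp [mul_one])
  map_mul' g h := LinearMap.ext fun f => Subtype.ext (funext fun x => by simp [mul_assoc])

/-- The function `[g, v] ∈ ind_K^G σ`: supported on `K g⁻¹`, with value `v` at `g⁻¹`. -/
def stdFn (g : S.GG) (v : W) : S.GG → W :=
  fun x => if h : x * g ∈ C.K then σ ⟨x * g, h⟩ v else 0

/-- The characterization of the family `f_n` (`n ∈ ℤ`) of `I_{1,K}`-invariant elements of
`ind_K^G σ`: `f_n` is supported on `K α⁻ⁿ I_{1,K}` and has value at `α⁻ⁿ` equal to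
`σ(β_K) v₀` for `n > 0` and `v₀` for `n ≤ 0`, where `v₀` is a fixed nonzero vector of
`σ^{I_{1,K}}`. -/
def IsFFamily (v0 : W) (ff : ℤ → ↥(IndSub C 𝔽 W σ)) : Prop :=
  v0 ≠ 0 ∧ (∀ g ∈ C.I1, sigma' C 𝔽 W σ g v0 = v0) ∧
  (∀ (n : ℤ) (g : S.GG), g ∈ C.I1 → indRep C 𝔽 W σ g (ff n) = ff n) ∧
  (∀ (n : ℤ) (x : S.GG), (ff n : S.GG → W) x ≠ 0 →
    ∃ k ∈ C.K, ∃ i ∈ C.I1, x = k * S.alphaE ^ (-n) * i) ∧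
  (∀ n : ℤ, 0 < n → (ff n : S.GG → W) (S.alphaE ^ (-n)) = sigma' C 𝔽 W σ C.βK v0) ∧
  (∀ n : ℤ, n ≤ 0 → (ff n : S.GG → W) (S.alphaE ^ (-n)) = v0)

/-- The characterization of the Hecke operator `T ∈ End_G(ind_K^G σ)`:
it is `G`-equivariant and satisfies
`T [1, v] = ∑_{u ∈ N_{n_K}/N_{n_K+2}} [u α⁻¹, j_σ σ(u⁻¹) v]
  + ∑_{u ∈ N_{n_K+1}/N_{n_K+2}} [β_K u α⁻¹, j_σ σ(β_K) v]`. -/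
def IsHeckeT (jσ : W →ₗ[𝔽] W) (T : Module.End 𝔽 ↥(IndSub C 𝔽 W σ)) : Prop :=
  (∀ (g : S.GG) (x : ↥(IndSub C 𝔽 W σ)),
    T (indRep C 𝔽 W σ g x) = indRep C 𝔽 W σ g (T x)) ∧
  (∀ (v : W) (x : ↥(IndSub C 𝔽 W σ)), (x : S.GG → W) = stdFn C 𝔽 W σ 1 v →
    ∀ (U2 U1 : Finset S.GG),
      S.IsReps (S.Nk C.nK) (S.Nk (C.nK + 2)) U2 →
      S.IsReps (S.Nk (C.nK + 1)) (S.Nk (C.nK + 2)) U1 →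
      ((T x : S.GG → W)) =
        (∑ u ∈ U2, stdFn C 𝔽 W σ (u * S.alphaE⁻¹) (jσ (sigma' C 𝔽 W σ u⁻¹ v))) +
        ∑ u ∈ U1, stdFn C 𝔽 W σ (C.βK * u * S.alphaE⁻¹) (jσ (sigma' C 𝔽 W σ C.βK v)))

/-- The eigencharacter `χ_σ` of `H₀/H₁` afforded by the (one-dimensional) space
`σ^{I_{1,K}}` with chosen basis vector `v₀`. -/
def IsChi (v0 : W) (χ : S.GG → 𝔽) : Prop :=
  (∀ h ∈ C.H0, sigma' C 𝔽 W σ h v0 = χ h • v0)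

/-- Right translation on functions `K → 𝔽` (the action on a (finite) principal series). -/
def PSact (k : ↥C.K) (f : ↥C.K → 𝔽) : ↥C.K → 𝔽 := fun x => f (x * k)

/-- The (inflation to `K` of the) finite principal series `Ind_𝔹^{Γ_K} χ`:
functions on `K`, invariant under right translation by `K¹`, left `I_{1,K}`-invariant and
left `(H₀, χ)`-equivariant. -/
def PSchiSub (χ : S.GG → 𝔽) : Submodule 𝔽 (↥C.K → 𝔽) where
  carrier := {f | (∀ b : ↥C.K, (b : S.GG) ∈ C.I1 → ∀ x, f (b * x) = f x) ∧
                  (∀ h : ↥C.K, (h : S.GG) ∈ C.H0 → ∀ x, f (h * x) = χ (h : S.GG) * f x) ∧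
                  (∀ z : ↥C.K, (z : S.GG) ∈ C.KoneS → ∀ x, f (x * z) = f x)}
  add_mem' := by
    rintro f g ⟨hf1, hf2, hf3⟩ ⟨hg1, hg2, hg3⟩
    exact ⟨fun b hb x => by simp [hf1 b hb x, hg1 b hb x],
           fun h hh x => by simp [hf2 h hh x, hg2 h hh x, mul_add],
           fun z hz x => by simp [hf3 z hz x, hg3 z hz x]⟩
  zero_mem' := ⟨fun b hb x => rfl, fun h hh x => by simp, fun z hz x => rfl⟩
  smul_mem' := by
    rintro c f ⟨hf1, hf2, hf3⟩
    refine ⟨fun b hb x => by simp [hf1 b hb x], fun h hh x => ?_, fun z hz x => by simp [hf3 z hz x]⟩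
    simp only [Pi.smul_apply, hf2 h hh x, smul_eq_mul]
    ring

/-- The principal series `Ind_𝔹^{Γ_K} 1` for the trivial character. -/
def PS1sub : Submodule 𝔽 (↥C.K → 𝔽) := PSchiSub C 𝔽 (fun _ => 1)

/-- `σ_{st}` is the Steinberg weight `st = (Ind_𝔹^{Γ_K} 1)/1`: there is a surjective
`K`-equivariant linear map from `Ind_𝔹^{Γ_K} 1` to it whose kernel is exactly the
constant functions. -/
def IsSteinberg {Wst : Type} [AddCommGroup Wst] [Module 𝔽 Wst]
    (σst : Representation 𝔽 ↥C.K Wst) : Prop :=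
  ∃ φ : ↥(PS1sub C 𝔽) →ₗ[𝔽] Wst, Function.Surjective φ ∧
    (∀ f : ↥(PS1sub C 𝔽), φ f = 0 ↔ ∃ c : 𝔽, (f : ↥C.K → 𝔽) = fun _ => c) ∧
    (∀ (k : ↥C.K) (f f' : ↥(PS1sub C 𝔽)),
      (f' : ↥C.K → 𝔽) = PSact C 𝔽 k (f : ↥C.K → 𝔽) → φ f' = σst k (φ f))

/-- `σ` is isomorphic to a twist of the Steinberg weight by a character. -/
def IsTwistSteinberg : Prop :=
  ∃ (c : ↥C.K →* 𝔽ˣ) (φ : ↥(PS1sub C 𝔽) →ₗ[𝔽] W), Function.Surjective φ ∧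
    (∀ f : ↥(PS1sub C 𝔽), φ f = 0 ↔ ∃ cc : 𝔽, (f : ↥C.K → 𝔽) = fun _ => cc) ∧
    (∀ (k : ↥C.K) (f f' : ↥(PS1sub C 𝔽)),
      (f' : ↥C.K → 𝔽) = PSact C 𝔽 k (f : ↥C.K → 𝔽) →
        φ f' = (c k : 𝔽) • σ k (φ f))


/-- The `K`-subrepresentation of the quotient `(ind_K^G σ) / (range T)` generated by the
image of a vector `v`. -/
def genQuot (T : Module.End 𝔽 ↥(IndSub C 𝔽 W σ)) (v : ↥(IndSub C 𝔽 W σ)) :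
    Submodule 𝔽 (↥(IndSub C 𝔽 W σ) ⧸ LinearMap.range T) :=
  Submodule.span 𝔽 {w | ∃ k ∈ C.K, w = Submodule.Quotient.mk (indRep C 𝔽 W σ k v)}

end Weight

/-- Smoothness of a representation of `G`: every vector is fixed by some congruence
subgroup (equivalently, has open stabilizer). -/
def SmoothRep {V : Type} [AddCommGroup V] [Module 𝔽 V] (ρ : Representation 𝔽 S.GG V) : Prop :=
  ∀ v : V, ∃ n : ℕ, ∀ g ∈ S.cong n, ρ g v = v

end RepTheory

end U21
namespace U21

namespace Setting

variable {S : Setting}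

lemma pE_mono {x : S.E} {k l : ℤ} (h : x ∈ S.pE k) (hlk : l ≤ k) : x ∈ S.pE l := by
  obtain ⟨w, hw, rfl⟩ := h
  obtain ⟨m, hm⟩ := Int.eq_ofNat_of_zero_le (sub_nonneg.mpr hlk)
  refine ⟨S.ϖ ^ m * w, S.O.mul_mem (S.O.pow_mem S.unif_mem m) hw, ?_⟩
  rw [← mul_assoc, ← zpow_natCast, ← zpow_add₀ S.unif_ne]
  congr 2
  omega

lemma pE_mul {x y : S.E} {a b : ℤ} (k : ℤ) (hx : x ∈ S.pE a) (hy : y ∈ S.pE b)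
    (h : k ≤ a + b) : x * y ∈ S.pE k := by
  obtain ⟨w, hw, rfl⟩ := hx
  obtain ⟨z, hz, rfl⟩ := hy
  refine pE_mono ⟨w * z, S.O.mul_mem hw hz, ?_⟩ h
  rw [zpow_add₀ S.unif_ne]
  ring

lemma pE_add {x y : S.E} {k : ℤ} (hx : x ∈ S.pE k) (hy : y ∈ S.pE k) : x + y ∈ S.pE k := by
  obtain ⟨w, hw, rfl⟩ := hx
  obtain ⟨z, hz, rfl⟩ := hy
  exact ⟨w + z, S.O.add_mem hw hz, by ring⟩

lemma pE_neg {x : S.E} {k : ℤ} (hx : x ∈ S.pE k) : -x ∈ S.pE k := by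
  obtain ⟨w, hw, rfl⟩ := hx
  exact ⟨-w, S.O.neg_mem hw, by ring⟩

lemma pE_neg_iff {x : S.E} {k : ℤ} : -x ∈ S.pE k ↔ x ∈ S.pE k :=
  ⟨fun h => by simpa using pE_neg h, pE_neg⟩

lemma pE_sub {x y : S.E} {k : ℤ} (hx : x ∈ S.pE k) (hy : y ∈ S.pE k) : x - y ∈ S.pE k := by
  rw [sub_eq_add_neg]
  exact pE_add hx (pE_neg hy)

@[simp] lemma zero_mem_pE (k : ℤ) : (0 : S.E) ∈ S.pE k := ⟨0, S.O.zero_mem, by simp⟩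

lemma mem_pE_zero {x : S.E} : x ∈ S.pE 0 ↔ x ∈ S.O :=
  ⟨by rintro ⟨w, hw, rfl⟩; simpa using hw, fun h => ⟨x, h, by simp⟩⟩

lemma one_mem_pE : (1 : S.E) ∈ S.pE 0 := mem_pE_zero.2 S.O.one_mem

lemma zpow_mem_pE (k : ℤ) : S.ϖ ^ k ∈ S.pE k := ⟨1, S.O.one_mem, by simp⟩

lemma one_notMem_pE : (1 : S.E) ∉ S.pE 1 := by
  rintro ⟨w, hw, h⟩
  apply S.unif_not_unit
  refine IsUnit.of_mul_eq_one ⟨w, hw⟩ (Subtype.ext ?_)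
  simpa using h.symm

lemma conj_mem_pE {x : S.E} {k : ℤ} (hx : x ∈ S.pE k) : S.conj x ∈ S.pE k := by
  obtain ⟨w, hw, rfl⟩ := hx
  exact ⟨S.conj w, S.conj_O w hw, by simp [map_zpow₀, S.unif_conj]⟩

lemma conj_mem_pE_iff {x : S.E} {k : ℤ} : S.conj x ∈ S.pE k ↔ x ∈ S.pE k :=
  ⟨fun h => by simpa [S.conj_invol] using conj_mem_pE h, conj_mem_pE⟩

/-- Multiplication by a power of the uniformizer shifts the valuation. -/
lemma zpow_mul_mem_pE {x : S.E} {k n : ℤ} : S.ϖ ^ n * x ∈ S.pE k ↔ x ∈ S.pE (k - n) := by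
  constructor
  · intro h
    have := pE_mul (k - n) (zpow_mem_pE (S := S) (-n)) h (by omega)
    rwa [← mul_assoc, ← zpow_add₀ S.unif_ne, neg_add_cancel, zpow_zero, one_mul] at this
  · intro h
    exact pE_mul k (zpow_mem_pE n) h (by omega)

lemma unif_mul_mem_pE {x : S.E} {k : ℤ} : S.ϖ * x ∈ S.pE k ↔ x ∈ S.pE (k - 1) := by
  simpa using zpow_mul_mem_pE (S := S) (x := x) (k := k) (n := 1)

lemma unif_inv_mul_mem_pE {x : S.E} {k : ℤ} : S.ϖ⁻¹ * x ∈ S.pE k ↔ x ∈ S.pE (k + 1) := by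
  simpa using zpow_mul_mem_pE (S := S) (x := x) (k := k) (n := -1)

lemma inv_mem_pE {x : S.E} {k : ℤ} (h : x ∉ S.pE k) : x⁻¹ ∈ S.pE (1 - k) := by
  have hx : x ≠ 0 := fun h0 => h (h0 ▸ zero_mem_pE k)
  obtain ⟨n, u, hu⟩ := S.disc x hx
  rcases le_or_gt k n with hkn | hkn
  · exact (h (pE_mono ⟨u, (u : S.O).2, by rw [hu, mul_comm]⟩ hkn)).elim
  · refine pE_mono (k := -n) ⟨((u⁻¹ : S.Oˣ) : S.O), ((u⁻¹ : S.Oˣ) : S.O).2, ?_⟩ (by omega)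
    have h1 : ((u : S.O) : S.E) * (((u⁻¹ : S.Oˣ) : S.O) : S.E) = 1 := by
      rw [← Subring.coe_mul, Units.mul_inv, Subring.coe_one]
    rw [hu, mul_inv, zpow_neg, mul_comm, eq_comm]
    congr 1
    exact eq_inv_of_mul_eq_one_right h1

lemma ne_zero_of_notMem_pE {x : S.E} {k : ℤ} (h : x ∉ S.pE k) : x ≠ 0 :=
  fun h0 => h (h0 ▸ zero_mem_pE k)

/-- If `v(x) < j` then dividing by `x` lowers the valuation by less than `j`. -/
lemma div_mem_pE {x y : S.E} {j a : ℤ} (k : ℤ) (hx : x ∉ S.pE j) (hy : y ∈ S.pE a)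
    (h : k ≤ a + 1 - j) : y / x ∈ S.pE k := by
  rw [div_eq_mul_inv]
  exact pE_mul k hy (inv_mem_pE hx) (by omega)

lemma mul_notMem_pE {x y : S.E} {a b k : ℤ} (hx : x ∉ S.pE a) (hy : y ∉ S.pE b)
    (h : a + b - 1 ≤ k) : x * y ∉ S.pE k := by
  intro hxy
  apply one_notMem_pE (S := S)
  have h1 := pE_mul 1 hxy (pE_mul _ (inv_mem_pE hx) (inv_mem_pE hy) le_rfl) (by omega)
  have hx0 := ne_zero_of_notMem_pE hx
  have hy0 := ne_zero_of_notMem_pE hy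
  rwa [show x * y * (x⁻¹ * y⁻¹) = 1 by field_simp] at h1

lemma mem_pE_of_norm {x : S.E} {k : ℤ} (h : x * S.conj x ∈ S.pE (2 * k - 1)) : x ∈ S.pE k := by
  by_contra hx
  exact mul_notMem_pE hx (fun h' => hx (conj_mem_pE_iff.1 h')) (by omega) h

lemma exists_pE (x : S.E) : ∃ k : ℕ, x ∈ S.pE (-k) := by
  by_cases hx : x = 0
  · exact ⟨0, by simp [hx]⟩
  · obtain ⟨n, u, hu⟩ := S.disc x hx
    refine ⟨n.natAbs, pE_mono (k := n) ⟨u, (u : S.O).2, by rw [hu, mul_comm]⟩ (by omega)⟩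

lemma natCast_mem_O (n : ℕ) : (n : S.E) ∈ S.pE 0 := mem_pE_zero.2 (natCast_mem S.O n)

lemma p_mem_pE : (S.p : S.E) ∈ S.pE 1 := by
  by_contra h
  have h2 : ((S.q ^ 2 : ℕ) : S.kE) = 0 := by
    rw [← S.card_res]
    exact Nat.cast_card_eq_zero _
  have h3 : ((S.q ^ 2 : ℕ) : S.O) ∈ S.mI := by
    rw [← Ideal.Quotient.eq_zero_iff_mem]
    simpa using h2
  obtain ⟨y, hy, hy2⟩ := (S.hmI _).1 h3
  have h4 : (S.p : S.E) ^ (S.fdeg * 2) ∈ S.pE 1 := ⟨y, hy, by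
    have := hy2
    simp only [S.hq] at this
    push_cast at this
    rw [← pow_mul] at this
    simpa using this⟩
  have h5 : ∀ n : ℕ, (S.p : S.E) ^ n ∉ S.pE 1 := by
    intro n
    induction n with
    | zero => simpa using one_notMem_pE
    | succ n ih => rw [pow_succ]; exact mul_notMem_pE ih h (by omega)
  exact h5 _ h4

/-- There is a unit of trace zero. -/
lemma exists_trace_zero : ∃ d : S.E, d ∈ S.pE 0 ∧ d ∉ S.pE 1 ∧ d + S.conj d = 0 := by
  obtain ⟨z, hz⟩ : ∃ z, S.conj z ≠ z := by
    by_contra! h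
    exact S.conj_ne (RingHom.ext h)
  have hd : z - S.conj z ≠ 0 := sub_ne_zero.2 (Ne.symm hz)
  obtain ⟨n, u, hu⟩ := S.disc _ hd
  have hu1 : ((u : S.O) : S.E) = S.ϖ ^ (-n) * (z - S.conj z) := by
    rw [hu, zpow_neg]
    field_simp [zpow_ne_zero n S.unif_ne]
  refine ⟨(u : S.O), mem_pE_zero.2 (u : S.O).2, fun h => ?_, ?_⟩
  · apply one_notMem_pE (S := S)
    have := pE_mul 1 h (mem_pE_zero.2 ((u⁻¹ : S.Oˣ) : S.O).2) (by omega)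
    rwa [← Subring.coe_mul, Units.mul_inv, Subring.coe_one] at this
  · rw [hu1]
    simp [map_zpow₀, S.unif_conj, S.conj_invol]
    ring

end Setting

end U21

namespace U21

namespace Setting

variable {S : Setting}

@[simp] lemma rev_zero3 : Fin.rev (0 : Fin 3) = 2 := rfl
@[simp] lemma rev_one3 : Fin.rev (1 : Fin 3) = 1 := rfl
@[simp] lemma rev_two3 : Fin.rev (2 : Fin 3) = 0 := rfl

lemma mat_mul (g h : S.GG) : S.mat (g * h) = S.mat g * S.mat h := rfl

lemma mat_one : S.mat 1 = 1 := rfl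

lemma mat_mul_apply (g h : S.GG) (i j : Fin 3) :
    S.mat (g * h) i j =
      S.mat g i 0 * S.mat h 0 j + S.mat g i 1 * S.mat h 1 j + S.mat g i 2 * S.mat h 2 j := by
  rw [mat_mul, Matrix.mul_apply, Fin.sum_univ_three]

lemma mat_ext {g h : S.GG} (H : ∀ i j, S.mat g i j = S.mat h i j) : g = h :=
  Subtype.ext (Units.ext (Matrix.ext H))

lemma mat_mul_inv_self (g : S.GG) : S.mat g * S.mat g⁻¹ = 1 := by
  rw [← mat_mul, mul_inv_cancel, mat_one]

lemma mat_form (g : S.GG) :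
    (S.mat g).transpose * S.betaM * (S.mat g).map S.conj = S.betaM := g.2

/-- The adjoint matrix of `M` for the Hermitian form. -/
def adjM (S : Setting) (M : S.M3) : S.M3 := fun i j => S.conj (M (Fin.rev j) (Fin.rev i))

lemma adjM_mul {M : S.M3} (h : M.transpose * S.betaM * M.map S.conj = S.betaM) :
    S.adjM M * M = 1 := by
  ext i j
  have h1 := congrFun (congrFun h (Fin.rev i)) j
  apply_fun S.conj at h1
  fin_cases i <;> fin_cases j <;>
    simp [adjM, betaM, Matrix.mul_apply, Fin.sum_univ_three, S.conj_invol]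
      at h1 ⊢ <;> linear_combination h1

lemma mat_inv (g : S.GG) (i j : Fin 3) :
    S.mat g⁻¹ i j = S.conj (S.mat g (Fin.rev j) (Fin.rev i)) := by
  have h := adjM_mul (mat_form g)
  have : S.mat g⁻¹ = S.adjM (S.mat g) := by
    calc S.mat g⁻¹ = S.adjM (S.mat g) * S.mat g * S.mat g⁻¹ := by rw [h, one_mul]
      _ = _ := by rw [mul_assoc, mat_mul_inv_self, mul_one]
  rw [this]
  rfl

/-- The element of `G` with a given isometric matrix. -/
def ofMat (M : S.M3) (h : M.transpose * S.betaM * M.map S.conj = S.betaM) : S.GG :=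
  ⟨⟨M, S.adjM M, mul_eq_one_comm.1 (adjM_mul h), adjM_mul h⟩, h⟩

@[simp] lemma mat_ofMat (M : S.M3) (h) : S.mat (ofMat M h) = M := rfl

lemma nM_form {x y : S.E} (h : x * S.conj x + y + S.conj y = 0) :
    (S.nM x y).transpose * S.betaM * (S.nM x y).map S.conj = S.betaM := by
  ext i j
  fin_cases i <;> fin_cases j <;>
    simp [nM, betaM, Matrix.mul_apply, Fin.sum_univ_three, S.conj_invol]
  linear_combination h

lemma n'M_form {x y : S.E} (h : x * S.conj x + y + S.conj y = 0) :
    (S.n'M x y).transpose * S.betaM * (S.n'M x y).map S.conj = S.betaM := by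
  ext i j
  fin_cases i <;> fin_cases j <;>
    simp [n'M, betaM, Matrix.mul_apply, Fin.sum_univ_three, S.conj_invol]
  linear_combination h

/-- The element `n(x, y)` of `G`. -/
def nE (x y : S.E) (h : x * S.conj x + y + S.conj y = 0) : S.GG := ofMat (S.nM x y) (nM_form h)

/-- The element `n'(x, y)` of `G`. -/
def n'E (x y : S.E) (h : x * S.conj x + y + S.conj y = 0) : S.GG :=
  ofMat (S.n'M x y) (n'M_form h)

@[simp] lemma mat_nE (x y : S.E) (h) : S.mat (nE x y h) = S.nM x y := rfl
@[simp] lemma mat_n'E (x y : S.E) (h) : S.mat (n'E x y h) = S.n'M x y := rfl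

lemma diag_form {d : S.E} (h : d * S.conj d = 1) :
    (!![1, 0, 0; 0, d, 0; 0, 0, 1] : S.M3).transpose * S.betaM *
      (!![1, 0, 0; 0, d, 0; 0, 0, 1] : S.M3).map S.conj = S.betaM := by
  ext i j
  fin_cases i <;> fin_cases j <;>
    simp [betaM, Matrix.mul_apply, Fin.sum_univ_three, h]

/-- The relations between the columns of an element of `G`. -/
lemma col_rel (g : S.GG) (i j : Fin 3) :
    S.mat g 0 i * S.conj (S.mat g 2 j) + S.mat g 1 i * S.conj (S.mat g 1 j) +
      S.mat g 2 i * S.conj (S.mat g 0 j) = S.betaM i j := by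
  have h1 := congrFun (congrFun (mat_form g) i) j
  simp [betaM, Matrix.mul_apply, Fin.sum_univ_three] at h1 ⊢
  linear_combination h1

/-- The relations between the rows of an element of `G`. -/
lemma row_rel (g : S.GG) (i j : Fin 3) :
    S.mat g i 0 * S.conj (S.mat g j 2) + S.mat g i 1 * S.conj (S.mat g j 1) +
      S.mat g i 2 * S.conj (S.mat g j 0) = S.betaM i j := by
  have h1 := congrFun (congrFun (mat_mul_inv_self g) i) (Fin.rev j)
  rw [Matrix.mul_apply, Fin.sum_univ_three] at h1
  simp only [mat_inv, Fin.rev_rev, rev_zero3, rev_one3, rev_two3] at h1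
  rw [h1]
  rw [Matrix.one_apply]
  fin_cases i <;> fin_cases j <;> simp [betaM, Fin.ext_iff]

lemma mat_alpha_mul (g : S.GG) (i j : Fin 3) :
    S.mat (S.alphaE * g) i j = S.ϖ ^ ((i : ℤ) - 1) * S.mat g i j := by
  have : S.mat S.alphaE = S.alphaM := rfl
  rw [mat_mul_apply, this]
  fin_cases i <;> simp [alphaM]

lemma mat_mul_alpha (g : S.GG) (i j : Fin 3) :
    S.mat (g * S.alphaE) i j = S.ϖ ^ ((j : ℤ) - 1) * S.mat g i j := by
  have : S.mat S.alphaE = S.alphaM := rfl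
  rw [mat_mul_apply, this]
  fin_cases j <;> simp [alphaM, mul_comm]

lemma mat_alphaInv_mul (g : S.GG) (i j : Fin 3) :
    S.mat (S.alphaE⁻¹ * g) i j = S.ϖ ^ (1 - (i : ℤ)) * S.mat g i j := by
  have := mat_alpha_mul (S.alphaE⁻¹ * g) i j
  rw [mul_inv_cancel_left] at this
  rw [this, ← mul_assoc, ← zpow_add₀ S.unif_ne]
  simp

lemma mat_mul_alphaInv (g : S.GG) (i j : Fin 3) :
    S.mat (g * S.alphaE⁻¹) i j = S.ϖ ^ (1 - (j : ℤ)) * S.mat g i j := by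
  have := mat_mul_alpha (g * S.alphaE⁻¹) i j
  rw [inv_mul_cancel_right] at this
  rw [this, ← mul_assoc, ← zpow_add₀ S.unif_ne]
  simp

lemma mat_beta_mul (g : S.GG) (i j : Fin 3) :
    S.mat (S.betaE * g) i j = S.mat g (Fin.rev i) j := by
  have : S.mat S.betaE = S.betaM := rfl
  rw [mat_mul_apply, this]
  fin_cases i <;> simp [betaM]

lemma mat_mul_beta (g : S.GG) (i j : Fin 3) :
    S.mat (g * S.betaE) i j = S.mat g i (Fin.rev j) := by
  have : S.mat S.betaE = S.betaM := rfl
  rw [mat_mul_apply, this]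
  fin_cases j <;> simp [betaM]

lemma mat_betaPr_mul (g : S.GG) (i j : Fin 3) :
    S.mat (S.betaPr * g) i j = S.ϖ ^ ((i : ℤ) - 1) * S.mat g (Fin.rev i) j := by
  rw [betaPr, mul_assoc, mat_beta_mul, mat_alphaInv_mul]
  congr 2
  fin_cases i <;> simp

lemma mat_mul_betaPr (g : S.GG) (i j : Fin 3) :
    S.mat (g * S.betaPr) i j = S.ϖ ^ (1 - (j : ℤ)) * S.mat g i (Fin.rev j) := by
  rw [betaPr, ← mul_assoc, mat_mul_alphaInv, mat_mul_beta]

lemma beta_mul_self : S.betaE * S.betaE = 1 := by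
  refine mat_ext fun i j => ?_
  rw [mat_beta_mul]
  have : S.mat S.betaE = S.betaM := rfl
  rw [this, mat_one]
  fin_cases i <;> fin_cases j <;> simp [betaM]

lemma betaPr_eq : S.betaPr = S.alphaE * S.betaE := by
  refine mat_ext fun i j => ?_
  rw [betaPr, mat_mul_alphaInv, mat_alpha_mul]
  have : S.mat S.betaE = S.betaM := rfl
  rw [this]
  fin_cases i <;> fin_cases j <;> simp [betaM]

lemma betaPr_mul_self : S.betaPr * S.betaPr = 1 := by
  nth_rewrite 1 [betaPr_eq]
  rw [betaPr, mul_assoc, ← mul_assoc S.betaE, beta_mul_self, one_mul, mul_inv_cancel]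

lemma betaPr_inv : S.betaPr⁻¹ = S.betaPr := inv_eq_of_mul_eq_one_left betaPr_mul_self

lemma mat_betaPr (i j : Fin 3) : S.mat S.betaPr i j = S.ϖ ^ ((i : ℤ) - 1) * S.betaM i j := by
  rw [betaPr_eq, mat_alpha_mul]
  rfl

/-- The subgroup of `G` defined by lower bounds for the valuations of the entries. -/
def latS (S : Setting) (e : Fin 3 → Fin 3 → ℤ) (h0 : ∀ i, e i i = 0)
    (h1 : ∀ i j k, e i k ≤ e i j + e j k) (h2 : ∀ i j, e (Fin.rev j) (Fin.rev i) = e i j) :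
    Subgroup S.GG where
  carrier := {g | ∀ i j, S.mat g i j ∈ S.pE (e i j)}
  one_mem' := by
    intro i j
    rw [mat_one, Matrix.one_apply]
    split_ifs with h
    · rw [← h, h0]; exact one_mem_pE
    · exact zero_mem_pE _
  mul_mem' := by
    intro a b ha hb i j
    rw [mat_mul_apply]
    exact pE_add (pE_add (pE_mul _ (ha i 0) (hb 0 j) (h1 _ _ _))
      (pE_mul _ (ha i 1) (hb 1 j) (h1 _ _ _))) (pE_mul _ (ha i 2) (hb 2 j) (h1 _ _ _))
  inv_mem' := by
    intro a ha i j
    rw [mat_inv, ← h2 i j]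
    exact conj_mem_pE (ha _ _)

/-- The bounds defining `K₁`. -/
def eK : Fin 3 → Fin 3 → ℤ := ![![0, 0, -1], ![1, 0, 0], ![1, 1, 0]]

/-- The bounds defining the Iwahori subgroup of `K₀`. -/
def eI : Fin 3 → Fin 3 → ℤ := ![![0, 0, 0], ![1, 0, 0], ![1, 1, 0]]

/-- The subgroup `K₁`. -/
def K1S (S : Setting) : Subgroup S.GG := S.latS eK (by decide) (by decide) (by decide)

/-- The subgroup `K₀`. -/
def K0S (S : Setting) : Subgroup S.GG := S.latS 0 (by decide) (by decide) (by decide)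

/-- The Iwahori subgroup of `K₀`. -/
def IS (S : Setting) : Subgroup S.GG := S.latS eI (by decide) (by decide) (by decide)

lemma mem_K1S {g : S.GG} : g ∈ S.K1S ↔ ∀ i j, S.mat g i j ∈ S.pE (eK i j) := Iff.rfl
lemma mem_K0S {g : S.GG} : g ∈ S.K0S ↔ ∀ i j, S.mat g i j ∈ S.pE 0 := Iff.rfl
lemma mem_IS {g : S.GG} : g ∈ S.IS ↔ ∀ i j, S.mat g i j ∈ S.pE (eI i j) := Iff.rfl

lemma forall_fin3 {P : Fin 3 → Fin 3 → Prop} : (∀ i j, P i j) ↔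
    P 0 0 ∧ P 0 1 ∧ P 0 2 ∧ P 1 0 ∧ P 1 1 ∧ P 1 2 ∧ P 2 0 ∧ P 2 1 ∧ P 2 2 := by
  simp [Fin.forall_fin_succ, and_assoc]

lemma K1S_eq : (S.K1S : Set S.GG) = S.K1set := by
  ext g
  simp only [SetLike.mem_coe, mem_K1S, forall_fin3, K1set, Set.mem_ofPred_eq, ← mem_pE_zero]
  rfl

lemma IS_le_K0S : S.IS ≤ S.K0S := fun g hg i j =>
  pE_mono (hg i j) (by revert i j; decide)

lemma betaPr_mem_K1S : S.betaPr ∈ S.K1S := by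
  rw [mem_K1S]
  intro i j
  rw [mat_betaPr, zpow_mul_mem_pE]
  fin_cases i <;> fin_cases j <;> simp [betaM, eK, one_mem_pE]

lemma beta_mem_K0S : S.betaE ∈ S.K0S := by
  rw [mem_K0S]
  intro i j
  have : S.mat S.betaE = S.betaM := rfl
  rw [this]
  fin_cases i <;> fin_cases j <;> simp [betaM, one_mem_pE]

lemma mem_Nk_iff {g : S.GG} {k : ℤ} : g ∈ S.Nk k ↔ S.mat g 0 0 = 1 ∧ S.mat g 1 1 = 1 ∧
    S.mat g 2 2 = 1 ∧ S.mat g 1 0 = 0 ∧ S.mat g 2 0 = 0 ∧ S.mat g 2 1 = 0 ∧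
    S.mat g 1 2 = - S.conj (S.mat g 0 1) ∧
    S.mat g 0 1 * S.conj (S.mat g 0 1) + S.mat g 0 2 + S.conj (S.mat g 0 2) = 0 ∧
    S.mat g 0 2 ∈ S.pE k := by
  constructor
  · rintro ⟨x, y, h, hy, hg⟩
    rw [hg]
    simp [nM, h, hy]
  · rintro ⟨h1, h2, h3, h4, h5, h6, h7, h8, h9⟩
    refine ⟨_, _, h8, h9, ?_⟩
    ext i j
    fin_cases i <;> fin_cases j <;> simp [nM, *]

lemma trace_mem_pE {x y : S.E} {k : ℤ} (h : x * S.conj x + y + S.conj y = 0) (hy : y ∈ S.pE k)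
    (m : ℤ) (hm : 2 * m - 1 ≤ k) : x ∈ S.pE m := by
  apply mem_pE_of_norm
  rw [show x * S.conj x = -(y + S.conj y) by linear_combination h]
  exact pE_mono (pE_neg (pE_add hy (conj_mem_pE hy))) hm

/-- The subgroup `N_k`. -/
def NS (S : Setting) (k : ℤ) : Subgroup S.GG where
  carrier := S.Nk k
  one_mem' := by
    rw [mem_Nk_iff]
    simp [mat_one]
  mul_mem' := by
    intro a b ha hb
    rw [mem_Nk_iff] at *
    obtain ⟨h1, h2, h3, h4, h5, h6, h7, h8, h9⟩ := ha
    obtain ⟨g1, g2, g3, g4, g5, g6, g7, g8, g9⟩ := hb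
    have hx := trace_mem_pE h8 h9 ((k + 1) / 2) (by omega)
    have hx' := trace_mem_pE g8 g9 ((k + 1) / 2) (by omega)
    simp only [mat_mul_apply, h1, h2, h3, h4, h5, h6, h7, g1, g2, g3, g4, g5, g6, g7, map_add,
      map_mul, map_one, map_zero, map_neg, S.conj_invol]
    refine ⟨by ring, by ring, by ring, by ring, by ring, by ring, by ring,
      by linear_combination h8 + g8, ?_⟩
    refine pE_add (pE_add (by simpa using g9) ?_) (by simpa using h9)
    exact pE_mul k hx (pE_neg (conj_mem_pE hx')) (by omega)
  inv_mem' := by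
    intro a ha
    rw [mem_Nk_iff] at *
    obtain ⟨h1, h2, h3, h4, h5, h6, h7, h8, h9⟩ := ha
    simp only [mat_inv, rev_zero3, rev_one3, rev_two3, h1, h2, h3, h4, h5, h6, h7, map_neg,
      map_one, map_zero, S.conj_invol]
    exact ⟨trivial, trivial, trivial, trivial, trivial, trivial, by ring,
      by linear_combination h8, conj_mem_pE h9⟩

lemma mem_NS {g : S.GG} {k : ℤ} : g ∈ S.NS k ↔ g ∈ S.Nk k := Iff.rfl

lemma NS_mono {k l : ℤ} (h : l ≤ k) : S.NS k ≤ S.NS l := by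
  rintro g ⟨x, y, h1, h2, h3⟩
  exact ⟨x, y, h1, pE_mono h2 h, h3⟩

lemma nE_mem {x y : S.E} (h) {k : ℤ} (hy : y ∈ S.pE k) : nE x y h ∈ S.NS k :=
  ⟨x, y, h, hy, rfl⟩

lemma NS_le_K1S : S.NS (-1) ≤ S.K1S := by
  rintro g ⟨x, y, h1, h2, h3⟩ i j
  have hx := trace_mem_pE h1 h2 0 (by omega)
  rw [h3]
  fin_cases i <;> fin_cases j <;>
    simp [nM, eK, one_mem_pE, hx, h2, pE_neg_iff, conj_mem_pE_iff]

lemma NS_le_IS : S.NS 0 ≤ S.IS := by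
  rintro g ⟨x, y, h1, h2, h3⟩ i j
  have hx := trace_mem_pE h1 h2 0 (by omega)
  rw [h3]
  fin_cases i <;> fin_cases j <;>
    simp [nM, eI, one_mem_pE, hx, h2, pE_neg_iff, conj_mem_pE_iff]

lemma alpha_conj_NS {g : S.GG} {k : ℤ} (hg : g ∈ S.NS k) :
    S.alphaE * g * S.alphaE⁻¹ ∈ S.NS (k - 2) := by
  rw [mem_NS, mem_Nk_iff] at *
  obtain ⟨h1, h2, h3, h4, h5, h6, h7, h8, h9⟩ := hg
  simp only [mat_mul_alphaInv, mat_alpha_mul, h1, h2, h3, h4, h5, h6, h7]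
  have h10 : S.mat g 0 1 * S.conj (S.mat g 0 1) = -(S.mat g 0 2 + S.conj (S.mat g 0 2)) := by
    linear_combination h8
  have hu := S.unif_ne
  simp [S.unif_conj, hu]
  constructor
  · field_simp
    linear_combination h8
  · rw [unif_inv_mul_mem_pE, unif_inv_mul_mem_pE]
    exact pE_mono h9 (by omega)

lemma alphaInv_conj_NS {g : S.GG} {k : ℤ} (hg : g ∈ S.NS k) :
    S.alphaE⁻¹ * g * S.alphaE ∈ S.NS (k + 2) := by
  rw [mem_NS, mem_Nk_iff] at *
  obtain ⟨h1, h2, h3, h4, h5, h6, h7, h8, h9⟩ := hg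
  simp only [mat_mul_alpha, mat_alphaInv_mul, h1, h2, h3, h4, h5, h6, h7]
  have hu := S.unif_ne
  simp [S.unif_conj, hu]
  constructor
  · linear_combination S.ϖ ^ 2 * h8
  · rw [unif_mul_mem_pE, unif_mul_mem_pE]
    exact pE_mono h9 (by omega)

end Setting

end U21

namespace U21

namespace Setting

variable {S : Setting}

lemma conj_ne_zero {x : S.E} (h : x ≠ 0) : S.conj x ≠ 0 :=
  (map_ne_zero S.conj).2 h

lemma mem_K1S_of_conj_mem {k : S.GG} (hk : k ∈ S.K1S) (h20 : S.mat k 2 0 ∈ S.pE 3) :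
    S.alphaE⁻¹ * k * S.alphaE ∈ S.K1S := by
  have h10 : S.mat k 1 0 ∈ S.pE 2 := by
    apply mem_pE_of_norm
    have h := col_rel k 0 0
    simp only [betaM, Matrix.of_apply, Matrix.cons_val', Matrix.cons_val_zero] at h
    rw [show S.mat k 1 0 * S.conj (S.mat k 1 0) = -(S.mat k 0 0 * S.conj (S.mat k 2 0) +
      S.mat k 2 0 * S.conj (S.mat k 0 0)) by linear_combination h]
    have h00 : S.mat k 0 0 ∈ S.pE 0 := hk 0 0
    exact pE_neg (pE_add (pE_mul _ h00 (conj_mem_pE h20) (by norm_num))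
      (pE_mul _ h20 (conj_mem_pE h00) (by norm_num)))
  have h21 : S.mat k 2 1 ∈ S.pE 2 := by
    apply mem_pE_of_norm
    have h := row_rel k 2 2
    simp [betaM] at h
    rw [show S.mat k 2 1 * S.conj (S.mat k 2 1) = -(S.mat k 2 0 * S.conj (S.mat k 2 2) +
      S.mat k 2 2 * S.conj (S.mat k 2 0)) by linear_combination h]
    have h22 : S.mat k 2 2 ∈ S.pE 0 := hk 2 2
    exact pE_neg (pE_add (pE_mul _ h20 (conj_mem_pE h22) (by norm_num))
      (pE_mul _ h22 (conj_mem_pE h20) (by norm_num)))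
  rw [mem_K1S, forall_fin3]
  simp only [mat_mul_alpha, mat_alphaInv_mul, zpow_mul_mem_pE]
  have H := fun i j => hk i j
  refine ⟨pE_mono (H 0 0) ?_, pE_mono (H 0 1) ?_, pE_mono (H 0 2) ?_, pE_mono h10 ?_,
    pE_mono (H 1 1) ?_, pE_mono (H 1 2) ?_, pE_mono h20 ?_, pE_mono h21 ?_,
    pE_mono (H 2 2) ?_⟩ <;> simp [eK]

lemma mem_K0S_of_conj_mem {k : S.GG} (hk : k ∈ S.K1S) (h20 : S.mat k 2 0 ∈ S.pE 2) :
    S.alphaE⁻¹ * k * S.alphaE ∈ S.K0S := by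
  rw [mem_K0S, forall_fin3]
  simp only [mat_mul_alpha, mat_alphaInv_mul, zpow_mul_mem_pE]
  have H := fun i j => hk i j
  refine ⟨pE_mono (H 0 0) ?_, pE_mono (H 0 1) ?_, pE_mono (H 0 2) ?_, pE_mono (H 1 0) ?_,
    pE_mono (H 1 1) ?_, pE_mono (H 1 2) ?_, pE_mono h20 ?_, pE_mono (H 2 1) ?_,
    pE_mono (H 2 2) ?_⟩ <;> simp [eK]

lemma col_norm (g : S.GG) : S.mat g 1 0 * S.conj (S.mat g 1 0) =
    -(S.mat g 0 0 * S.conj (S.mat g 2 0) + S.mat g 2 0 * S.conj (S.mat g 0 0)) := by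
  have h := col_rel g 0 0
  simp [betaM] at h
  linear_combination h

/-- Clearing the first column by a lower unipotent element. -/
lemma exists_n'E (g : S.GG) (h : S.mat g 0 0 ≠ 0) :
    ∃ n : S.GG, S.mat n = S.n'M (S.mat g 1 0 / S.mat g 0 0) (S.mat g 2 0 / S.mat g 0 0) ∧
      S.mat (n⁻¹ * g) 0 0 = S.mat g 0 0 ∧ S.mat (n⁻¹ * g) 1 0 = 0 ∧
      S.mat (n⁻¹ * g) 2 0 = 0 := by
  have hc := conj_ne_zero h
  have hn := col_norm g
  have hf : (S.mat g 1 0 / S.mat g 0 0) * S.conj (S.mat g 1 0 / S.mat g 0 0) +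
      S.mat g 2 0 / S.mat g 0 0 + S.conj (S.mat g 2 0 / S.mat g 0 0) = 0 := by
    simp only [map_div₀]
    field_simp
    linear_combination hn
  refine ⟨n'E _ _ hf, rfl, ?_, ?_, ?_⟩
  · simp [mat_mul_apply, mat_inv, n'M]
  · simp [mat_mul_apply, mat_inv, n'M, S.conj_invol]
    field_simp
    ring
  · simp [mat_mul_apply, mat_inv, n'M]
    field_simp
    linear_combination hn

lemma n'M_mem_K1S {n : S.GG} {x y : S.E} (hn : S.mat n = S.n'M x y) (hx : x ∈ S.pE 1)
    (hy : y ∈ S.pE 1) : n ∈ S.K1S := by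
  rw [mem_K1S, forall_fin3, hn]
  simp [n'M, eK, one_mem_pE, hx, hy, pE_neg_iff, conj_mem_pE_iff]

lemma n'M_mem_K0S {n : S.GG} {x y : S.E} (hn : S.mat n = S.n'M x y) (hx : x ∈ S.pE 0)
    (hy : y ∈ S.pE 0) : n ∈ S.K0S := by
  rw [mem_K0S, forall_fin3, hn]
  simp [n'M, one_mem_pE, hx, hy, pE_neg_iff, conj_mem_pE_iff]

lemma col_div_mem {g : S.GG} (h : S.mat g 0 0 ≠ 0) {m k : ℤ} (hk : 2 * m - 1 ≤ k)
    (h2 : S.mat g 2 0 / S.mat g 0 0 ∈ S.pE k) : S.mat g 1 0 / S.mat g 0 0 ∈ S.pE m := by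
  apply mem_pE_of_norm
  have hc := conj_ne_zero h
  have hn := col_norm g
  rw [show S.mat g 1 0 / S.mat g 0 0 * S.conj (S.mat g 1 0 / S.mat g 0 0) =
    -(S.conj (S.mat g 2 0 / S.mat g 0 0) + S.mat g 2 0 / S.mat g 0 0) by
      simp only [map_div₀]
      field_simp
      linear_combination hn]
  exact pE_mono (pE_neg (pE_add (conj_mem_pE h2) h2)) hk

lemma div_mem_pE_of_inv {x y : S.E} {k : ℤ} (h : x = 0 ∨ y / x ∉ S.pE k) :
    x / y ∈ S.pE (1 - k) := by
  rcases h with h | h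
  · simp [h]
  · simpa using inv_mem_pE h

lemma eq_zero_of_col {g : S.GG} (h0 : S.mat g 0 0 = 0) (h2 : S.mat g 2 0 = 0) :
    S.mat g 1 0 = 0 := by
  have hn := col_norm g
  rw [h0, h2] at hn
  by_contra h
  exact mul_ne_zero h (conj_ne_zero h) (by simpa using hn)

/-- Iwasawa decomposition with respect to `K₁`. -/
lemma iwasawa_K1 (g : S.GG) : ∃ k ∈ S.K1S, S.mat (k * g) 1 0 = 0 ∧ S.mat (k * g) 2 0 = 0 := by
  by_cases h : S.mat g 0 0 ≠ 0 ∧ S.mat g 2 0 / S.mat g 0 0 ∈ S.pE 1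
  · obtain ⟨n, hn, -, h1, h2⟩ := exists_n'E g h.1
    exact ⟨n⁻¹, inv_mem (n'M_mem_K1S hn (col_div_mem h.1 (by norm_num) h.2) h.2), h1, h2⟩
  · by_cases h20 : S.mat g 2 0 = 0
    · by_cases h00 : S.mat g 0 0 = 0
      · exact ⟨1, one_mem _, by rw [one_mul]; exact eq_zero_of_col h00 h20,
          by rw [one_mul]; exact h20⟩
      · exact (h ⟨h00, by simp [h20]⟩).elim
    · have hd := div_mem_pE_of_inv (x := S.mat g 0 0) (y := S.mat g 2 0) (k := 1) (by tauto)
      have e00 : S.mat (S.betaPr * g) 0 0 = S.ϖ⁻¹ * S.mat g 2 0 := by simp [mat_betaPr_mul]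
      have e20 : S.mat (S.betaPr * g) 2 0 = S.ϖ * S.mat g 0 0 := by simp [mat_betaPr_mul]
      have hu := S.unif_ne
      have hne : S.mat (S.betaPr * g) 0 0 ≠ 0 := by rw [e00]; positivity
      have hy : S.mat (S.betaPr * g) 2 0 / S.mat (S.betaPr * g) 0 0 ∈ S.pE 1 := by
        rw [e00, e20, show S.ϖ * S.mat g 0 0 / (S.ϖ⁻¹ * S.mat g 2 0) =
          S.ϖ * (S.ϖ * (S.mat g 0 0 / S.mat g 2 0)) by field_simp, unif_mul_mem_pE,
          unif_mul_mem_pE]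
        exact pE_mono hd (by norm_num)
      obtain ⟨n, hn, -, h1, h2⟩ := exists_n'E _ hne
      refine ⟨n⁻¹ * S.betaPr, mul_mem (inv_mem (n'M_mem_K1S hn ?_ hy)) betaPr_mem_K1S, ?_, ?_⟩
      · exact col_div_mem hne (by norm_num) hy
      · rwa [mul_assoc]
      · rwa [mul_assoc]

/-- Iwasawa decomposition with respect to `K₀`. -/
lemma iwasawa_K0 (g : S.GG) : ∃ k ∈ S.K0S, S.mat (k * g) 1 0 = 0 ∧ S.mat (k * g) 2 0 = 0 := by
  by_cases h : S.mat g 0 0 ≠ 0 ∧ S.mat g 2 0 / S.mat g 0 0 ∈ S.pE 0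
  · obtain ⟨n, hn, -, h1, h2⟩ := exists_n'E g h.1
    exact ⟨n⁻¹, inv_mem (n'M_mem_K0S hn (col_div_mem h.1 (by norm_num) h.2) h.2), h1, h2⟩
  · by_cases h20 : S.mat g 2 0 = 0
    · by_cases h00 : S.mat g 0 0 = 0
      · exact ⟨1, one_mem _, by rw [one_mul]; exact eq_zero_of_col h00 h20,
          by rw [one_mul]; exact h20⟩
      · exact (h ⟨h00, by simp [h20]⟩).elim
    · have hd := div_mem_pE_of_inv (x := S.mat g 0 0) (y := S.mat g 2 0) (k := 0) (by tauto)
      have e00 : S.mat (S.betaE * g) 0 0 = S.mat g 2 0 := by simp [mat_beta_mul]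
      have e20 : S.mat (S.betaE * g) 2 0 = S.mat g 0 0 := by simp [mat_beta_mul]
      have hne : S.mat (S.betaE * g) 0 0 ≠ 0 := by rwa [e00]
      have hy : S.mat (S.betaE * g) 2 0 / S.mat (S.betaE * g) 0 0 ∈ S.pE 0 := by
        rw [e00, e20]
        exact pE_mono hd (by norm_num)
      obtain ⟨n, hn, -, h1, h2⟩ := exists_n'E _ hne
      refine ⟨n⁻¹ * S.betaE, mul_mem (inv_mem (n'M_mem_K0S hn ?_ hy)) beta_mem_K0S, ?_, ?_⟩
      · exact col_div_mem hne (by norm_num) hy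
      · rwa [mul_assoc]
      · rwa [mul_assoc]

lemma row_norm (g : S.GG) (i : Fin 3) (hi : i ≠ 1) : S.mat g i 1 * S.conj (S.mat g i 1) =
    -(S.mat g i 0 * S.conj (S.mat g i 2) + S.mat g i 2 * S.conj (S.mat g i 0)) := by
  have h := row_rel g i i
  have : S.betaM i i = 0 := by fin_cases i <;> simp [betaM] at hi ⊢
  linear_combination h + this

lemma alpha_mul_mem_K1S {k : S.GG} (hk : k ∈ S.K0S) (h00 : S.mat k 0 0 ∈ S.pE 1) :
    S.alphaE * k ∈ S.K1S := by
  have H := fun i j => hk i j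
  simp only [Pi.zero_apply] at H
  have h01 : S.mat k 0 1 ∈ S.pE 1 := by
    apply mem_pE_of_norm
    rw [row_norm k 0 (by decide)]
    exact pE_neg (pE_add (pE_mul _ h00 (conj_mem_pE (H 0 2)) (by norm_num))
      (pE_mul _ (H 0 2) (conj_mem_pE h00) (by norm_num)))
  have h02 : S.mat k 0 2 ∉ S.pE 1 := by
    intro h02
    have h := row_rel k 0 2
    rw [show S.betaM 0 2 = 1 from rfl] at h
    apply one_notMem_pE (S := S)
    rw [← h]
    exact pE_add (pE_add (pE_mul _ h00 (conj_mem_pE (H 2 2)) (by norm_num))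
      (pE_mul _ h01 (conj_mem_pE (H 2 1)) (by norm_num)))
      (pE_mul _ h02 (conj_mem_pE (H 2 0)) (by norm_num))
  have h10 : S.mat k 1 0 ∈ S.pE 1 := by
    by_contra h10
    refine mul_notMem_pE (k := 1) h02 (fun h' => h10 (conj_mem_pE_iff.1 h')) (by norm_num) ?_
    have h := row_rel k 0 1
    rw [show S.betaM 0 1 = 0 from rfl] at h
    rw [show S.mat k 0 2 * S.conj (S.mat k 1 0) = -(S.mat k 0 0 * S.conj (S.mat k 1 2) +
      S.mat k 0 1 * S.conj (S.mat k 1 1)) by linear_combination h]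
    exact pE_neg (pE_add (pE_mul _ h00 (conj_mem_pE (H 1 2)) (by norm_num))
      (pE_mul _ h01 (conj_mem_pE (H 1 1)) (by norm_num)))
  rw [mem_K1S, forall_fin3]
  simp only [mat_alpha_mul, zpow_mul_mem_pE]
  refine ⟨pE_mono h00 ?_, pE_mono h01 ?_, pE_mono (H 0 2) ?_, pE_mono h10 ?_,
    pE_mono (H 1 1) ?_, pE_mono (H 1 2) ?_, pE_mono (H 2 0) ?_, pE_mono (H 2 1) ?_,
    pE_mono (H 2 2) ?_⟩ <;> simp [eK]

lemma exists_NS_alpha_conj {k : S.GG} (hk : k ∈ S.K0S) (h00 : S.mat k 0 0 ∉ S.pE 1) :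
    ∃ u ∈ S.NS 0, S.alphaE * (k * u) * S.alphaE⁻¹ ∈ S.K1S := by
  have H := fun i j => hk i j
  simp only [Pi.zero_apply] at H
  have ha := ne_zero_of_notMem_pE h00
  have hc := conj_ne_zero ha
  have hn := row_norm k 0 (by decide)
  have hf : (-S.mat k 0 1 / S.mat k 0 0) * S.conj (-S.mat k 0 1 / S.mat k 0 0) +
      S.conj (S.mat k 0 2 / S.mat k 0 0) + S.conj (S.conj (S.mat k 0 2 / S.mat k 0 0)) = 0 := by
    simp only [map_div₀, map_neg, S.conj_invol]
    field_simp
    linear_combination hn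
  have hu : nE _ _ hf ∈ S.NS 0 :=
    nE_mem hf (conj_mem_pE (div_mem_pE 0 h00 (H 0 2) (by norm_num)))
  refine ⟨_, hu, ?_⟩
  have hm : k * nE _ _ hf ∈ S.K0S := mul_mem hk (IS_le_K0S (NS_le_IS hu))
  have m00 : S.mat (k * nE _ _ hf) 0 0 = S.mat k 0 0 := by simp [mat_mul_apply, nM]
  have m01 : S.mat (k * nE _ _ hf) 0 1 = 0 := by
    simp [mat_mul_apply, nM]
    field_simp
    ring
  have m02 : S.mat (k * nE _ _ hf) 0 2 = 0 := by
    simp [mat_mul_apply, nM]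
    field_simp
    linear_combination hn
  set m := k * nE _ _ hf
  have m12 : S.mat m 1 2 = 0 := by
    have h := row_rel m 1 0
    rw [m00, m01, m02, show S.betaM 1 0 = 0 from rfl] at h
    simpa [hc, ha] using h
  have M := fun i j => hm i j
  simp only [Pi.zero_apply] at M
  rw [mem_K1S, forall_fin3]
  simp only [mat_mul_alphaInv, mat_alpha_mul, zpow_mul_mem_pE, m01, m02, m12, zero_mem_pE,
    true_and]
  refine ⟨pE_mono (M 0 0) ?_, pE_mono (M 1 0) ?_, pE_mono (M 1 1) ?_, pE_mono (M 2 0) ?_,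
    pE_mono (M 2 1) ?_, pE_mono (M 2 2) ?_⟩ <;> simp [eK]

lemma IS_00_notMem {k : S.GG} (hk : k ∈ S.IS) : S.mat k 0 0 ∉ S.pE 1 := by
  intro h00
  have h := col_rel k 0 2
  rw [show S.betaM 0 2 = 1 from rfl] at h
  apply one_notMem_pE (S := S)
  rw [← h]
  have h10 : S.mat k 1 0 ∈ S.pE 1 := hk 1 0
  have h20 : S.mat k 2 0 ∈ S.pE 1 := hk 2 0
  have h22 : S.mat k 2 2 ∈ S.pE 0 := hk 2 2
  have h12 : S.mat k 1 2 ∈ S.pE 0 := hk 1 2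
  have h02 : S.mat k 0 2 ∈ S.pE 0 := hk 0 2
  exact pE_add (pE_add (pE_mul _ h00 (conj_mem_pE h22) (by norm_num))
    (pE_mul _ h10 (conj_mem_pE h12) (by norm_num)))
    (pE_mul _ h20 (conj_mem_pE h02) (by norm_num))

lemma mem_IS_of_20 {k : S.GG} (hk : k ∈ S.K0S) (h20 : S.mat k 2 0 ∈ S.pE 1) : k ∈ S.IS := by
  have H := fun i j => hk i j
  simp only [Pi.zero_apply] at H
  have h10 : S.mat k 1 0 ∈ S.pE 1 := by
    apply mem_pE_of_norm
    rw [col_norm]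
    exact pE_neg (pE_add (pE_mul _ (H 0 0) (conj_mem_pE h20) (by norm_num))
      (pE_mul _ h20 (conj_mem_pE (H 0 0)) (by norm_num)))
  have h21 : S.mat k 2 1 ∈ S.pE 1 := by
    apply mem_pE_of_norm
    rw [row_norm k 2 (by decide)]
    exact pE_neg (pE_add (pE_mul _ h20 (conj_mem_pE (H 2 2)) (by norm_num))
      (pE_mul _ (H 2 2) (conj_mem_pE h20) (by norm_num)))
  rw [mem_IS, forall_fin3]
  exact ⟨H _ _, H _ _, H _ _, h10, H _ _, H _ _, h20, h21, H _ _⟩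

/-- Bruhat decomposition of `K₀`. -/
lemma bruhat_K0 {k : S.GG} (hk : k ∈ S.K0S) :
    k ∈ S.IS ∨ ∃ u ∈ S.NS 0, S.betaE * (u * k) ∈ S.IS := by
  by_cases h20 : S.mat k 2 0 ∈ S.pE 1
  · exact Or.inl (mem_IS_of_20 hk h20)
  right
  have H := fun i j => hk i j
  simp only [Pi.zero_apply] at H
  have ha := ne_zero_of_notMem_pE h20
  have hc := conj_ne_zero ha
  have hn := col_norm k
  have hf : S.conj (S.mat k 1 0 / S.mat k 2 0) * S.conj (S.conj (S.mat k 1 0 / S.mat k 2 0)) +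
      S.conj (S.mat k 0 0 / S.mat k 2 0) + S.conj (S.conj (S.mat k 0 0 / S.mat k 2 0)) = 0 := by
    simp only [map_div₀, S.conj_invol]
    field_simp
    linear_combination hn
  have hu : nE _ _ hf ∈ S.NS 0 :=
    nE_mem hf (conj_mem_pE (div_mem_pE 0 h20 (H 0 0) (by norm_num)))
  refine ⟨_, hu, mem_IS_of_20 (mul_mem beta_mem_K0S
    (mul_mem (IS_le_K0S (NS_le_IS hu)) hk)) ?_⟩
  rw [mat_beta_mul]
  convert zero_mem_pE 1
  simp [mat_mul_apply, nM]
  field_simp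
  linear_combination hn

end Setting

end U21

namespace U21

namespace Setting

variable {S : Setting}

lemma mem_Kone1_iff {g : S.GG} : g ∈ S.Kone1 ↔ g ∈ S.K1S ∧ S.mat g 0 2 ∈ S.pE 0 ∧
    S.mat g 2 0 ∈ S.pE 2 ∧ S.mat g 0 0 - 1 ∈ S.pE 1 ∧ S.mat g 1 1 - 1 ∈ S.pE 1 ∧
    S.mat g 2 2 - 1 ∈ S.pE 1 := by
  rw [mem_pE_zero, ← SetLike.mem_coe, K1S_eq]
  rfl

lemma mem_I1K1_iff {g : S.GG} : g ∈ S.I1K1 ↔ g ∈ S.K1S ∧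
    S.mat g 2 0 ∈ S.pE 2 ∧ S.mat g 0 0 - 1 ∈ S.pE 1 ∧ S.mat g 1 1 - 1 ∈ S.pE 1 ∧
    S.mat g 2 2 - 1 ∈ S.pE 1 := by
  rw [← SetLike.mem_coe, K1S_eq, ← and_assoc]
  rfl

lemma mem_I1'K1_iff {g : S.GG} : g ∈ S.I1'K1 ↔ g ∈ S.K1S ∧
    S.mat g 0 2 ∈ S.pE 0 ∧ S.mat g 0 0 - 1 ∈ S.pE 1 ∧ S.mat g 1 1 - 1 ∈ S.pE 1 ∧
    S.mat g 2 2 - 1 ∈ S.pE 1 := by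
  rw [mem_pE_zero, ← SetLike.mem_coe, K1S_eq]
  rfl

lemma NS_zero_subset_Kone1 {g : S.GG} (hg : g ∈ S.NS 0) : g ∈ S.Kone1 := by
  rw [mem_Kone1_iff]
  refine ⟨NS_le_K1S (NS_mono (by norm_num) hg), ?_⟩
  rw [mem_NS, mem_Nk_iff] at hg
  obtain ⟨h1, h2, h3, h4, h5, h6, h7, h8, h9⟩ := hg
  simp [h1, h2, h3, h5, h9]

lemma NS_subset_I1K1 {g : S.GG} (hg : g ∈ S.NS (-1)) : g ∈ S.I1K1 := by
  rw [mem_I1K1_iff]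
  refine ⟨NS_le_K1S hg, ?_⟩
  rw [mem_NS, mem_Nk_iff] at hg
  obtain ⟨h1, h2, h3, h4, h5, h6, h7, h8, h9⟩ := hg
  simp [h1, h2, h3, h5]

lemma upper_21 {g : S.GG} (h00 : S.mat g 0 0 ≠ 0) (h10 : S.mat g 1 0 = 0)
    (h20 : S.mat g 2 0 = 0) : S.mat g 2 1 = 0 := by
  have h := col_rel g 0 1
  rw [h10, h20, show S.betaM 0 1 = 0 from rfl] at h
  simpa [h00] using h

lemma upper_00_ne {g : S.GG} (h10 : S.mat g 1 0 = 0) (h20 : S.mat g 2 0 = 0) :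
    S.mat g 0 0 ≠ 0 := by
  intro h0
  have h := col_rel g 0 2
  rw [h10, h20, h0, show S.betaM 0 2 = 1 from rfl] at h
  simp at h

lemma mem_NS_of {g : S.GG} {k : ℤ} (h00 : S.mat g 0 0 = 1) (h11 : S.mat g 1 1 = 1)
    (h22 : S.mat g 2 2 = 1) (h10 : S.mat g 1 0 = 0) (h20 : S.mat g 2 0 = 0)
    (h02 : S.mat g 0 2 ∈ S.pE k) : g ∈ S.NS k := by
  rw [mem_NS, mem_Nk_iff]
  have h21 := upper_21 (by rw [h00]; exact one_ne_zero) h10 h20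
  refine ⟨h00, h11, h22, h10, h20, h21, ?_, ?_, h02⟩
  · have h := row_rel g 1 0
    rw [h10, h11, h00, show S.betaM 1 0 = 0 from rfl, map_one] at h
    linear_combination h
  · have h := row_rel g 0 0
    rw [h00, show S.betaM 0 0 = 0 from rfl, map_one] at h
    linear_combination h

/-- Upper triangular elements of `K₁` normalize `N_{-1}`. -/
lemma upper_conj_NS {b n : S.GG} (hb : b ∈ S.K1S) (h10 : S.mat b 1 0 = 0)
    (h20 : S.mat b 2 0 = 0) (hn : n ∈ S.NS (-1)) : b⁻¹ * n * b ∈ S.NS (-1) := by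
  have hK : b⁻¹ * n * b ∈ S.K1S := mul_mem (mul_mem (inv_mem hb) (NS_le_K1S hn)) hb
  rw [mem_NS, mem_Nk_iff] at hn
  obtain ⟨h1, h2, h3, h4, h5, h6, h7, h8, h9⟩ := hn
  have h00 := upper_00_ne h10 h20
  have h21 := upper_21 h00 h10 h20
  have c02 := col_rel b 0 2
  have c11 := col_rel b 1 1
  rw [h10, h20, show S.betaM 0 2 = 1 from rfl] at c02
  rw [h21, show S.betaM 1 1 = 1 from rfl] at c11
  simp at c02 c11
  have c02' := congrArg S.conj c02
  simp [S.conj_invol] at c02'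
  refine mem_NS_of ?_ ?_ ?_ ?_ ?_ (hK 0 2)
  all_goals
    simp only [mat_mul_apply, mat_inv, rev_zero3, rev_one3, rev_two3, h1, h2, h3, h4, h5, h6, h10,
      h20, h21, map_zero]
  · linear_combination c02
  · linear_combination c11
  · linear_combination c02'
  · ring
  · ring

/-- The decomposition of elements of the big cell of `K₁`. -/
lemma K1_big_cell {k : S.GG} (hk : k ∈ S.K1S) (h00 : S.mat k 0 0 ∉ S.pE 1) :
    ∃ n ∈ S.I1'K1, n⁻¹ * k ∈ S.K1S ∧ S.mat (n⁻¹ * k) 1 0 = 0 ∧ S.mat (n⁻¹ * k) 2 0 = 0 ∧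
      S.mat n 2 0 = S.mat k 2 0 / S.mat k 0 0 := by
  obtain ⟨n, hn, -, h1, h2⟩ := exists_n'E k (ne_zero_of_notMem_pE h00)
  have hnK : n ∈ S.K1S := n'M_mem_K1S hn (div_mem_pE _ h00 (hk 1 0) (by simp [eK]))
    (div_mem_pE _ h00 (hk 2 0) (by simp [eK]))
  refine ⟨n, ?_, mul_mem (inv_mem hnK) hk, h1, h2, by rw [hn]; simp [n'M]⟩
  rw [mem_I1'K1_iff]
  refine ⟨hnK, ?_⟩
  rw [hn]
  simp [n'M]

lemma K1_small_cell {k : S.GG} (hk : k ∈ S.K1S) (h00 : S.mat k 0 0 ∈ S.pE 1) :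
    ∃ n ∈ S.Kone1, n⁻¹ * (S.betaPr * k) ∈ S.K1S ∧ S.mat (n⁻¹ * (S.betaPr * k)) 1 0 = 0 ∧
      S.mat (n⁻¹ * (S.betaPr * k)) 2 0 = 0 := by
  have h20 : S.mat k 2 0 ∉ S.pE 2 := by
    intro h20
    have h := col_rel k 0 2
    rw [show S.betaM 0 2 = 1 from rfl] at h
    apply one_notMem_pE (S := S)
    rw [← h]
    have h10 : S.mat k 1 0 ∈ S.pE 1 := hk 1 0
    have h22 : S.mat k 2 2 ∈ S.pE 0 := hk 2 2
    have h12 : S.mat k 1 2 ∈ S.pE 0 := hk 1 2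
    have h02 : S.mat k 0 2 ∈ S.pE (-1) := hk 0 2
    exact pE_add (pE_add (pE_mul _ h00 (conj_mem_pE h22) (by norm_num))
      (pE_mul _ h10 (conj_mem_pE h12) (by norm_num)))
      (pE_mul _ h20 (conj_mem_pE h02) (by norm_num))
  have e00 : S.mat (S.betaPr * k) 0 0 ∉ S.pE 1 := by
    simpa [mat_betaPr_mul, unif_inv_mul_mem_pE] using h20
  have e20 : S.mat (S.betaPr * k) 2 0 ∈ S.pE 2 := by
    simpa [mat_betaPr_mul, unif_mul_mem_pE] using h00
  obtain ⟨n, hn, h1, h2, h3, h4⟩ := K1_big_cell (mul_mem betaPr_mem_K1S hk) e00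
  refine ⟨n, ?_, h1, h2, h3⟩
  rw [mem_I1'K1_iff] at hn
  rw [mem_Kone1_iff]
  refine ⟨hn.1, hn.2.1, ?_, hn.2.2⟩
  rw [h4]
  exact div_mem_pE _ e00 e20 (by norm_num)

/-- `I_{1,K₁}` is contained in `N_{-1} K₁¹`. -/
lemma exists_NS_inv_mul_mem_Kone1 {g : S.GG} (hg : g ∈ S.I1K1) :
    ∃ n ∈ S.NS (-1), n⁻¹ * g ∈ S.Kone1 := by
  rw [mem_I1K1_iff] at hg
  obtain ⟨hK, h20, h00, h11, h22⟩ := hg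
  have hK' := fun i j => hK i j
  have u22 : S.mat g 2 2 ∉ S.pE 1 := fun h => one_notMem_pE (S := S) (by
    simpa using pE_sub h h22)
  have hz := ne_zero_of_notMem_pE u22
  have hc := conj_ne_zero hz
  have hn := col_rel g 2 2
  rw [show S.betaM 2 2 = 0 from rfl] at hn
  have hf : (-S.conj (S.mat g 1 2 / S.mat g 2 2)) * S.conj (-S.conj (S.mat g 1 2 / S.mat g 2 2)) +
      S.mat g 0 2 / S.mat g 2 2 + S.conj (S.mat g 0 2 / S.mat g 2 2) = 0 := by
    simp only [map_div₀, map_neg, S.conj_invol]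
    field_simp
    linear_combination hn
  have hy : S.mat g 0 2 / S.mat g 2 2 ∈ S.pE (-1) := div_mem_pE _ u22 (hK' 0 2) (by simp [eK])
  have hx : S.conj (S.mat g 1 2 / S.mat g 2 2) ∈ S.pE 0 :=
    conj_mem_pE (div_mem_pE _ u22 (hK' 1 2) (by simp [eK]))
  have hnn := nE_mem hf hy
  refine ⟨_, hnn, ?_⟩
  rw [mem_Kone1_iff]
  refine ⟨mul_mem (inv_mem (NS_le_K1S hnn)) hK, ?_, ?_, ?_, ?_, ?_⟩
  · convert zero_mem_pE 0
    simp [mat_mul_apply, mat_inv, nM, S.conj_invol]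
    field_simp
    linear_combination hn
  · simpa [mat_mul_apply, mat_inv, nM, S.conj_invol] using h20
  · have : S.mat ((nE _ _ hf)⁻¹ * g) 0 0 - 1 = (S.mat g 0 0 - 1) +
        S.conj (S.mat g 1 2 / S.mat g 2 2) * S.mat g 1 0 +
        S.conj (S.mat g 0 2 / S.mat g 2 2) * S.mat g 2 0 := by
      simp [mat_mul_apply, mat_inv, nM, S.conj_invol]
      ring
    rw [this]
    exact pE_add (pE_add h00 (pE_mul _ hx (hK' 1 0) (by simp [eK])))
      (pE_mul _ (conj_mem_pE hy) h20 (by norm_num))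
  · have : S.mat ((nE _ _ hf)⁻¹ * g) 1 1 - 1 = (S.mat g 1 1 - 1) -
        S.conj (S.conj (S.mat g 1 2 / S.mat g 2 2)) * S.mat g 2 1 := by
      simp [mat_mul_apply, mat_inv, nM, S.conj_invol]
      ring
    rw [this]
    exact pE_sub h11 (pE_mul _ (conj_mem_pE hx) (hK' 2 1) (by simp [eK]))
  · simpa [mat_mul_apply, mat_inv, nM, S.conj_invol] using h22

lemma NS_inv_mul_mem {n m : S.GG} {l k : ℤ} (hn : n ∈ S.NS l) (hm : m ∈ S.NS l) :
    n⁻¹ * m ∈ S.NS k ↔ S.mat m 0 2 - S.mat n 0 2 +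
      S.mat n 0 1 * S.conj (S.mat m 0 1 - S.mat n 0 1) ∈ S.pE k := by
  have h := mul_mem (inv_mem hn) hm
  have e : S.mat (n⁻¹ * m) 0 2 = S.mat m 0 2 - S.mat n 0 2 +
      S.mat n 0 1 * S.conj (S.mat m 0 1 - S.mat n 0 1) := by
    rw [mem_NS, mem_Nk_iff] at hn hm
    obtain ⟨h1, h2, h3, h4, h5, h6, h7, h8, h9⟩ := hn
    obtain ⟨g1, g2, g3, g4, g5, g6, g7, g8, g9⟩ := hm
    simp only [mat_mul_apply, mat_inv, rev_zero3, rev_one3, rev_two3, h3, h7, g3, g7, map_neg,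
      map_one, S.conj_invol, map_sub]
    linear_combination h8
  rw [← e]
  rw [mem_NS, mem_Nk_iff] at h ⊢
  tauto

lemma NS_mul_01 {n m : S.GG} {l : ℤ} (hn : n ∈ S.NS l) (hm : m ∈ S.NS l) :
    S.mat (n * m) 0 1 = S.mat n 0 1 + S.mat m 0 1 := by
  rw [mem_NS, mem_Nk_iff] at hn hm
  obtain ⟨h1, h2, h3, h4, h5, h6, h7, h8, h9⟩ := hn
  obtain ⟨g1, g2, g3, g4, g5, g6, g7, g8, g9⟩ := hm
  rw [mat_mul_apply, h1, g2, g6]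
  ring

lemma NS_mul_02 {n m : S.GG} {l : ℤ} (hn : n ∈ S.NS l) (hm : m ∈ S.NS l) :
    S.mat (n * m) 0 2 = S.mat n 0 2 + S.mat m 0 2 - S.mat n 0 1 * S.conj (S.mat m 0 1) := by
  rw [mem_NS, mem_Nk_iff] at hn hm
  obtain ⟨h1, h2, h3, h4, h5, h6, h7, h8, h9⟩ := hn
  obtain ⟨g1, g2, g3, g4, g5, g6, g7, g8, g9⟩ := hm
  rw [mat_mul_apply, h1, g3, g7]
  ring

lemma NS_02 {n : S.GG} {l : ℤ} (hn : n ∈ S.NS l) : S.mat n 0 2 ∈ S.pE l := by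
  rw [mem_NS, mem_Nk_iff] at hn
  tauto

lemma NS_01 {n : S.GG} {l : ℤ} (hn : n ∈ S.NS l) (m : ℤ) (hm : 2 * m - 1 ≤ l) :
    S.mat n 0 1 ∈ S.pE m := by
  have h := NS_02 hn
  rw [mem_NS, mem_Nk_iff] at hn
  obtain ⟨h1, h2, h3, h4, h5, h6, h7, h8, h9⟩ := hn
  exact trace_mem_pE h8 h _ hm

/-- Commutators of elements of `N_{-1}` lie in `N_0`. -/
lemma NS_comm {n m : S.GG} (hn : n ∈ S.NS (-1)) (hm : m ∈ S.NS (-1)) :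
    (n * m)⁻¹ * (m * n) ∈ S.NS 0 := by
  rw [NS_inv_mul_mem (mul_mem hn hm) (mul_mem hm hn), NS_mul_01 hn hm, NS_mul_01 hm hn,
    NS_mul_02 hn hm, NS_mul_02 hm hn]
  have h1 := NS_01 hn 0 (by norm_num)
  have h2 := NS_01 hm 0 (by norm_num)
  rw [show S.mat m 0 1 + S.mat n 0 1 - (S.mat n 0 1 + S.mat m 0 1) = 0 by ring,
    show S.mat m 0 2 + S.mat n 0 2 - S.mat m 0 1 * S.conj (S.mat n 0 1) -
    (S.mat n 0 2 + S.mat m 0 2 - S.mat n 0 1 * S.conj (S.mat m 0 1)) =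
    S.mat n 0 1 * S.conj (S.mat m 0 1) - S.mat m 0 1 * S.conj (S.mat n 0 1) by ring]
  simp only [map_zero, mul_zero, add_zero]
  exact pE_sub (pE_mul _ h1 (conj_mem_pE h2) (by norm_num))
    (pE_mul _ h2 (conj_mem_pE h1) (by norm_num))

lemma NS_pow_01 {n : S.GG} {l : ℤ} (hn : n ∈ S.NS l) (m : ℕ) :
    S.mat (n ^ m) 0 1 = m * S.mat n 0 1 := by
  induction m with
  | zero => simp [mat_one]
  | succ m ih => rw [pow_succ, NS_mul_01 (pow_mem hn m) hn, ih]; push_cast; ring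

lemma NS_pow_02 {n : S.GG} {l : ℤ} (hn : n ∈ S.NS l) (m : ℕ) :
    S.mat (n ^ m) 0 2 = m * S.mat n 0 2 -
      (m.choose 2 : ℕ) * (S.mat n 0 1 * S.conj (S.mat n 0 1)) := by
  induction m with
  | zero => simp [mat_one]
  | succ m ih =>
    rw [pow_succ, NS_mul_02 (pow_mem hn m) hn, ih, NS_pow_01 hn, Nat.choose_succ_succ]
    push_cast
    simp
    ring

lemma NS_pow_p {n : S.GG} (hn : n ∈ S.NS (-1)) : n ^ S.p ∈ S.NS 0 := by
  have h := pow_mem hn S.p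
  have h2 : S.mat (n ^ S.p) 0 2 ∈ S.pE 0 := by
    rw [NS_pow_02 hn]
    have h1 := NS_01 hn 0 (by norm_num)
    exact pE_sub (pE_mul _ p_mem_pE (NS_02 hn) (by norm_num))
      (pE_mul _ (natCast_mem_O _) (pE_mul _ h1 (conj_mem_pE h1) le_rfl) (by norm_num))
  rw [mem_NS, mem_Nk_iff] at h ⊢
  tauto

/-- The central element `n(0, ϖ^k d)` with `d` a unit of trace zero: its class modulo `N_{k+1}`
has order `p`. -/
lemma exists_order_p (S : Setting) (k : ℤ) :
    ∃ z ∈ S.NS k, z ∉ S.NS (k + 1) ∧ z ^ S.p ∈ S.NS (k + 1) := by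
  obtain ⟨d, hd0, hd1, hd⟩ := S.exists_trace_zero
  have hf : (0 : S.E) * S.conj 0 + S.ϖ ^ k * d + S.conj (S.ϖ ^ k * d) = 0 := by
    simp only [map_mul, map_zpow₀, S.unif_conj, map_zero]
    linear_combination S.ϖ ^ k * hd
  have hz : nE 0 _ hf ∈ S.NS k := nE_mem hf (zpow_mul_mem_pE.2 (by simpa using hd0))
  refine ⟨_, hz, fun h => hd1 ?_, ?_⟩
  · have := zpow_mul_mem_pE.1 (by simpa [nM] using NS_02 h)
    simpa using this
  · have h := pow_mem hz S.p
    have h2 : S.mat ((nE 0 _ hf) ^ S.p) 0 2 ∈ S.pE (k + 1) := by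
      rw [NS_pow_02 hz]
      simp only [mat_nE, nM]
      simp
      exact pE_mul _ p_mem_pE (zpow_mul_mem_pE (k := k).2 (by simpa using hd0)) (by omega)
    rw [mem_NS, mem_Nk_iff] at h ⊢
    tauto

lemma NS_conj_mem {n m : S.GG} {a : ℤ} (ha : a = -1 ∨ a = 0) (hm : m ∈ S.NS a)
    (hn : n ∈ S.NS (a + 1)) : m⁻¹ * (n * m) ∈ S.NS (a + 1) := by
  have hn' := NS_mono (by omega : a ≤ a + 1) hn
  rw [NS_inv_mul_mem hm (mul_mem hn' hm), NS_mul_01 hn' hm, NS_mul_02 hn' hm]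
  have h1 := NS_01 hn (a + 1) (by omega)
  have h2 := NS_01 hm 0 (by omega)
  rw [show S.mat n 0 2 + S.mat m 0 2 - S.mat n 0 1 * S.conj (S.mat m 0 1) - S.mat m 0 2 =
    S.mat n 0 2 - S.mat n 0 1 * S.conj (S.mat m 0 1) by ring, add_sub_cancel_right]
  exact pE_add (pE_sub (NS_02 hn) (pE_mul _ h1 (conj_mem_pE h2) (by omega)))
    (pE_mul _ h2 (conj_mem_pE h1) (by omega))

lemma card_reps_dvd {A B : Subgroup S.GG}
    (hnorm : ∀ a ∈ A, ∀ b ∈ B, a⁻¹ * (b * a) ∈ B) {z : S.GG} (hz : z ∈ A) (hzB : z ∉ B)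
    (hzp : z ^ S.p ∈ B) {U : Finset S.GG} (hU : S.IsReps A B U) : S.p ∣ U.card := by
  have hN : (B.subgroupOf A).Normal := ⟨by
    rintro ⟨b, hbA⟩ hb ⟨a, ha⟩
    rw [Subgroup.mem_subgroupOf] at hb ⊢
    have := hnorm a⁻¹ (inv_mem ha) b hb
    simpa [mul_assoc] using this⟩
  let f : U → A ⧸ B.subgroupOf A := fun u => QuotientGroup.mk ⟨u, hU.1 u.2⟩
  have hf : Function.Bijective f := by
    constructor
    · rintro ⟨u, hu⟩ ⟨v, hv⟩ huv
      have h := QuotientGroup.eq.1 huv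
      rw [Subgroup.mem_subgroupOf] at h
      obtain ⟨w, -, hw⟩ := hU.2 u (hU.1 hu)
      exact Subtype.ext ((hw u ⟨hu, by simp [one_mem]⟩).trans (hw v ⟨hv, h⟩).symm)
    · intro x
      obtain ⟨⟨a, ha⟩, rfl⟩ := QuotientGroup.mk_surjective x
      obtain ⟨u, ⟨hu, hau⟩, -⟩ := hU.2 a ha
      refine ⟨⟨u, hu⟩, QuotientGroup.eq.2 ?_⟩
      rw [Subgroup.mem_subgroupOf]
      have := inv_mem hau
      simpa using this
  have hcard : U.card = Nat.card (A ⧸ B.subgroupOf A) := by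
    rw [← Nat.card_eq_of_bijective f hf]
    simp
  rw [hcard]
  have : orderOf (QuotientGroup.mk ⟨z, hz⟩ : A ⧸ B.subgroupOf A) = S.p := by
    have := Fact.mk S.hp
    refine orderOf_eq_prime ?_ ?_
    · rw [← QuotientGroup.mk_pow, QuotientGroup.eq_one_iff, Subgroup.mem_subgroupOf]
      exact hzp
    · rw [Ne, QuotientGroup.eq_one_iff, Subgroup.mem_subgroupOf]
      exact hzB
  rw [← this]
  exact orderOf_dvd_natCard _

lemma exists_reps {A B : Subgroup S.GG} {X : Type*} [Finite X] (f : S.GG → X)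
    (hf : ∀ a ∈ A, ∀ b ∈ A, f a = f b → a⁻¹ * b ∈ B) : ∃ U : Finset S.GG, S.IsReps A B U := by
  have : Finite (A ⧸ B.subgroupOf A) := by
    refine Finite.of_injective (fun x => f (x.out : A)) fun x y hxy => ?_
    have h := hf _ x.out.2 _ y.out.2 hxy
    rw [← QuotientGroup.out_eq' x, ← QuotientGroup.out_eq' y, QuotientGroup.eq,
      Subgroup.mem_subgroupOf]
    exact h
  have := Fintype.ofFinite (A ⧸ B.subgroupOf A)
  refine ⟨Finset.univ.image fun x : A ⧸ B.subgroupOf A => ((x.out : A) : S.GG), ?_, ?_⟩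
  · intro u hu
    simp only [Finset.coe_image, Set.mem_image] at hu
    obtain ⟨x, -, rfl⟩ := hu
    exact x.out.2
  · intro a ha
    have key : ∀ x : A ⧸ B.subgroupOf A,
        a⁻¹ * (x.out : A) ∈ B ↔ x = QuotientGroup.mk ⟨a, ha⟩ := by
      intro x
      conv_rhs => rw [← QuotientGroup.out_eq' x, eq_comm, QuotientGroup.eq,
        Subgroup.mem_subgroupOf]
      rfl
    refine ⟨((QuotientGroup.mk ⟨a, ha⟩ : A ⧸ B.subgroupOf A).out : A),
      ⟨Finset.mem_image_of_mem _ (Finset.mem_univ _), (key _).2 rfl⟩, ?_⟩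
    rintro v ⟨hv, hav⟩
    simp only [Finset.mem_image] at hv
    obtain ⟨x, -, rfl⟩ := hv
    rw [(key x).1 hav]

lemma mem_pE_of_res {x y : S.O} (h : S.resmap x = S.resmap y) :
    (y : S.E) - x ∈ S.pE 1 := by
  have := (Ideal.Quotient.eq (I := S.mI)).1 h.symm
  obtain ⟨w, hw, hw2⟩ := (S.hmI _).1 this
  exact ⟨w, hw, by simpa using hw2⟩

/-- The reduction of an element of `E`, zero outside `o_E`. -/
def red (x : S.E) : S.kE := if h : x ∈ S.O then S.resmap ⟨x, h⟩ else 0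

lemma mem_pE_of_red {x y : S.E} (hx : x ∈ S.pE 0) (hy : y ∈ S.pE 0) (h : red x = red y) :
    y - x ∈ S.pE 1 := by
  rw [mem_pE_zero] at hx hy
  rw [red, red, dif_pos hx, dif_pos hy] at h
  exact mem_pE_of_res h

lemma exists_reps_neg_one (S : Setting) :
    ∃ U : Finset S.GG, S.IsReps (S.NS (-1)) (S.NS 0) U := by
  refine exists_reps (fun g => red (S.ϖ * S.mat g 0 2)) fun a ha b hb h => ?_
  rw [NS_inv_mul_mem ha hb]
  have h1 := mem_pE_of_red (unif_mul_mem_pE.2 (NS_02 ha)) (unif_mul_mem_pE.2 (NS_02 hb)) h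
  rw [← mul_sub, unif_mul_mem_pE] at h1
  have h2 := NS_01 ha 0 (by norm_num)
  exact pE_add h1 (pE_mul _ h2 (conj_mem_pE (pE_sub (NS_01 hb 0 (by norm_num)) h2)) le_rfl)

lemma exists_reps_zero (S : Setting) :
    ∃ U : Finset S.GG, S.IsReps (S.NS 0) (S.NS 1) U := by
  refine exists_reps (fun g => (red (S.mat g 0 1), red (S.mat g 0 2))) fun a ha b hb h => ?_
  rw [NS_inv_mul_mem ha hb]
  rw [Prod.mk.injEq] at h
  have h1 := mem_pE_of_red (NS_02 ha) (NS_02 hb) h.2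
  have h2 := NS_01 ha 0 (by norm_num)
  have h3 := mem_pE_of_red h2 (NS_01 hb 0 (by norm_num)) h.1
  exact pE_add h1 (pE_mul _ h2 (conj_mem_pE h3) le_rfl)

lemma IsReps.sum_comp {A B : Subgroup S.GG} {U : Finset S.GG} (hU : S.IsReps A B U)
    {M : Type*} [AddCommMonoid M] (φ : S.GG → M) (hφ : ∀ a ∈ A, ∀ b ∈ B, φ (a * b) = φ a)
    (τ : S.GG → S.GG) (hτ : ∀ a ∈ A, τ a ∈ A)
    (hτB : ∀ a ∈ A, ∀ a' ∈ A, (τ a)⁻¹ * τ a' ∈ B → a⁻¹ * a' ∈ B) :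
    ∑ u ∈ U, φ (τ u) = ∑ u ∈ U, φ u := by
  have hA : ∀ u ∈ U, u ∈ A := fun u hu => hU.1 hu
  choose! r hr using fun a ha => (hU.2 a ha).exists
  have hinj : Set.InjOn (fun u => r (τ u)) U := by
    intro u hu v hv huv
    simp only at huv
    have h1 := (hr _ (hτ u (hA u hu))).2
    have h2 := (hr _ (hτ v (hA v hv))).2
    rw [← huv] at h2
    have h3 := hτB u (hA u hu) v (hA v hv) (by
      have := mul_mem h1 (inv_mem h2)
      simpa [mul_assoc] using this)
    obtain ⟨w, -, hw⟩ := hU.2 u (hA u hu)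
    exact (hw u ⟨hu, by simp [one_mem]⟩).trans (hw v ⟨hv, h3⟩).symm
  have himg : U.image (fun u => r (τ u)) = U := by
    refine Finset.eq_of_subset_of_card_le ?_ (Finset.card_image_of_injOn hinj).ge
    intro x hx
    obtain ⟨u, hu, rfl⟩ := Finset.mem_image.1 hx
    exact (hr _ (hτ u (hA u hu))).1
  conv_rhs => rw [← himg, Finset.sum_image hinj]
  refine Finset.sum_congr rfl fun u hu => ?_
  have h1 := hr _ (hτ u (hA u hu))
  rw [← hφ _ (hτ u (hA u hu)) _ h1.2, mul_inv_cancel_left]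

/-- The pro-`p` Iwahori subgroup of `K₀`. -/
def I1S (S : Setting) : Subgroup S.GG where
  carrier := {g | g ∈ S.IS ∧ ∀ j, S.mat g j j - 1 ∈ S.pE 1}
  one_mem' := ⟨one_mem _, by simp [mat_one]⟩
  mul_mem' := by
    rintro a b ⟨ha, ha1⟩ ⟨hb, hb1⟩
    refine ⟨mul_mem ha hb, fun j => ?_⟩
    have hbj : S.mat b j j ∈ S.pE 0 := pE_mono (hb j j) (by revert j; decide)
    have h := pE_add (pE_mul 1 (ha1 j) hbj (by norm_num)) (hb1 j)
    have A := fun i j => ha i j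
    have B := fun i j => hb i j
    fin_cases j
    · have h2 := pE_add h (pE_add (pE_mul 1 (A 0 1) (B 1 0) (by simp [eI]))
        (pE_mul 1 (A 0 2) (B 2 0) (by simp [eI])))
      convert h2 using 1
      simp [mat_mul_apply]
      ring
    · have h2 := pE_add h (pE_add (pE_mul 1 (A 1 0) (B 0 1) (by simp [eI]))
        (pE_mul 1 (A 1 2) (B 2 1) (by simp [eI])))
      convert h2 using 1
      simp [mat_mul_apply]
      ring
    · have h2 := pE_add h (pE_add (pE_mul 1 (A 2 0) (B 0 2) (by simp [eI]))
        (pE_mul 1 (A 2 1) (B 1 2) (by simp [eI])))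
      convert h2 using 1
      simp [mat_mul_apply]
      ring
  inv_mem' := by
    rintro a ⟨ha, ha1⟩
    refine ⟨inv_mem ha, fun j => ?_⟩
    rw [mat_inv, ← map_one S.conj, ← map_sub]
    exact conj_mem_pE (ha1 _)

lemma mem_I1S {g : S.GG} : g ∈ S.I1S ↔ g ∈ S.IS ∧ ∀ j, S.mat g j j - 1 ∈ S.pE 1 := Iff.rfl

lemma eI_diag (j : Fin 3) : eI j j = 0 := by revert j; decide

lemma IS_mul_diag {a b : S.GG} (ha : a ∈ S.IS) (hb : b ∈ S.IS) (j : Fin 3) :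
    S.mat (a * b) j j - S.mat a j j * S.mat b j j ∈ S.pE 1 := by
  have A := fun i j => ha i j
  have B := fun i j => hb i j
  fin_cases j
  · convert pE_add (pE_mul 1 (A 0 1) (B 1 0) (by simp [eI]))
      (pE_mul 1 (A 0 2) (B 2 0) (by simp [eI])) using 1
    simp [mat_mul_apply]
    ring
  · convert pE_add (pE_mul 1 (A 1 0) (B 0 1) (by simp [eI]))
      (pE_mul 1 (A 1 2) (B 2 1) (by simp [eI])) using 1
    simp [mat_mul_apply]
    ring
  · convert pE_add (pE_mul 1 (A 2 0) (B 0 2) (by simp [eI]))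
      (pE_mul 1 (A 2 1) (B 1 2) (by simp [eI])) using 1
    simp [mat_mul_apply]

lemma IS_conj_I1S {a g : S.GG} (ha : a ∈ S.IS) (hg : g ∈ S.I1S) : a * g * a⁻¹ ∈ S.I1S := by
  obtain ⟨hg, hg1⟩ := hg
  refine ⟨mul_mem (mul_mem ha hg) (inv_mem ha), fun j => ?_⟩
  have h1 := IS_mul_diag (mul_mem ha hg) (inv_mem ha) j
  have h2 := IS_mul_diag ha hg j
  have h3 := IS_mul_diag ha (inv_mem ha) j
  rw [mul_inv_cancel, mat_one, Matrix.one_apply_eq] at h3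
  have hd : S.mat a⁻¹ j j ∈ S.pE 0 := pE_mono (inv_mem ha j j) (eI_diag j).ge
  have hd' : S.mat a j j ∈ S.pE 0 := pE_mono (ha j j) (eI_diag j).ge
  have h4 := pE_add h1 (pE_sub (pE_add (pE_mul 1 h2 hd (by norm_num))
    (pE_mul 1 (pE_mul 1 hd' (hg1 j) (by norm_num)) hd (by norm_num))) h3)
  convert h4 using 1
  ring

lemma NS_le_I1S : S.NS 0 ≤ S.I1S := by
  intro g hg
  refine ⟨NS_le_IS hg, fun j => ?_⟩
  rw [mem_NS, mem_Nk_iff] at hg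
  obtain ⟨h1, h2, h3, -⟩ := hg
  fin_cases j <;> simp [h1, h2, h3]

lemma alpha_conj_I1S {g : S.GG} (hg : g ∈ S.I1S) (h : S.alphaE * g * S.alphaE⁻¹ ∈ S.K1S) :
    S.alphaE * g * S.alphaE⁻¹ ∈ S.I1K1 := by
  rw [mem_I1K1_iff]
  refine ⟨h, ?_⟩
  have h20 : S.mat g 2 0 ∈ S.pE 1 := hg.1 2 0
  have hu := S.unif_ne
  have h0 := hg.2 0
  have h1 := hg.2 1
  have h2 := hg.2 2
  simp only [mat_mul_alphaInv, mat_alpha_mul]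
  simp [hu, h0, h1, h2, unif_mul_mem_pE]
  exact pE_mono h20 (by norm_num)

lemma alpha_conj_NS_mem {u : S.GG} (hu : u ∈ S.NS 0) :
    S.alphaE * u * S.alphaE⁻¹ ∈ S.K1S ↔ u ∈ S.NS 1 := by
  constructor
  · intro h
    have h02 := h 0 2
    rw [mat_mul_alphaInv, mat_alpha_mul, zpow_mul_mem_pE, zpow_mul_mem_pE] at h02
    have h02' : S.mat u 0 2 ∈ S.pE 1 := pE_mono h02 (by simp [eK])
    rw [mem_NS, mem_Nk_iff] at hu ⊢
    tauto
  · intro h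
    exact NS_le_K1S (alpha_conj_NS h)

end Setting

end U21

namespace U21

/-- An irreducible action of `K₁` trivial on the pro-`p` radical, together with the operator
`j` of the weight, in a form independent of the choice of a chamber. -/
structure WeightDatum (S : Setting) (𝔽 : Type) [Field 𝔽] (W : Type) [AddCommGroup W]
    [Module 𝔽 W] where
  s : S.GG → Module.End 𝔽 W
  s_one : s 1 = 1
  s_mul : ∀ g ∈ S.K1S, ∀ h ∈ S.K1S, s (g * h) = s g * s h
  s_kone : ∀ g ∈ S.Kone1, s g = 1
  irr : ∀ Z : Submodule 𝔽 W, (∀ k ∈ S.K1S, ∀ w ∈ Z, s k w ∈ Z) → Z = ⊥ ∨ Z = ⊤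
  j : W →ₗ[𝔽] W
  j_fix : ∀ w, (∀ g ∈ S.I1K1, s g w = w) → j w = w
  j_aug : ∀ w, ∀ g ∈ S.I1'K1, j (s g w - w) = 0

namespace WeightDatum

open Setting

variable {S : Setting} {𝔽 : Type} [Field 𝔽] {W : Type} [AddCommGroup W] [Module 𝔽 W]
  (D : WeightDatum S 𝔽 W)

lemma s_mul_apply {g h : S.GG} (hg : g ∈ S.K1S) (hh : h ∈ S.K1S) (w : W) :
    D.s (g * h) w = D.s g (D.s h w) := by
  rw [D.s_mul g hg h hh]
  rfl

lemma s_one_apply (w : W) : D.s 1 w = w := by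
  rw [D.s_one]
  rfl

lemma s_kone_apply {g : S.GG} (hg : g ∈ S.Kone1) (w : W) : D.s g w = w := by
  rw [D.s_kone g hg]
  rfl

lemma s_inv_apply {g : S.GG} (hg : g ∈ S.K1S) (w : W) : D.s g⁻¹ (D.s g w) = w := by
  rw [← D.s_mul_apply (inv_mem hg) hg, inv_mul_cancel, D.s_one_apply]

lemma s_apply_inv {g : S.GG} (hg : g ∈ S.K1S) (w : W) : D.s g (D.s g⁻¹ w) = w := by
  rw [← D.s_mul_apply hg (inv_mem hg), mul_inv_cancel, D.s_one_apply]

lemma s_eq_zero {g : S.GG} (hg : g ∈ S.K1S) {w : W} (h : D.s g w = 0) : w = 0 := by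
  rw [← D.s_inv_apply hg w, h, map_zero]

lemma s_pow {g : S.GG} (hg : g ∈ S.K1S) (n : ℕ) : D.s (g ^ n) = D.s g ^ n := by
  induction n with
  | zero => simp [D.s_one]
  | succ n ih => rw [pow_succ, pow_succ, D.s_mul _ (pow_mem hg n) _ hg, ih]

/-- The space of vectors fixed by the pro-`p` Iwahori subgroup. -/
def L : Submodule 𝔽 W where
  carrier := {w | ∀ g ∈ S.I1K1, D.s g w = w}
  add_mem' := fun ha hb g hg => by rw [map_add, ha g hg, hb g hg]
  zero_mem' := fun g _ => map_zero _
  smul_mem' := fun c w hw g hg => by rw [map_smul, hw g hg]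

lemma mem_L_iff {w : W} : w ∈ D.L ↔ ∀ n ∈ S.NS (-1), D.s n w = w := by
  refine ⟨fun h n hn => h n (NS_subset_I1K1 hn), fun h g hg => ?_⟩
  obtain ⟨n, hn, hng⟩ := exists_NS_inv_mul_mem_Kone1 hg
  rw [← mul_inv_cancel_left n g, D.s_mul_apply (NS_le_K1S hn) (mem_Kone1_iff.1 hng).1,
    D.s_kone_apply hng, h n hn]

lemma j_L {w : W} (hw : w ∈ D.L) : D.j w = w := D.j_fix w hw

lemma j_I1' {g : S.GG} (hg : g ∈ S.I1'K1) (w : W) : D.j (D.s g w) = D.j w := by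
  rw [← sub_eq_zero, ← map_sub]
  exact D.j_aug w g hg

lemma s_upper_mem_L {b : S.GG} (hb : b ∈ S.K1S) (h10 : S.mat b 1 0 = 0)
    (h20 : S.mat b 2 0 = 0) {w : W} (hw : w ∈ D.L) : D.s b w ∈ D.L := by
  rw [mem_L_iff] at *
  intro n hn
  have h := upper_conj_NS hb h10 h20 hn
  rw [← D.s_mul_apply (NS_le_K1S hn) hb, show n * b = b * (b⁻¹ * n * b) by group,
    D.s_mul_apply hb (NS_le_K1S h), hw _ h]

lemma exists_fixed [CharP 𝔽 S.p] (Z : Submodule 𝔽 W)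
    (hZ : ∀ n ∈ S.NS (-1), ∀ w ∈ Z, D.s n w ∈ Z) (hne : Z ≠ ⊥) : ∃ w ∈ Z, w ≠ 0 ∧ w ∈ D.L := by
  obtain ⟨U, hU⟩ := S.exists_reps_neg_one
  have key : ∀ A : Finset S.GG, (∀ a ∈ A, a ∈ S.NS (-1)) →
      ∃ w ∈ Z, w ≠ 0 ∧ ∀ a ∈ A, D.s a w = w := by
    intro A
    induction A using Finset.induction_on with
    | empty =>
      intro _
      obtain ⟨w, hw, hw0⟩ := Submodule.exists_mem_ne_zero_of_ne_bot hne
      exact ⟨w, hw, hw0, by simp⟩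
    | insert a A _ ih =>
      intro hA
      obtain ⟨w, hw, hw0, hwA⟩ := ih fun b hb => hA b (Finset.mem_insert_of_mem hb)
      have ha := hA a (Finset.mem_insert_self _ _)
      have : Nontrivial W := ⟨w, 0, hw0⟩
      have := Fact.mk S.hp
      have : CharP (Module.End 𝔽 W) S.p :=
        charP_of_injective_algebraMap (algebraMap 𝔽 (Module.End 𝔽 W)).injective S.p
      have hep : (D.s a - 1) ^ S.p = 0 := by
        rw [sub_pow_char_of_commute _ (Commute.one_right _), one_pow, ← D.s_pow (NS_le_K1S ha),
          D.s_kone _ (NS_zero_subset_Kone1 (NS_pow_p ha)), sub_self]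
      have hex : ∃ n : ℕ, ((D.s a - 1) ^ n) w = 0 := ⟨S.p, by rw [hep]; rfl⟩
      have hpos : Nat.find hex ≠ 0 := by
        intro h0
        have := Nat.find_spec hex
        rw [h0, pow_zero] at this
        exact hw0 this
      obtain ⟨m, hm⟩ := Nat.exists_eq_succ_of_ne_zero hpos
      have hZe : ∀ n : ℕ, ∀ v ∈ Z, ((D.s a - 1) ^ n) v ∈ Z := by
        intro n
        induction n with
        | zero => intro v hv; simpa using hv
        | succ n ihn =>
          intro v hv
          rw [pow_succ, Module.End.mul_apply]
          exact ihn _ (Z.sub_mem (hZ a ha v hv) hv)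
      refine ⟨((D.s a - 1) ^ m) w, hZe m w hw, Nat.find_min hex (by omega), ?_⟩
      intro b hb
      rcases Finset.mem_insert.1 hb with rfl | hb'
      · have h := Nat.find_spec hex
        rw [hm, pow_succ', Module.End.mul_apply] at h
        rw [← sub_eq_zero]
        exact h
      · have hbN := hA b hb
        have hcomm : Commute (D.s b) (D.s a) := by
          change D.s b * D.s a = D.s a * D.s b
          rw [← D.s_mul _ (NS_le_K1S hbN) _ (NS_le_K1S ha),
            ← D.s_mul _ (NS_le_K1S ha) _ (NS_le_K1S hbN),
            ← mul_inv_cancel_left (a * b) (b * a),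
            D.s_mul _ (NS_le_K1S (mul_mem ha hbN)) _
              (NS_le_K1S (NS_mono (by norm_num) (NS_comm ha hbN))),
            D.s_kone _ (NS_zero_subset_Kone1 (NS_comm ha hbN)), mul_one]
        have h2 : Commute (D.s b) ((D.s a - 1) ^ m) :=
          (hcomm.sub_right (Commute.one_right _)).pow_right m
        have h3 := congrArg (fun φ : Module.End 𝔽 W => φ w) h2.eq
        simp only [Module.End.mul_apply] at h3
        rw [h3, hwA b hb']
  obtain ⟨w, hw, hw0, hwU⟩ := key U fun a ha => hU.1 ha
  refine ⟨w, hw, hw0, D.mem_L_iff.2 fun n hn => ?_⟩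
  obtain ⟨u, hu, hnu⟩ := (hU.2 n hn).exists
  have h := inv_mem hnu
  rw [mul_inv_rev, inv_inv] at h
  change u⁻¹ * n ∈ S.NS 0 at h
  rw [← mul_inv_cancel_left u n, D.s_mul_apply (NS_le_K1S (hU.1 hu))
    (NS_le_K1S (NS_mono (by norm_num) h)), D.s_kone_apply (NS_zero_subset_Kone1 h), hwU u hu]

lemma eq_zero_of_j [CharP 𝔽 S.p] {w : W} (h : ∀ u ∈ S.NS (-1), D.j (D.s u w) = 0) : w = 0 := by
  let Z : Submodule 𝔽 W :=
    { carrier := {w | ∀ u ∈ S.NS (-1), D.j (D.s u w) = 0}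
      add_mem' := fun ha hb u hu => by rw [map_add, map_add, ha u hu, hb u hu, add_zero]
      zero_mem' := fun u _ => by rw [map_zero, map_zero]
      smul_mem' := fun c w hw u hu => by rw [map_smul, map_smul, hw u hu, smul_zero] }
  by_contra hw0
  obtain ⟨l, hl, hl0, hlL⟩ := D.exists_fixed Z (fun n hn w hw u hu => by
    rw [← D.s_mul_apply (NS_le_K1S hu) (NS_le_K1S hn)]
    exact hw _ (mul_mem hu hn)) (fun hZ => hw0 (by
      have : w ∈ Z := h
      rwa [hZ, Submodule.mem_bot] at this))
  apply hl0
  have := hl 1 (one_mem _)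
  rwa [D.s_one_apply, D.j_L hlL] at this

lemma j_big_cell {k : S.GG} (hk : k ∈ S.K1S) (h00 : S.mat k 0 0 ∉ S.pE 1) {l : W}
    (hl : l ∈ D.L) : D.j (D.s k l) ∈ D.L := by
  obtain ⟨n, hn, hb, h10, h20, -⟩ := K1_big_cell hk h00
  have hl' := D.s_upper_mem_L hb h10 h20 hl
  rw [← mul_inv_cancel_left n k, D.s_mul_apply (mem_I1'K1_iff.1 hn).1 hb, D.j_I1' hn, D.j_L hl']
  exact hl'

lemma j_beta {l : W} (hl : l ∈ D.L) : D.j (D.s S.betaPr l) ∈ D.L := by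
  obtain ⟨U, hU⟩ := S.exists_reps_neg_one
  have hβ := S.betaPr_mem_K1S
  have hUK : ∀ u ∈ U, u ∈ S.K1S := fun u hu => NS_le_K1S (hU.1 hu)
  obtain ⟨u0, ⟨hu0, hu0'⟩, huniq⟩ := hU.2 1 (one_mem (S.NS (-1)))
  rw [inv_one, one_mul] at hu0'
  have hsum : ∑ u ∈ U, D.s (u * S.betaPr) l ∈ D.L := by
    rw [mem_L_iff]
    intro n hn
    rw [map_sum]
    have h := hU.sum_comp (A := S.NS (-1)) (B := S.NS 0) (fun u => D.s (u * S.betaPr) l) ?_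
      (fun u => n * u) (fun a ha => mul_mem hn ha) (fun a _ a' _ h => by
        simpa [mul_assoc] using h)
    · rw [← h]
      refine Finset.sum_congr rfl fun u hu => ?_
      rw [← D.s_mul_apply (NS_le_K1S hn) (mul_mem (hUK u hu) hβ), mul_assoc]
    · intro a ha b hb
      have haK := NS_le_K1S ha
      have hbK := NS_le_K1S (NS_mono (by norm_num) hb)
      rw [mul_assoc, D.s_mul_apply haK (mul_mem hbK hβ), D.s_mul_apply hbK hβ,
        D.s_kone_apply (NS_zero_subset_Kone1 hb), ← D.s_mul_apply haK hβ]
  rw [← Finset.add_sum_erase U _ hu0, D.s_mul_apply (hUK _ hu0) hβ,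
    D.s_kone_apply (NS_zero_subset_Kone1 hu0')] at hsum
  have h1 := D.j_L hsum
  rw [map_add, map_sum] at h1
  rw [eq_sub_of_add_eq h1]
  refine D.L.sub_mem hsum (D.L.sum_mem fun u hu => ?_)
  obtain ⟨hne, huU⟩ := Finset.mem_erase.1 hu
  refine D.j_big_cell (mul_mem (hUK u huU) hβ) (fun h => hne (huniq u ⟨huU, ?_⟩)) hl
  have hN := hU.1 huU
  change u ∈ S.NS (-1) at hN
  rw [mat_mul_betaPr] at h
  have h' : S.mat u 0 2 ∈ S.pE 0 := by simpa [unif_mul_mem_pE] using h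
  rw [inv_one, one_mul]
  change u ∈ S.NS 0
  rw [mem_NS, mem_Nk_iff] at hN ⊢
  tauto

/-- The image of `j` is the space of pro-`p` Iwahori fixed vectors. -/
lemma j_mem_L [CharP 𝔽 S.p] [Nontrivial W] (w : W) : D.j w ∈ D.L := by
  let Q : Submodule 𝔽 W := Submodule.span 𝔽 {w | ∃ k ∈ S.K1S, ∃ l ∈ D.L, w = D.s k l}
  have hQ : Q ≤ D.L.comap D.j := by
    rw [Submodule.span_le]
    rintro _ ⟨k, hk, l, hl, rfl⟩
    by_cases h00 : S.mat k 0 0 ∈ S.pE 1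
    · obtain ⟨n, hn, hb, h10, h20⟩ := K1_small_cell hk h00
      have hl' := D.s_upper_mem_L hb h10 h20 hl
      have hβ := S.betaPr_mem_K1S
      have e : D.s k l = D.s S.betaPr (D.s (n⁻¹ * (S.betaPr * k)) l) := by
        rw [D.s_mul_apply (inv_mem (mem_Kone1_iff.1 hn).1) (mul_mem hβ hk),
          D.s_mul_apply hβ hk]
        have : D.s n⁻¹ (D.s S.betaPr (D.s k l)) = D.s S.betaPr (D.s k l) := by
          conv_lhs => rw [← D.s_kone_apply hn (D.s S.betaPr (D.s k l))]
          rw [D.s_inv_apply (mem_Kone1_iff.1 hn).1]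
        rw [this, ← D.s_mul_apply hβ hβ, betaPr_mul_self, D.s_one_apply]
      rw [SetLike.mem_coe, Submodule.mem_comap, e]
      exact D.j_beta hl'
    · exact D.j_big_cell hk h00 hl
  have hstab : ∀ k ∈ S.K1S, ∀ w ∈ Q, D.s k w ∈ Q := by
    intro k hk
    change Q ≤ Q.comap (D.s k)
    refine Submodule.span_le.2 ?_
    rintro _ ⟨k', hk', l, hl, rfl⟩
    exact Submodule.subset_span ⟨k * k', mul_mem hk hk', l, hl, (D.s_mul_apply hk hk' l).symm⟩
  obtain ⟨l, -, hl0, hl⟩ := D.exists_fixed ⊤ (fun _ _ _ _ => trivial) top_ne_bot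
  rcases D.irr Q hstab with h | h
  · refine (hl0 ?_).elim
    have : l ∈ Q := Submodule.subset_span ⟨1, one_mem _, l, hl, (D.s_one_apply l).symm⟩
    rwa [h, Submodule.mem_bot] at this
  · exact hQ (h ▸ Submodule.mem_top)

lemma exists_L_ne_zero [CharP 𝔽 S.p] [Nontrivial W] : ∃ l ∈ D.L, l ≠ 0 := by
  obtain ⟨l, -, hl0, hl⟩ := D.exists_fixed ⊤ (fun _ _ _ _ => trivial) top_ne_bot
  exact ⟨l, hl, hl0⟩

end WeightDatum

end U21

namespace U21

namespace Setting

variable {S : Setting}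

/-- Representatives of `N_0/N_1`. -/
def rep0 (S : Setting) : Finset S.GG := S.exists_reps_zero.choose

lemma rep0_spec (S : Setting) : S.IsReps (S.NS 0) (S.NS 1) S.rep0 := S.exists_reps_zero.choose_spec

lemma rep0_mem {u : S.GG} (hu : u ∈ S.rep0) : u ∈ S.NS 0 := S.rep0_spec.1 hu

lemma card_rep0 (𝔽 : Type) [Field 𝔽] [CharP 𝔽 S.p] : (S.rep0.card : 𝔽) = 0 := by
  obtain ⟨z, hz, hzB, hzp⟩ := S.exists_order_p 0
  rw [CharP.cast_eq_zero_iff 𝔽 S.p]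
  exact card_reps_dvd (fun a ha b hb => NS_conj_mem (Or.inr rfl) ha hb) hz hzB hzp S.rep0_spec

lemma IsReps.card_eq_zero {U : Finset S.GG} (hU : S.IsReps (S.NS (-1)) (S.NS 0) U) (𝔽 : Type)
    [Field 𝔽] [CharP 𝔽 S.p] : (U.card : 𝔽) = 0 := by
  obtain ⟨z, hz, hzB, hzp⟩ := S.exists_order_p (-1)
  rw [CharP.cast_eq_zero_iff 𝔽 S.p]
  exact card_reps_dvd (fun a ha b hb => NS_conj_mem (Or.inl rfl) ha hb) hz hzB hzp hU

lemma betaPr_mul_alpha : S.betaPr * S.alphaE = S.betaE := by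
  rw [betaPr, inv_mul_cancel_right]

lemma alpha_mul_beta : S.alphaE * S.betaE = S.betaPr := betaPr_eq.symm

/-- A filtration of `G` by left `K₁`-stable subsets, according to the first column. -/
def Lev (S : Setting) (n : ℤ) : Set S.GG :=
  {g | S.mat g 0 0 ∈ S.pE (-n) ∧ S.mat g 1 0 ∈ S.pE (-n) ∧ S.mat g 2 0 ∈ S.pE (1 - n)}

/-- A filtration of `G` by left `K₀`-stable subsets, according to the first column. -/
def Lev0 (S : Setting) (n : ℤ) : Set S.GG := {g | ∀ i, S.mat g i 0 ∈ S.pE (-n)}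

lemma Lev_mono {m n : ℤ} (h : m ≤ n) : S.Lev m ⊆ S.Lev n := fun _ hg =>
  ⟨pE_mono hg.1 (by omega), pE_mono hg.2.1 (by omega), pE_mono hg.2.2 (by omega)⟩

lemma Lev_K1_mul {k g : S.GG} {n : ℤ} (hk : k ∈ S.K1S) (hg : g ∈ S.Lev n) : k * g ∈ S.Lev n := by
  rw [mem_K1S, forall_fin3] at hk
  obtain ⟨h00, h01, h02, h10, h11, h12, h20, h21, h22⟩ := hk
  simp only [eK] at *
  obtain ⟨a, b, c⟩ := hg
  refine ⟨?_, ?_, ?_⟩ <;> rw [mat_mul_apply]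
  · exact pE_add (pE_add (pE_mul _ h00 a (by simp)) (pE_mul _ h01 b (by simp)))
      (pE_mul _ h02 c (by simp))
  · exact pE_add (pE_add (pE_mul _ h10 a (by simp)) (pE_mul _ h11 b (by simp)))
      (pE_mul _ h12 c (by simp))
  · exact pE_add (pE_add (pE_mul _ h20 a (by simp)) (pE_mul _ h21 b (by simp)))
      (pE_mul _ h22 c (by simp))

lemma Lev_K1_mul_iff {k g : S.GG} {n : ℤ} (hk : k ∈ S.K1S) : k * g ∈ S.Lev n ↔ g ∈ S.Lev n :=
  ⟨fun h => by simpa using Lev_K1_mul (inv_mem hk) h, Lev_K1_mul hk⟩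

lemma Lev0_mono {m n : ℤ} (h : m ≤ n) : S.Lev0 m ⊆ S.Lev0 n := fun _ hg i =>
  pE_mono (hg i) (by omega)

lemma Lev0_K0_mul {k g : S.GG} {n : ℤ} (hk : k ∈ S.K0S) (hg : g ∈ S.Lev0 n) :
    k * g ∈ S.Lev0 n := by
  rw [mem_K0S] at hk
  intro i
  rw [mat_mul_apply]
  exact pE_add (pE_add (pE_mul _ (hk _ _) (hg _) (by simp)) (pE_mul _ (hk _ _) (hg _) (by simp)))
      (pE_mul _ (hk _ _) (hg _) (by simp))

lemma Lev0_K0_mul_iff {k g : S.GG} {n : ℤ} (hk : k ∈ S.K0S) : k * g ∈ S.Lev0 n ↔ g ∈ S.Lev0 n :=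
  ⟨fun h => by simpa using Lev0_K0_mul (inv_mem hk) h, Lev0_K0_mul hk⟩

lemma K1S_subset_Lev {k : S.GG} (hk : k ∈ S.K1S) : k ∈ S.Lev 0 := by
  rw [mem_K1S, forall_fin3] at hk
  obtain ⟨h00, h01, h02, h10, h11, h12, h20, h21, h22⟩ := hk
  simp only [eK] at *
  exact ⟨h00, pE_mono h10 (by simp), h20⟩

lemma alpha_K0S_subset_Lev {k : S.GG} (hk : k ∈ S.K0S) : S.alphaE * k ∈ S.Lev 1 := by
  rw [mem_K0S] at hk
  refine ⟨?_, ?_, ?_⟩ <;> rw [mat_alpha_mul, zpow_mul_mem_pE] <;>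
    exact pE_mono (hk _ _) (by simp)

lemma alpha_mul_notMem_Lev {g : S.GG} {n : ℤ} (hg : S.mat g 0 0 ∉ S.pE (1 - n)) :
    S.alphaE * g ∉ S.Lev n := by
  rintro ⟨h, -, -⟩
  rw [mat_alpha_mul, zpow_mul_mem_pE] at h
  exact hg (pE_mono h (by simp))

lemma alpha_K0S_notMem_K1S {k : S.GG} (h00 : S.mat k 0 0 ∉ S.pE 1) : S.alphaE * k ∉ S.K1S :=
  fun h => alpha_mul_notMem_Lev (n := 0) (by simpa using h00) (K1S_subset_Lev h)

lemma exists_mem_Lev (g : S.GG) : ∃ n : ℕ, g ∈ S.Lev n := by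
  obtain ⟨a, ha⟩ := exists_pE (S.mat g 0 0)
  obtain ⟨b, hb⟩ := exists_pE (S.mat g 1 0)
  obtain ⟨c, hc⟩ := exists_pE (S.mat g 2 0)
  exact ⟨a + b + c + 1, pE_mono ha (by push_cast; omega), pE_mono hb (by push_cast; omega),
    pE_mono hc (by push_cast; omega)⟩

lemma exists_mem_Lev0 (g : S.GG) : ∃ n : ℕ, g ∈ S.Lev0 n := by
  obtain ⟨n, h0, h1, h2⟩ := exists_mem_Lev g
  refine ⟨n, fun i => ?_⟩
  fin_cases i
  exacts [h0, h1, pE_mono h2 (by omega)]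

lemma conj_20_mem {κ g : S.GG} {a j : ℤ} (h10 : S.mat g 1 0 = 0) (h20 : S.mat g 2 0 = 0)
    (h00 : S.mat g 0 0 ∉ S.pE j) (h : S.mat (S.alphaE⁻¹ * κ * S.alphaE * g) 2 0 ∈ S.pE a) :
    S.mat κ 2 0 ∈ S.pE (a + 3 - j) := by
  have hc := ne_zero_of_notMem_pE h00
  rw [mul_assoc, mul_assoc, mat_alphaInv_mul, mat_mul_apply, mat_alpha_mul, mat_alpha_mul,
    mat_alpha_mul, h10, h20, zpow_mul_mem_pE] at h
  have e : S.mat κ 2 0 * (S.ϖ ^ (((0 : Fin 3) : ℤ) - 1) * S.mat g 0 0) +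
      S.mat κ 2 1 * (S.ϖ ^ (((1 : Fin 3) : ℤ) - 1) * 0) +
      S.mat κ 2 2 * (S.ϖ ^ (((2 : Fin 3) : ℤ) - 1) * 0) =
      S.ϖ ^ (((0 : Fin 3) : ℤ) - 1) * (S.mat κ 2 0 * S.mat g 0 0) := by ring
  rw [e, zpow_mul_mem_pE] at h
  have := div_mem_pE (a + 3 - j) h00 h (by simp; omega)
  rwa [mul_div_cancel_right₀ _ hc] at this

lemma conj_mem_K1S_of_Lev {κ g : S.GG} {n : ℤ} (hκ : κ ∈ S.K1S) (h10 : S.mat g 1 0 = 0)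
    (h20 : S.mat g 2 0 = 0) (h00 : S.mat g 0 0 ∉ S.pE (1 - n))
    (h : S.alphaE⁻¹ * κ * S.alphaE * g ∈ S.Lev n) : S.alphaE⁻¹ * κ * S.alphaE ∈ S.K1S :=
  mem_K1S_of_conj_mem hκ (pE_mono (conj_20_mem h10 h20 h00 h.2.2) (by omega))

lemma conj_mem_K0S_of_Lev0 {κ g : S.GG} {n : ℤ} (hκ : κ ∈ S.K1S) (h10 : S.mat g 1 0 = 0)
    (h20 : S.mat g 2 0 = 0) (h00 : S.mat g 0 0 ∉ S.pE (1 - n))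
    (h : S.alphaE⁻¹ * κ * S.alphaE * g ∈ S.Lev0 n) : S.alphaE⁻¹ * κ * S.alphaE ∈ S.K0S :=
  mem_K0S_of_conj_mem hκ (pE_mono (conj_20_mem h10 h20 h00 (h 2)) (by omega))

end Setting

namespace WeightDatum

open Setting

variable {S : Setting} {𝔽 : Type} [Field 𝔽] {W : Type} [AddCommGroup W] [Module 𝔽 W]
  (D : WeightDatum S 𝔽 W)

/-- Left equivariance of functions on `G` under the maximal compact subgroup. -/
def Equivar (f : S.GG → W) : Prop := ∀ k ∈ S.K1S, ∀ g, f (k * g) = D.s k (f g)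

/-- Membership in the compact induction. -/
def IsInd (f : S.GG → W) : Prop :=
  D.Equivar f ∧ ∃ t : Finset S.GG, ∀ g, f g ≠ 0 → ∃ k ∈ S.K1S, ∃ x ∈ t, g = k * x

/-- The function supported on `K g⁻¹` with value `v` at `g⁻¹`. -/
def std (g : S.GG) (v : W) : S.GG → W := fun x => if x * g ∈ S.K1S then D.s (x * g) v else 0

lemma std_apply {g x : S.GG} (h : x * g ∈ S.K1S) (v : W) : D.std g v x = D.s (x * g) v := if_pos h

lemma std_apply_eq_zero {g x : S.GG} (h : x * g ∉ S.K1S) (v : W) : D.std g v x = 0 := if_neg h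

lemma mem_of_std_ne_zero {g x : S.GG} {v : W} (h : D.std g v x ≠ 0) : x * g ∈ S.K1S := by
  by_contra h'
  exact h (D.std_apply_eq_zero h' v)

lemma std_equivar (g : S.GG) (v : W) : D.Equivar (D.std g v) := by
  intro k hk x
  by_cases h : x * g ∈ S.K1S
  · rw [D.std_apply h, D.std_apply (by rw [mul_assoc]; exact mul_mem hk h), mul_assoc,
      D.s_mul_apply hk h]
  · rw [D.std_apply_eq_zero h, D.std_apply_eq_zero, map_zero]
    rwa [mul_assoc, Subgroup.mul_mem_cancel_left _ hk]

lemma std_isInd (g : S.GG) (v : W) : D.IsInd (D.std g v) :=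
  ⟨D.std_equivar g v, {g⁻¹}, fun x hx => ⟨x * g, D.mem_of_std_ne_zero hx, g⁻¹, by simp, by simp⟩⟩

lemma std_mul (g h x : S.GG) (v : W) : D.std g v (x * h) = D.std (h * g) v x := by
  unfold std
  rw [mul_assoc]

lemma std_right {k : S.GG} (hk : k ∈ S.K1S) (g : S.GG) (v : W) :
    D.std (g * k) v = D.std g (D.s k v) := by
  ext x
  by_cases h : x * g ∈ S.K1S
  · rw [D.std_apply h, D.std_apply (by rw [← mul_assoc]; exact mul_mem h hk), ← mul_assoc,
      D.s_mul_apply h hk]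
  · rw [D.std_apply_eq_zero h, D.std_apply_eq_zero]
    rwa [← mul_assoc, Subgroup.mul_mem_cancel_right _ hk]

/-- The function `∑_{u ∈ N_0/N_1} [uα⁻¹, w]`. -/
def F (w : W) : S.GG → W := ∑ u ∈ S.rep0, D.std (u * S.alphaE⁻¹) w

lemma F_apply_sum (w : W) (x : S.GG) : D.F w x = ∑ u ∈ S.rep0, D.std (u * S.alphaE⁻¹) w x := by
  rw [F, Finset.sum_apply]

lemma F_equivar (w : W) : D.Equivar (D.F w) := by
  intro k hk x
  simp only [F_apply_sum, map_sum, D.std_equivar _ _ k hk x]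

lemma F_apply {w : W} (hw : w ∈ D.L) {k i : S.GG} (hk : k ∈ S.K1S) (hi : i ∈ S.I1S) :
    D.F w (k * S.alphaE * i) = D.s k w := by
  rw [mul_assoc, D.F_equivar _ k hk]
  congr 1
  have hiI := (mem_I1S.1 hi).1
  obtain ⟨n, hn, hinK⟩ := exists_NS_alpha_conj (IS_le_K0S hiI) (IS_00_notMem hiI)
  obtain ⟨u, ⟨hu, hun⟩, huniq⟩ := S.rep0_spec.2 n hn
  have key : ∀ u ∈ S.rep0, S.alphaE * i * (u * S.alphaE⁻¹) ∈ S.K1S ↔ n⁻¹ * u ∈ S.NS 1 := by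
    intro u hu
    rw [show S.alphaE * i * (u * S.alphaE⁻¹) =
      S.alphaE * (i * n) * S.alphaE⁻¹ * (S.alphaE * (n⁻¹ * u) * S.alphaE⁻¹) by group,
      Subgroup.mul_mem_cancel_left _ hinK,
      alpha_conj_NS_mem (mul_mem (inv_mem hn) (rep0_mem hu))]
  rw [F_apply_sum, Finset.sum_eq_single u]
  · have h := (key u hu).2 hun
    rw [D.std_apply h]
    have e : S.alphaE * i * (u * S.alphaE⁻¹) = S.alphaE * (i * u) * S.alphaE⁻¹ := by group
    rw [e] at h ⊢
    exact hw _ (alpha_conj_I1S (mul_mem hi (NS_le_I1S (rep0_mem hu))) h)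
  · intro u' hu' hne
    exact D.std_apply_eq_zero (fun h => hne (huniq u' ⟨hu', (key u' hu').1 h⟩)) w
  · exact fun h => (h hu).elim

lemma F_supp {w : W} {x : S.GG} (h : D.F w x ≠ 0) :
    ∃ k ∈ S.K1S, ∃ u ∈ S.NS 0, x = k * S.alphaE * u := by
  rw [F_apply_sum] at h
  obtain ⟨u, hu, hne⟩ := Finset.exists_ne_zero_of_sum_ne_zero h
  exact ⟨_, D.mem_of_std_ne_zero hne, u⁻¹, inv_mem (rep0_mem hu), by group⟩

lemma F_right {w : W} (hw : w ∈ D.L) (x : S.GG) {i : S.GG} (hi : i ∈ S.I1S) :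
    D.F w (x * i) = D.F w x := by
  by_cases h : D.F w x = 0
  · by_contra h'
    rw [h] at h'
    obtain ⟨k, hk, u, hu, e⟩ := D.F_supp h'
    rw [show x = k * S.alphaE * (u * i⁻¹) by rw [← mul_assoc, ← e]; group,
      D.F_apply hw hk (mul_mem (NS_le_I1S hu) (inv_mem hi))] at h
    rw [e, D.F_apply hw hk (NS_le_I1S hu)] at h'
    exact h' h
  · obtain ⟨k, hk, u, hu, rfl⟩ := D.F_supp h
    rw [mul_assoc, D.F_apply hw hk (NS_le_I1S hu), D.F_apply hw hk (mul_mem (NS_le_I1S hu) hi)]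

lemma F_alpha {w : W} (hw : w ∈ D.L) : D.F w S.alphaE = w := by
  have := D.F_apply hw (one_mem S.K1S) (one_mem S.I1S)
  rwa [one_mul, mul_one, D.s_one_apply] at this

lemma F_beta {w : W} (hw : w ∈ D.L) : D.F w S.betaE = D.s S.betaPr w := by
  rw [← betaPr_mul_alpha, D.F_equivar w _ betaPr_mem_K1S, D.F_alpha hw]

/-- Elements of `K₁` are not in the support of `F w`. -/
lemma F_K1S (w : W) {k : S.GG} (hk : k ∈ S.K1S) : D.F w k = 0 := by
  by_contra h
  obtain ⟨k', hk', u, hu, rfl⟩ := D.F_supp h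
  rw [mul_assoc, Subgroup.mul_mem_cancel_left _ hk'] at hk
  exact alpha_K0S_notMem_K1S (IS_00_notMem (NS_le_IS hu)) hk

lemma F_supp_K0 {w : W} {x : S.GG} (h : D.F w x ≠ 0) :
    ∃ k ∈ S.K1S, ∃ u ∈ S.K0S, x = k * S.alphaE * u := by
  obtain ⟨k, hk, u, hu, e⟩ := D.F_supp h
  exact ⟨k, hk, u, IS_le_K0S (NS_le_IS hu), e⟩

end WeightDatum

end U21

namespace U21

open Setting

/-- A weight of `K₁` together with its compact induction and its Hecke operator. -/
structure HeckeDatum (S : Setting) (𝔽 : Type) [Field 𝔽] (W : Type) [AddCommGroup W]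
    [Module 𝔽 W] extends WeightDatum S 𝔽 W where
  P : Submodule 𝔽 (S.GG → W)
  mem_P : ∀ f, f ∈ P ↔ toWeightDatum.IsInd f
  ρ : Representation 𝔽 S.GG P
  ρ_apply : ∀ (g : S.GG) (f : P) (x : S.GG), (ρ g f).1 x = f.1 (x * g)
  T : Module.End 𝔽 P
  T_equivar : ∀ (g : S.GG) (f : P), T (ρ g f) = ρ g (T f)
  T_std : ∀ (v : W) (f : P), f.1 = toWeightDatum.std 1 v → ∀ U2 U1 : Finset S.GG,
    S.IsReps (S.NS (-1)) (S.NS 1) U2 → S.IsReps (S.NS 0) (S.NS 1) U1 →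
    (T f).1 = (∑ u ∈ U2, toWeightDatum.std (u * S.alphaE⁻¹) (j (s u⁻¹ v))) +
      ∑ u ∈ U1, toWeightDatum.std (S.betaPr * u * S.alphaE⁻¹) (j (s S.betaPr v))

namespace Setting

variable {S : Setting}

lemma mem_NS_one_of_alpha_conj {n : S.GG} (hn : n ∈ S.NS (-1))
    (h : S.alphaE * n * S.alphaE⁻¹ ∈ S.K1S) : n ∈ S.NS 1 := by
  have h02 := mem_K1S.1 h 0 2
  rw [mat_mul_alphaInv, mat_alpha_mul, zpow_mul_mem_pE, zpow_mul_mem_pE] at h02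
  rw [mem_NS, mem_Nk_iff] at hn ⊢
  have h02' : S.mat n 0 2 ∈ S.pE 1 := by simpa [eK] using h02
  tauto

lemma IsReps.image_mul {A B C : Subgroup S.GG} (hBA : B ≤ A) (hCB : C ≤ B) {U V : Finset S.GG}
    (hU : S.IsReps A B U) (hV : S.IsReps B C V) :
    S.IsReps A C ((U ×ˢ V).image fun z => z.1 * z.2) ∧
      Set.InjOn (fun z : S.GG × S.GG => z.1 * z.2) (U ×ˢ V : Finset (S.GG × S.GG)) := by
  have huniq : ∀ u ∈ U, ∀ v ∈ V, ∀ u' ∈ U, ∀ v' ∈ V, (u * v)⁻¹ * (u' * v') ∈ C →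
      u = u' ∧ v = v' := by
    intro u hu v hv u' hu' v' hv' h
    have hvB : v ∈ B := hV.1 hv
    have hvB' : v' ∈ B := hV.1 hv'
    have hB : u⁻¹ * u' ∈ B := by
      have := mul_mem (mul_mem hvB (hCB h)) (inv_mem hvB')
      rwa [show v * ((u * v)⁻¹ * (u' * v')) * v'⁻¹ = u⁻¹ * u' by group] at this
    have e : u = u' := (hU.2 u (hU.1 hu)).unique ⟨hu, by
      rw [inv_mul_cancel]; exact one_mem B⟩ ⟨hu', hB⟩
    subst e
    refine ⟨rfl, (hV.2 v hvB).unique ⟨hv, by rw [inv_mul_cancel]; exact one_mem C⟩ ⟨hv', ?_⟩⟩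
    rwa [show (u * v)⁻¹ * (u * v') = v⁻¹ * v' by group] at h
  constructor
  · constructor
    · intro x hx
      obtain ⟨⟨u, v⟩, hz, rfl⟩ := Finset.mem_image.1 hx
      obtain ⟨hu, hv⟩ := Finset.mem_product.1 hz
      exact mul_mem (hU.1 hu) (hBA (hV.1 hv))
    · intro a ha
      obtain ⟨u, ⟨hu, hau⟩, -⟩ := hU.2 a ha
      have h1 : u⁻¹ * a ∈ B := by
        have := inv_mem hau
        rwa [mul_inv_rev, inv_inv] at this
      obtain ⟨v, ⟨hv, hav⟩, -⟩ := hV.2 _ h1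
      have hav' : a⁻¹ * (u * v) ∈ C := by
        have e : (u⁻¹ * a)⁻¹ * v = a⁻¹ * (u * v) := by group
        exact e ▸ hav
      refine ⟨u * v, ⟨Finset.mem_image.2 ⟨(u, v), Finset.mem_product.2 ⟨hu, hv⟩, rfl⟩, hav'⟩, ?_⟩
      rintro _ ⟨hz, haz⟩
      obtain ⟨⟨u', v'⟩, hz', rfl⟩ := Finset.mem_image.1 hz
      obtain ⟨hu', hv'⟩ := Finset.mem_product.1 hz'
      have h2 : (u * v)⁻¹ * (u' * v') ∈ C := by
        have := mul_mem (inv_mem hav') haz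
        rwa [show (a⁻¹ * (u * v))⁻¹ * (a⁻¹ * (u' * v')) = (u * v)⁻¹ * (u' * v') by group] at this
      obtain ⟨rfl, rfl⟩ := huniq u hu v hv u' hu' v' hv' h2
      rfl
  · rintro ⟨u, v⟩ hz ⟨u', v'⟩ hz' h
    obtain ⟨hu, hv⟩ := Finset.mem_product.1 (Finset.mem_coe.1 hz)
    obtain ⟨hu', hv'⟩ := Finset.mem_product.1 (Finset.mem_coe.1 hz')
    have h' : u * v = u' * v' := h
    obtain ⟨rfl, rfl⟩ := huniq u hu v hv u' hu' v' hv' (by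
      rw [h', inv_mul_cancel]
      exact one_mem C)
    rfl

lemma alpha_mul_betaPr_notMem {u : S.GG} (hu : u ∈ S.NS 0) :
    S.alphaE * S.betaPr * (u * S.alphaE⁻¹) ∉ S.K1S := by
  intro h
  have h02 := mem_K1S.1 h 0 2
  rw [← mul_assoc, mat_mul_alphaInv, mul_assoc, mat_alpha_mul, mat_betaPr_mul, rev_zero3,
    (mem_Nk_iff.1 (mem_NS.1 hu)).2.2.1, zpow_mul_mem_pE, zpow_mul_mem_pE, zpow_mul_mem_pE] at h02
  exact one_notMem_pE (pE_mono h02 (by simp [eK]))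

end Setting

namespace HeckeDatum

variable {S : Setting} {𝔽 : Type} [Field 𝔽] {W : Type} [AddCommGroup W] [Module 𝔽 W]
  (D : HeckeDatum S 𝔽 W)

lemma isInd (f : D.P) : D.IsInd f.1 := (D.mem_P f.1).1 f.2

lemma equivar (f : D.P) : D.Equivar f.1 := (D.isInd f).1

/-- The standard function as an element of the compact induction. -/
def stdP (g : S.GG) (v : W) : D.P := ⟨D.std g v, (D.mem_P _).2 (D.std_isInd g v)⟩

@[simp] lemma coe_stdP (g : S.GG) (v : W) : (D.stdP g v).1 = D.std g v := rfl

lemma ρ_stdP (h g : S.GG) (v : W) : D.ρ h (D.stdP g v) = D.stdP (h * g) v :=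
  Subtype.ext <| funext fun x => by rw [ρ_apply]; exact D.std_mul g h x v

lemma ρ_mul_apply (g h : S.GG) (f : D.P) : D.ρ (g * h) f = D.ρ g (D.ρ h f) := by
  rw [map_mul]
  rfl

lemma ρ_one_apply (f : D.P) : D.ρ 1 f = f := by
  rw [map_one]
  rfl

lemma stdP_right {k : S.GG} (hk : k ∈ S.K1S) (g : S.GG) (v : W) :
    D.stdP (g * k) v = D.stdP g (D.s k v) := Subtype.ext (D.std_right hk g v)

lemma F_mem (w : W) : D.F w ∈ D.P := D.P.sum_mem fun u _ => (D.stdP (u * S.alphaE⁻¹) w).2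

/-- The function `F w` as an element of the compact induction. -/
def FP (w : W) : D.P := ⟨D.F w, D.F_mem w⟩

@[simp] lemma coe_FP (w : W) : (D.FP w).1 = D.F w := rfl

lemma ind_induction {M : D.P → Prop} (f : D.P) (h0 : M 0) (hadd : ∀ a b, M a → M b → M (a + b))
    (hstd : ∀ g v, f.1 g ≠ 0 → M (D.stdP g⁻¹ v)) : M f := by
  obtain ⟨t, ht⟩ := (D.isInd f).2
  suffices H : ∀ (t : Finset S.GG) (f : D.P), (∀ g, f.1 g ≠ 0 → ∃ k ∈ S.K1S, ∃ x ∈ t, g = k * x) →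
      (∀ g v, f.1 g ≠ 0 → M (D.stdP g⁻¹ v)) → M f from H t f ht hstd
  clear ht hstd f t
  intro t
  induction t using Finset.induction_on with
  | empty =>
    intro f hf _
    have : f = 0 := Subtype.ext <| funext fun g => by
      by_contra h
      obtain ⟨k, -, x, hx, -⟩ := hf g h
      simp at hx
    rwa [this]
  | insert a t _ ih =>
    intro f hf hM
    have hsub : ∀ g, (f - D.stdP a⁻¹ (f.1 a)).1 g ≠ 0 → g * a⁻¹ ∉ S.K1S ∧ f.1 g ≠ 0 := by
      intro g hg
      change f.1 g - D.std a⁻¹ (f.1 a) g ≠ 0 at hg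
      by_cases h : g * a⁻¹ ∈ S.K1S
      · rw [D.std_apply h, ← D.equivar f _ h, inv_mul_cancel_right, sub_self] at hg
        exact (hg rfl).elim
      · rw [D.std_apply_eq_zero h, sub_zero] at hg
        exact ⟨h, hg⟩
    rw [← sub_add_cancel f (D.stdP a⁻¹ (f.1 a))]
    refine hadd _ _ (ih _ (fun g hg => ?_) fun g v hg => hM g v (hsub g hg).2) ?_
    · obtain ⟨hga, hg⟩ := hsub g hg
      obtain ⟨k, hk, x, hx, rfl⟩ := hf g hg
      rcases Finset.mem_insert.1 hx with rfl | hx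
      · rw [mul_inv_cancel_right] at hga
        exact (hga hk).elim
      · exact ⟨k, hk, x, hx, rfl⟩
    · by_cases h : f.1 a = 0
      · rw [h]
        have : D.stdP a⁻¹ (0 : W) = 0 := Subtype.ext <| funext fun g => by
          change D.std _ _ g = 0
          unfold WeightDatum.std
          split_ifs
          · exact map_zero _
          · rfl
        rwa [this]
      · exact hM a _ h

lemma T_one {U : Finset S.GG} (hU : S.IsReps (S.NS (-1)) (S.NS 0) U) (v : W) :
    D.T (D.stdP 1 v) = (∑ a ∈ U, D.ρ a (D.FP (D.j (D.s a⁻¹ v)))) +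
      D.ρ S.betaPr (D.FP (D.j (D.s S.betaPr v))) := by
  obtain ⟨hU2, hinj⟩ := hU.image_mul (NS_mono (by norm_num)) (NS_mono (by norm_num)) S.rep0_spec
  refine Subtype.ext (funext fun x => ?_)
  have h := congrFun (D.T_std v (D.stdP 1 v) (D.coe_stdP 1 v) _ _ hU2 S.rep0_spec) x
  refine h.trans ?_
  clear h
  rw [Pi.add_apply, Finset.sum_apply, Finset.sum_apply, Finset.sum_image hinj,
    Finset.sum_product, Submodule.coe_add, Submodule.coe_sum, Pi.add_apply, Finset.sum_apply,
    ρ_apply, coe_FP, WeightDatum.F_apply_sum]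
  congr 1
  · refine Finset.sum_congr rfl fun a ha => ?_
    rw [ρ_apply, coe_FP, WeightDatum.F_apply_sum]
    refine Finset.sum_congr rfl fun u hu => ?_
    have huK := inv_mem (rep0_mem hu)
    rw [WeightDatum.std_mul, mul_inv_rev,
      D.s_mul_apply (NS_le_K1S (NS_mono (by norm_num) huK)) (inv_mem (NS_le_K1S (hU.1 ha))),
      D.s_kone_apply (NS_zero_subset_Kone1 huK), mul_assoc]
  · refine Finset.sum_congr rfl fun u hu => ?_
    rw [WeightDatum.std_mul, mul_assoc]

lemma T_one_supp {v : W} {x : S.GG} (h : (D.T (D.stdP 1 v)).1 x ≠ 0) :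
    ∃ k ∈ S.K1S, ∃ k' ∈ S.K1S, x = k * S.alphaE * k' := by
  obtain ⟨U, hU⟩ := S.exists_reps_neg_one
  have key : ∀ a ∈ S.K1S, ∀ w, D.F w (x * a) ≠ 0 →
      ∃ k ∈ S.K1S, ∃ k' ∈ S.K1S, x = k * S.alphaE * k' := by
    intro a ha w hw
    obtain ⟨k, hk, u, hu, e⟩ := D.F_supp hw
    refine ⟨k, hk, u * a⁻¹, mul_mem (NS_le_K1S (NS_mono (by norm_num) hu)) (inv_mem ha), ?_⟩
    rw [← mul_assoc, ← e, mul_inv_cancel_right]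
  rw [D.T_one hU, Submodule.coe_add, Submodule.coe_sum, Pi.add_apply, Finset.sum_apply] at h
  simp only [ρ_apply, coe_FP] at h
  by_cases h2 : D.F (D.j (D.s S.betaPr v)) (x * S.betaPr) = 0
  · rw [h2, add_zero] at h
    obtain ⟨a, ha, h⟩ := Finset.exists_ne_zero_of_sum_ne_zero h
    exact key a (NS_le_K1S (hU.1 ha)) _ h
  · exact key _ betaPr_mem_K1S _ h2

/-- The operator `T + c`. -/
def Tc (c : 𝔽) : Module.End 𝔽 D.P := D.T + c • 1

lemma Tc_coe (c : 𝔽) (f : D.P) (x : S.GG) : (D.Tc c f).1 x = (D.T f).1 x + c • f.1 x := rfl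

lemma Tc_equivar (c : 𝔽) (g : S.GG) (f : D.P) : D.Tc c (D.ρ g f) = D.ρ g (D.Tc c f) := by
  change D.T (D.ρ g f) + c • D.ρ g f = D.ρ g (D.T f + c • f)
  rw [map_add, map_smul, T_equivar]

lemma exists_supp_Lev (f : D.P) : ∃ m : ℕ, ∀ x, f.1 x ≠ 0 → x ∈ S.Lev m := by
  obtain ⟨t, ht⟩ := (D.isInd f).2
  choose N hN using fun g : S.GG => exists_mem_Lev g
  refine ⟨t.sup N, fun x hx => ?_⟩
  obtain ⟨k, hk, y, hy, rfl⟩ := ht x hx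
  exact Lev_K1_mul hk (Lev_mono (by exact_mod_cast Finset.le_sup (f := N) hy) (hN y))

variable [CharP 𝔽 S.p] [Nontrivial W]

lemma T_one_alpha (v : W) : (D.T (D.stdP 1 v)).1 S.alphaE = D.j v := by
  obtain ⟨U, hU⟩ := S.exists_reps_neg_one
  rw [D.T_one hU, Submodule.coe_add, Submodule.coe_sum, Pi.add_apply, Finset.sum_apply]
  simp only [ρ_apply, coe_FP]
  have h2 : D.F (D.j (D.s S.betaPr v)) (S.alphaE * S.betaPr) = 0 := by
    rw [WeightDatum.F_apply_sum]
    exact Finset.sum_eq_zero fun u hu =>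
      D.std_apply_eq_zero (alpha_mul_betaPr_notMem (rep0_mem hu)) _
  obtain ⟨a, ⟨ha, ha0⟩, huniq⟩ := hU.2 1 (one_mem (S.NS (-1)))
  rw [inv_one, one_mul] at ha0
  rw [h2, add_zero, Finset.sum_eq_single a]
  · have := D.F_right (D.j_mem_L (D.s a⁻¹ v)) S.alphaE (NS_le_I1S ha0)
    rw [this, D.F_alpha (D.j_mem_L _), D.s_kone_apply (NS_zero_subset_Kone1 (inv_mem ha0))]
  · intro b hb hne
    by_contra h
    obtain ⟨k, hk, u, hu, e⟩ := D.F_supp h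
    refine hne (huniq b ⟨hb, ?_⟩)
    rw [inv_one, one_mul]
    have hbN : b ∈ S.NS (-1) := hU.1 hb
    have h1 : b * u⁻¹ ∈ S.NS 1 := by
      refine mem_NS_one_of_alpha_conj (mul_mem hbN (inv_mem (NS_mono (by norm_num) hu))) ?_
      rw [← mul_assoc, e]
      simpa using hk
    have := mul_mem (NS_mono (show (0 : ℤ) ≤ 1 by norm_num) h1) hu
    rwa [inv_mul_cancel_right] at this
  · exact fun h => (h ha).elim

lemma T_apply_alpha_mul {f : D.P} {n : ℤ} {g : S.GG} (hf : ∀ x, f.1 x ≠ 0 → x ∈ S.Lev n)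
    (h10 : S.mat g 1 0 = 0) (h20 : S.mat g 2 0 = 0) (h00 : S.mat g 0 0 ∉ S.pE (1 - n)) :
    (D.T f).1 (S.alphaE * g) = D.j (f.1 g) := by
  refine D.ind_induction (M := fun f => (D.T f).1 (S.alphaE * g) = D.j (f.1 g)) f ?_ ?_ ?_
  · rw [map_zero]
    exact (map_zero _).symm
  · intro a b ha hb
    rw [map_add, Submodule.coe_add, Submodule.coe_add, Pi.add_apply, Pi.add_apply, map_add, ha, hb]
  · intro y v hy
    have hy := hf y hy
    have e1 : D.stdP y⁻¹ v = D.ρ y⁻¹ (D.stdP 1 v) := by rw [ρ_stdP, mul_one]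
    by_cases hk : g * y⁻¹ ∈ S.K1S
    · rw [coe_stdP, D.std_apply hk, ← D.T_one_alpha, e1, D.T_equivar, ρ_apply, mul_assoc,
        ← D.ρ_apply, ← D.T_equivar, ρ_stdP, mul_one]
      have := D.stdP_right hk 1 v
      rw [one_mul] at this
      rw [this]
    · rw [coe_stdP, D.std_apply_eq_zero hk, map_zero, e1, D.T_equivar, ρ_apply]
      by_contra h
      obtain ⟨k, hk1, k', hk', e⟩ := D.T_one_supp h
      have ey : k' * y = S.alphaE⁻¹ * k⁻¹ * S.alphaE * g := by
        rw [← mul_inv_eq_iff_eq_mul] at e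
        rw [show k' = (k * S.alphaE)⁻¹ * (k * S.alphaE * k') by group, ← mul_inv_eq_iff_eq_mul.1 e]
        group
      have h1 := conj_mem_K1S_of_Lev (inv_mem hk1) h10 h20 h00 (ey ▸ Lev_K1_mul hk' hy)
      apply hk
      have : g * y⁻¹ = (S.alphaE⁻¹ * k⁻¹ * S.alphaE)⁻¹ * k' := by
        rw [eq_inv_mul_iff_mul_eq, ← mul_assoc, ← ey, mul_inv_cancel_right]
      rw [this]
      exact mul_mem (inv_mem h1) hk'

lemma Tc_apply_alpha_mul (c : 𝔽) {f : D.P} {n : ℤ} {g : S.GG}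
    (hf : ∀ x, f.1 x ≠ 0 → x ∈ S.Lev n) (h10 : S.mat g 1 0 = 0) (h20 : S.mat g 2 0 = 0)
    (h00 : S.mat g 0 0 ∉ S.pE (1 - n)) : (D.Tc c f).1 (S.alphaE * g) = D.j (f.1 g) := by
  rw [Tc_coe, D.T_apply_alpha_mul hf h10 h20 h00, add_eq_left]
  rw [not_not.1 fun h => alpha_mul_notMem_Lev h00 (hf _ h), smul_zero]

lemma supp_Lev_zero_of_Tc (c : 𝔽) {f : D.P} (hf : ∀ x, (D.Tc c f).1 x ≠ 0 → x ∈ S.Lev 1) :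
    ∀ x, f.1 x ≠ 0 → x ∈ S.Lev 0 := by
  obtain ⟨m, hm⟩ := D.exists_supp_Lev f
  induction m with
  | zero => exact_mod_cast hm
  | succ m ih =>
    refine ih fun g hg => ?_
    by_contra hgm
    obtain ⟨k, hk, h10, h20⟩ := iwasawa_K1 g
    have hk1 : k * g ∈ S.Lev (m + 1 : ℕ) := Lev_K1_mul hk (hm g hg)
    have h00 : S.mat (k * g) 0 0 ∉ S.pE (1 - (m + 1 : ℕ)) := by
      intro h
      refine hgm ((Lev_K1_mul_iff hk).1 ⟨pE_mono h (by push_cast; omega), ?_, ?_⟩)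
      · rw [h10]; exact zero_mem_pE _
      · rw [h20]; exact zero_mem_pE _
    refine hg (D.s_eq_zero hk ?_)
    rw [← D.equivar f k hk]
    refine D.eq_zero_of_j fun u hu => ?_
    obtain ⟨u00, -, -, u10, u20, u21, -⟩ := mem_Nk_iff.1 (mem_NS.1 hu)
    have e00 : S.mat (u * (k * g)) 0 0 = S.mat (k * g) 0 0 := by
      rw [mat_mul_apply, h10, h20, u00]; ring
    rw [← e00] at h00
    have e10 : S.mat (u * (k * g)) 1 0 = 0 := by rw [mat_mul_apply, h10, h20, u10]; ring
    have e20 : S.mat (u * (k * g)) 2 0 = 0 := by rw [mat_mul_apply, h10, h20, u20]; ring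
    rw [← D.equivar f u (NS_le_K1S hu), ← D.Tc_apply_alpha_mul c hm e10 e20 h00]
    by_contra h
    exact alpha_mul_notMem_Lev h00 (Lev_mono (by push_cast; omega) (hf _ h))

/-- The function `F w + c [1, w]`. -/
def Fc (c : 𝔽) (w : W) : D.P := D.FP w + c • D.stdP 1 w

lemma Tc_one {c : 𝔽} (hc : c = 0 ∨ ∀ w, D.j w = w) {U : Finset S.GG}
    (hU : S.IsReps (S.NS (-1)) (S.NS 0) U) (v : W) :
    D.Tc c (D.stdP 1 v) = (∑ a ∈ U, D.ρ a (D.Fc c (D.j (D.s a⁻¹ v)))) +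
      D.ρ S.betaPr (D.Fc c (D.j (D.s S.betaPr v))) := by
  have key : c • D.stdP 1 v = c • ((∑ a ∈ U, D.ρ a (D.stdP 1 (D.j (D.s a⁻¹ v)))) +
      D.ρ S.betaPr (D.stdP 1 (D.j (D.s S.betaPr v)))) := by
    rcases hc with rfl | hj
    · rw [zero_smul, zero_smul]
    · congr 1
      have h : ∀ a ∈ S.K1S, D.ρ a (D.stdP 1 (D.s a⁻¹ v)) = D.stdP 1 v := by
        intro a ha
        have := D.stdP_right ha 1 (D.s a⁻¹ v)
        rw [one_mul] at this
        rw [ρ_stdP, mul_one, this, D.s_apply_inv ha]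
      simp only [hj]
      rw [Finset.sum_congr rfl fun a ha => h a (NS_le_K1S (hU.1 ha)), Finset.sum_const,
        ← Nat.cast_smul_eq_nsmul 𝔽, hU.card_eq_zero 𝔽, zero_smul, zero_add]
      have := h _ betaPr_mem_K1S
      rw [betaPr_inv] at this
      exact this.symm
  change D.T (D.stdP 1 v) + c • D.stdP 1 v = _
  rw [key, D.T_one hU]
  simp only [Fc, map_add, map_smul, Finset.sum_add_distrib, smul_add, Finset.smul_sum]
  abel

lemma range_Tc_le {c : 𝔽} (hc : c = 0 ∨ ∀ w, D.j w = w) {N : Submodule 𝔽 D.P}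
    (hN : ∀ g, ∀ f ∈ N, D.ρ g f ∈ N) (hF : ∀ w ∈ D.L, D.Fc c w ∈ N) :
    LinearMap.range (D.Tc c) ≤ N := by
  rintro _ ⟨f, rfl⟩
  obtain ⟨U, hU⟩ := S.exists_reps_neg_one
  refine D.ind_induction (M := fun f => D.Tc c f ∈ N) f ?_ ?_ ?_
  · rw [map_zero]
    exact N.zero_mem
  · intro a b ha hb
    rw [map_add]
    exact N.add_mem ha hb
  · intro g v _
    have e : D.stdP g⁻¹ v = D.ρ g⁻¹ (D.stdP 1 v) := by rw [ρ_stdP, mul_one]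
    rw [e, Tc_equivar, D.Tc_one hc hU]
    exact hN _ _ (N.add_mem (N.sum_mem fun a _ => hN _ _ (hF _ (D.j_mem_L _)))
      (hN _ _ (hF _ (D.j_mem_L _))))

end HeckeDatum

end U21

namespace U21

namespace HeckeDatum

open Setting

variable {S : Setting} {𝔽 : Type} [Field 𝔽] {W : Type} [AddCommGroup W] [Module 𝔽 W]
  (D : HeckeDatum S 𝔽 W)

/-- A `K₀`-stable space of functions supported on `K₁αK₀` which are detected on `αN_0`, and
which contains the functions `F w + c [1, w]`. -/
structure IsTransfer (c : 𝔽) (Q : Submodule 𝔽 D.P) : Prop where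
  stable : ∀ k ∈ S.K0S, ∀ t ∈ Q, D.ρ k t ∈ Q
  supp : ∀ t ∈ Q, ∀ x, t.1 x ≠ 0 → ∃ k ∈ S.K1S, ∃ k' ∈ S.K0S, x = k * S.alphaE * k'
  detect : ∀ t ∈ Q, t ≠ 0 → ∃ u ∈ S.NS 0, t.1 (S.alphaE * u) ≠ 0
  mem : ∀ w ∈ D.L, D.Fc c w ∈ Q

/-- The subrepresentation generated by a subspace. -/
def gen (Q : Submodule 𝔽 D.P) : Submodule 𝔽 D.P := ⨆ g : S.GG, Q.map (D.ρ g)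

lemma ρ_mem_gen {Q : Submodule 𝔽 D.P} {t : D.P} (ht : t ∈ Q) (g : S.GG) : D.ρ g t ∈ D.gen Q :=
  Submodule.mem_iSup_of_mem g (Submodule.mem_map_of_mem ht)

lemma gen_invariant (Q : Submodule 𝔽 D.P) (g : S.GG) : ∀ f ∈ D.gen Q, D.ρ g f ∈ D.gen Q := by
  change D.gen Q ≤ (D.gen Q).comap (D.ρ g)
  refine iSup_le fun h => ?_
  rintro _ ⟨t, ht, rfl⟩
  rw [Submodule.mem_comap, ← ρ_mul_apply]
  exact D.ρ_mem_gen ht _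

namespace IsTransfer

variable {D} {c : 𝔽} {Q : Submodule 𝔽 D.P} (h : D.IsTransfer c Q)

include h

lemma exists_sum {x : D.P} (hx : x ∈ D.gen Q) :
    ∃ (ι : Type) (Y : Finset ι) (y : ι → S.GG) (t : ι → D.P), (∀ i ∈ Y, t i ∈ Q ∧ t i ≠ 0) ∧
      (∀ i j, y j * (y i)⁻¹ ∈ S.K0S → i = j) ∧ x = ∑ i ∈ Y, D.ρ (y i)⁻¹ (t i) := by
  let ι := Quotient (QuotientGroup.rightRel S.K0S)
  have hle : D.gen Q ≤ ⨆ i : ι, Q.map (D.ρ i.out⁻¹) := by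
    refine iSup_le fun g => ?_
    rintro _ ⟨t, ht, rfl⟩
    let i : ι := Quotient.mk _ g⁻¹
    have hi : g⁻¹ * i.out⁻¹ ∈ S.K0S := QuotientGroup.rightRel_apply.1 (Quotient.mk_out g⁻¹)
    refine Submodule.mem_iSup_of_mem i ⟨_, h.stable _ (inv_mem hi) t ht, ?_⟩
    rw [← ρ_mul_apply]
    congr 2
    group
  obtain ⟨f, hf, hfx⟩ := (Submodule.mem_iSup_iff_exists_finsupp _ _).1 (hle hx)
  choose t ht hft using hf
  refine ⟨ι, f.support, fun i => i.out, t, fun i hi => ⟨ht i, ?_⟩, fun i j hij => ?_, ?_⟩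
  · intro h0
    rw [Finsupp.mem_support_iff, ← hft i, h0, map_zero] at hi
    exact hi rfl
  · have := Quotient.sound (s := QuotientGroup.rightRel S.K0S)
      (QuotientGroup.rightRel_apply.2 hij)
    rwa [Quotient.out_eq, Quotient.out_eq] at this
  · rw [← hfx, Finsupp.sum]
    exact Finset.sum_congr rfl fun i _ => (hft i).symm

lemma mem_Lev0 {ι : Type} {Y : Finset ι} {y : ι → S.GG} {t : ι → D.P}
    (ht : ∀ i ∈ Y, t i ∈ Q ∧ t i ≠ 0) (hy : ∀ i j, y j * (y i)⁻¹ ∈ S.K0S → i = j)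
    (hsupp : ∀ z, (∑ i ∈ Y, D.ρ (y i)⁻¹ (t i)).1 z ≠ 0 → z ∈ S.K1S) :
    ∀ i ∈ Y, y i ∈ S.Lev0 (-1) := by
  have hstep : ∀ n : ℕ, (∀ i ∈ Y, y i ∈ S.Lev0 n) → ∀ i ∈ Y, y i ∈ S.Lev0 ((n : ℤ) - 1) := by
    intro n hn i hi
    by_contra hyi
    obtain ⟨k, hk, h10, h20⟩ := iwasawa_K0 (y i)
    have hky : k * y i ∉ S.Lev0 ((n : ℤ) - 1) := fun h => hyi ((Lev0_K0_mul_iff hk).1 h)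
    have h00 : S.mat (k * y i) 0 0 ∉ S.pE (1 - n) := by
      intro h
      refine hky fun j => ?_
      fin_cases j
      · exact pE_mono h (by omega)
      · change S.mat (k * y i) 1 0 ∈ _
        rw [h10]
        exact zero_mem_pE _
      · change S.mat (k * y i) 2 0 ∈ _
        rw [h20]
        exact zero_mem_pE _
    obtain ⟨htQ, ht0⟩ := ht i hi
    obtain ⟨u, hu, hne⟩ := h.detect (D.ρ k (t i)) (h.stable k hk _ htQ) (fun h0 => ht0 (by
      rw [← D.ρ_one_apply (t i), ← inv_mul_cancel k, ρ_mul_apply, h0, map_zero]))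
    rw [ρ_apply] at hne
    obtain ⟨u00, -, -, u10, u20, -⟩ := mem_Nk_iff.1 (mem_NS.1 hu)
    have e00 : S.mat (u * (k * y i)) 0 0 = S.mat (k * y i) 0 0 := by
      rw [mat_mul_apply, h10, h20, u00]; ring
    rw [← e00] at h00
    have e10 : S.mat (u * (k * y i)) 1 0 = 0 := by rw [mat_mul_apply, h10, h20, u10]; ring
    have e20 : S.mat (u * (k * y i)) 2 0 = 0 := by rw [mat_mul_apply, h10, h20, u20]; ring
    refine alpha_mul_notMem_Lev h00 (Lev_mono (by omega) (K1S_subset_Lev (hsupp _ ?_)))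
    rw [Submodule.coe_sum, Finset.sum_apply, Finset.sum_eq_single i]
    · rw [ρ_apply]
      convert hne using 2
      group
    · intro j hj hji
      rw [ρ_apply]
      by_contra hz
      obtain ⟨κ, hκ, κ', hκ', e⟩ := h.supp _ (ht j hj).1 _ hz
      have e' : κ' * y j = S.alphaE⁻¹ * κ⁻¹ * S.alphaE * (u * (k * y i)) := by
        rw [show κ' = (κ * S.alphaE)⁻¹ * (κ * S.alphaE * κ') by group, ← e]
        group
      have h1 := conj_mem_K0S_of_Lev0 (inv_mem hκ) e10 e20 h00 (e' ▸ Lev0_K0_mul hκ' (hn j hj))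
      refine hji (hy j i ?_)
      have e2 : y i * (y j)⁻¹ = (S.alphaE⁻¹ * κ⁻¹ * S.alphaE * (u * k))⁻¹ * κ' := by
        rw [eq_inv_mul_iff_mul_eq, ← mul_assoc, mul_inv_eq_iff_eq_mul, e']
        group
      rw [e2]
      exact mul_mem (inv_mem (mul_mem h1 (mul_mem (IS_le_K0S (NS_le_IS hu)) hk))) hκ'
    · exact fun h => (h hi).elim
  choose N hN using fun g : S.GG => exists_mem_Lev0 g
  have htop : ∀ i ∈ Y, y i ∈ S.Lev0 (Y.sup fun i => N (y i) : ℕ) := fun i hi =>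
    Lev0_mono (by exact_mod_cast Finset.le_sup (f := fun i => N (y i)) hi) (hN (y i))
  generalize (Y.sup fun i => N (y i)) = m at htop
  induction m with
  | zero => exact_mod_cast hstep 0 htop
  | succ m ih => exact ih (by simpa using hstep _ htop)

lemma stdP_notMem {v : W} (hv : v ≠ 0) : D.stdP 1 v ∉ D.gen Q := by
  intro hmem
  obtain ⟨ι, Y, y, t, ht, hy, hx⟩ := h.exists_sum hmem
  have h1 := h.mem_Lev0 ht hy (fun z hz => by
    rw [← hx] at hz
    simpa using D.mem_of_std_ne_zero hz)
  have h2 := h.mem_Lev0 (y := fun i => y i * S.betaPr) ht (fun i j hij => hy i j (by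
    rwa [mul_inv_rev, mul_assoc, mul_inv_cancel_left] at hij)) (fun z hz => by
    have e : ∑ i ∈ Y, D.ρ (y i * S.betaPr)⁻¹ (t i) = D.ρ S.betaPr (D.stdP 1 v) := by
      rw [hx, map_sum]
      refine Finset.sum_congr rfl fun i _ => ?_
      rw [← ρ_mul_apply, mul_inv_rev, betaPr_inv]
    rw [e, ρ_stdP, mul_one] at hz
    exact (Subgroup.mul_mem_cancel_right _ betaPr_mem_K1S).1 (D.mem_of_std_ne_zero hz))
  rcases Y.eq_empty_or_nonempty with rfl | ⟨i, hi⟩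
  · rw [Finset.sum_empty] at hx
    apply hv
    have := congrArg (fun f : D.P => f.1 1) hx
    simp only [coe_stdP] at this
    rw [D.std_apply (by simp), mul_one, D.s_one_apply] at this
    exact this
  · have hcol := col_rel (y i) 0 2
    have a := h1 i hi
    have b : ∀ j, S.mat (y i) j 2 ∈ S.pE 0 := by
      intro j
      have := h2 i hi j
      rw [mat_mul_betaPr, zpow_mul_mem_pE] at this
      simpa using this
    have hp : ∀ j l, S.mat (y i) j 0 * S.conj (S.mat (y i) l 2) ∈ S.pE 1 := fun j l =>
      pE_mul 1 (a j) (conj_mem_pE (b l)) (by simp)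
    have := pE_add (pE_add (hp 0 2) (hp 1 1)) (hp 2 0)
    rw [hcol] at this
    exact one_notMem_pE (by simpa [betaM] using this)

lemma Fc_notMem_range [CharP 𝔽 S.p] [Nontrivial W] {w : W} (hw : w ∈ D.L) (hw0 : w ≠ 0) :
    D.Fc c w ∉ LinearMap.range (D.Tc c) := by
  rintro ⟨f, hf⟩
  have hsupp : ∀ t ∈ Q, ∀ x, t.1 x ≠ 0 → x ∈ S.Lev 1 := by
    intro t ht x hx
    obtain ⟨k, hk, k', hk', rfl⟩ := h.supp t ht x hx
    rw [mul_assoc]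
    exact Lev_K1_mul hk (alpha_K0S_subset_Lev hk')
  have h1 := D.supp_Lev_zero_of_Tc c (f := f) (hf ▸ hsupp _ (h.mem w hw))
  have h2 := D.supp_Lev_zero_of_Tc c (f := D.ρ S.betaE f) (by
    rw [Tc_equivar, hf]
    exact hsupp _ (h.stable _ beta_mem_K0S _ (h.mem w hw)))
  have hα : S.alphaE ∉ S.Lev 0 := by
    have := alpha_mul_notMem_Lev (S := S) (g := 1) (n := 0) (by
      rw [mat_one]; exact one_notMem_pE)
    rwa [mul_one] at this
  have hβ : f.1 S.betaPr = 0 := by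
    rw [← alpha_mul_beta, ← ρ_apply]
    exact not_not.1 fun h => hα (h2 _ h)
  have hf1 : f.1 1 = 0 := by
    rw [← betaPr_mul_self, D.equivar f _ betaPr_mem_K1S, hβ, map_zero]
  have h3 := D.Tc_apply_alpha_mul c (f := f) (n := 0) (g := 1) h1 (by simp [mat_one])
    (by simp [mat_one]) (by rw [mat_one]; exact one_notMem_pE)
  rw [hf1, map_zero, mul_one, hf] at h3
  apply hw0
  have hα' : S.alphaE * 1 ∉ S.K1S := fun h => hα (by simpa using K1S_subset_Lev h)
  have e : (D.Fc c w).1 S.alphaE = D.F w S.alphaE + c • D.std 1 w S.alphaE := rfl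
  rwa [e, D.F_alpha hw, D.std_apply_eq_zero hα', smul_zero, add_zero] at h3

theorem exists_intermediate [CharP 𝔽 S.p] [Nontrivial W] (hc : c = 0 ∨ ∀ w, D.j w = w) :
    ∃ N : Submodule 𝔽 D.P, (∀ g, ∀ f ∈ N, D.ρ g f ∈ N) ∧ LinearMap.range (D.Tc c) ≤ N ∧
      N ≠ LinearMap.range (D.Tc c) ∧ N ≠ ⊤ := by
  obtain ⟨w, hw, hw0⟩ := D.exists_L_ne_zero
  have hF : ∀ w ∈ D.L, D.Fc c w ∈ D.gen Q := fun w hw => by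
    rw [← D.ρ_one_apply (D.Fc c w)]
    exact D.ρ_mem_gen (h.mem w hw) 1
  refine ⟨D.gen Q, D.gen_invariant Q, D.range_Tc_le hc (D.gen_invariant Q) hF, ?_, ?_⟩
  · intro e
    exact h.Fc_notMem_range hw hw0 (e ▸ hF w hw)
  · intro e
    exact h.stdP_notMem hw0 (e ▸ Submodule.mem_top)

end IsTransfer

end HeckeDatum

end U21

namespace U21

namespace Setting

variable {S : Setting}

lemma det_mul_conj_det (g : S.GG) : (S.mat g).det * S.conj (S.mat g).det = 1 := by
  have h := congrArg Matrix.det (mat_form g)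
  have hb : S.betaM.det ≠ 0 := by
    intro h0
    have := congrArg Matrix.det S.beta_mul_beta
    rw [Matrix.det_mul, h0, zero_mul, Matrix.det_one] at this
    exact zero_ne_one this
  rw [Matrix.det_mul, Matrix.det_mul, Matrix.det_transpose, ← RingHom.mapMatrix_apply,
    ← RingHom.map_det, mul_right_comm] at h
  exact mul_right_cancel₀ hb (by rw [h, one_mul])

lemma det_alpha : (S.mat S.alphaE).det = 1 := by
  have : S.mat S.alphaE = S.alphaM := rfl
  simp [this, alphaM, Matrix.det_fin_three, S.unif_ne]

lemma det_NS {u : S.GG} {k : ℤ} (hu : u ∈ S.NS k) : (S.mat u).det = 1 := by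
  obtain ⟨x, y, -, -, h⟩ := mem_NS.1 hu
  simp [h, nM, Matrix.det_fin_three]

lemma det_mul (g h : S.GG) : (S.mat (g * h)).det = (S.mat g).det * (S.mat h).det := by
  rw [mat_mul, Matrix.det_mul]

lemma exists_K1S_det (g : S.GG) : ∃ k ∈ S.K1S, (S.mat k).det = (S.mat g).det := by
  have hd := det_mul_conj_det g
  refine ⟨ofMat _ (diag_form hd), ?_, ?_⟩
  · have hdO : (S.mat g).det ∈ S.pE 0 :=
      mem_pE_of_norm (by rw [hd]; exact pE_mono one_mem_pE (by norm_num))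
    rw [mem_K1S, forall_fin3]
    simp only [mat_ofMat, eK]
    simp [hdO, one_mem_pE]
  · simp [Matrix.det_fin_three]

lemma K1S_eq_alpha_mul {k : S.GG} (hk : k ∈ S.K1S) :
    ∃ k' ∈ S.K1S, ∃ b ∈ S.K0S, k = k' * S.alphaE * b := by
  refine ⟨k * S.betaPr, mul_mem hk betaPr_mem_K1S, S.betaE, beta_mem_K0S, ?_⟩
  rw [mul_assoc, mul_assoc, alpha_mul_beta, betaPr_mul_self, mul_one]

/-- `αK₀` is covered by `K₁` and `K₁αN_0`. -/
lemma alpha_K0S_cases {k : S.GG} (hk : k ∈ S.K0S) :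
    S.alphaE * k ∈ S.K1S ∨ S.alphaE * k ∉ S.K1S ∧
      ∃ k' ∈ S.K1S, ∃ u ∈ S.NS 0, S.alphaE * k = k' * S.alphaE * u := by
  by_cases h00 : S.mat k 0 0 ∈ S.pE 1
  · exact Or.inl (alpha_mul_mem_K1S hk h00)
  · obtain ⟨u, hu, h⟩ := exists_NS_alpha_conj hk h00
    exact Or.inr ⟨alpha_K0S_notMem_K1S h00, _, h, u⁻¹, inv_mem hu, by group⟩

end Setting

namespace HeckeDatum

open Setting

variable {S : Setting} {𝔽 : Type} [Field 𝔽] {W : Type} [AddCommGroup W] [Module 𝔽 W]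
  (D : HeckeDatum S 𝔽 W)

lemma Fc_apply (c : 𝔽) (w : W) (x : S.GG) : (D.Fc c w).1 x = D.F w x + c • D.std 1 w x := rfl

/-- The functions on `K₁αK₀` on which `K₀` acts through `χ ∘ det`. -/
def detSpace (χ : S.E → 𝔽) : Submodule 𝔽 D.P where
  carrier := {f | (∀ x, f.1 x ≠ 0 → ∃ k ∈ S.K1S, ∃ k' ∈ S.K0S, x = k * S.alphaE * k') ∧
    ∀ k ∈ S.K0S, ∀ k' ∈ S.K0S,
      f.1 (S.alphaE * k * k') = χ (S.mat k').det • f.1 (S.alphaE * k)}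
  zero_mem' := ⟨fun x hx => absurd rfl hx, fun k _ k' _ => (smul_zero _).symm⟩
  add_mem' := by
    rintro f g ⟨hf, hf'⟩ ⟨hg, hg'⟩
    refine ⟨fun x hx => ?_, fun k hk k' hk' => ?_⟩
    · by_cases h : f.1 x = 0
      · refine hg x fun h' => hx ?_
        change f.1 x + g.1 x = 0
        rw [h, h', add_zero]
      · exact hf x h
    · change f.1 _ + g.1 _ = _ • (f.1 _ + g.1 _)
      rw [hf' k hk k' hk', hg' k hk k' hk', smul_add]
  smul_mem' := by
    rintro c f ⟨hf, hf'⟩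
    refine ⟨fun x hx => hf x fun h => hx ?_, fun k hk k' hk' => ?_⟩
    · change c • f.1 x = 0
      rw [h, smul_zero]
    · change c • f.1 _ = _ • (c • f.1 _)
      rw [hf' k hk k' hk', smul_comm]

section Det

variable {χ : S.E → 𝔽} (hχ : ∀ g ∈ S.K1S, ∀ w, D.s g w = χ (S.mat g).det • w)

include hχ

lemma L_eq_top_of_det : D.L = ⊤ := by
  rw [eq_top_iff]
  intro w _
  rw [D.mem_L_iff]
  intro n hn
  have h1 := hχ 1 (one_mem _) w
  rw [mat_one, Matrix.det_one, D.s_one_apply] at h1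
  rw [hχ n (NS_le_K1S hn), det_NS hn, ← h1]

lemma j_eq_of_det (w : W) : D.j w = w :=
  D.j_L (by rw [D.L_eq_top_of_det hχ]; trivial)

lemma Fc_alpha_mul (w : W) {k : S.GG} (hk : k ∈ S.K0S) :
    (D.Fc 1 w).1 (S.alphaE * k) = χ (S.mat k).det • w := by
  have hw : w ∈ D.L := by rw [D.L_eq_top_of_det hχ]; trivial
  rw [Fc_apply, one_smul]
  have hd : (S.mat (S.alphaE * k)).det = (S.mat k).det := by
    rw [det_mul, det_alpha, one_mul]
  rcases alpha_K0S_cases hk with h | ⟨h, k', hk', u, hu, e⟩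
  · rw [D.F_K1S w h, zero_add, D.std_apply (by rwa [mul_one]), mul_one, hχ _ h, hd]
  · rw [D.std_apply_eq_zero (by rwa [mul_one]), add_zero, ← hd, e,
      D.F_apply hw hk' (NS_le_I1S hu), hχ _ hk', det_mul, det_mul, det_alpha, det_NS hu, mul_one,
      mul_one]

variable [Nontrivial W]

lemma chi_det_mul (g h : S.GG) :
    χ (S.mat (g * h)).det = χ (S.mat g).det * χ (S.mat h).det := by
  obtain ⟨w, hw⟩ := exists_ne (0 : W)
  obtain ⟨k, hk, hkg⟩ := exists_K1S_det g
  obtain ⟨l, hl, hlh⟩ := exists_K1S_det h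
  have h1 := D.s_mul_apply hk hl w
  rw [hχ _ (mul_mem hk hl), hχ l hl, map_smul, hχ k hk, smul_smul, det_mul, hkg, hlh,
    ← det_mul, mul_comm] at h1
  exact smul_left_injective 𝔽 hw h1

lemma isTransfer_of_det : D.IsTransfer 1 (D.detSpace χ) where
  stable := by
    rintro k hk t ⟨ht, ht'⟩
    refine ⟨fun x hx => ?_, fun k' hk' l hl => ?_⟩
    · rw [ρ_apply] at hx
      obtain ⟨a, ha, b, hb, e⟩ := ht _ hx
      exact ⟨a, ha, b * k⁻¹, mul_mem hb (inv_mem hk), by rw [← mul_assoc, ← e]; group⟩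
    · rw [ρ_apply, ρ_apply, ht' k' hk' k hk, mul_assoc, ht' k' hk' _ (mul_mem hl hk),
        D.chi_det_mul hχ, mul_smul]
  supp := fun t ht => ht.1
  detect := by
    rintro t ⟨ht, ht'⟩ hne
    refine ⟨1, one_mem _, fun h0 => hne ?_⟩
    ext x
    by_contra hx
    obtain ⟨k, hk, k', hk', rfl⟩ := ht x hx
    refine hx ?_
    have h1 := ht' 1 (one_mem _) k' hk'
    rw [h0, smul_zero, mul_one] at h1
    rw [mul_assoc, D.equivar t k hk, h1, map_zero]
    rfl
  mem := by
    intro w hw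
    refine ⟨fun x hx => ?_, fun k hk k' hk' => ?_⟩
    · rw [Fc_apply, one_smul] at hx
      by_cases h : D.F w x = 0
      · rw [h, zero_add] at hx
        have hK := D.mem_of_std_ne_zero hx
        rw [mul_one] at hK
        exact K1S_eq_alpha_mul hK
      · exact D.F_supp_K0 h
    · rw [mul_assoc, D.Fc_alpha_mul hχ w (mul_mem hk hk'), D.Fc_alpha_mul hχ w hk,
        D.chi_det_mul hχ, smul_smul, mul_comm]

end Det

end HeckeDatum

end U21

namespace U21

namespace Setting

variable {S : Setting}

lemma sub_mul_mem {a b c : S.GG} (h : ∀ i j, S.mat a i j - S.mat b i j ∈ S.pE 1)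
    (hc : c ∈ S.K0S) (i j : Fin 3) : S.mat (a * c) i j - S.mat (b * c) i j ∈ S.pE 1 := by
  rw [mat_mul_apply, mat_mul_apply, show ∀ x y z x' y' z' : S.E,
    x + y + z - (x' + y' + z') = (x - x') + (y - y') + (z - z') by intros; ring]
  simp only [← sub_mul]
  exact pE_add (pE_add (pE_mul 1 (h i 0) (hc 0 j) (by simp)) (pE_mul 1 (h i 1) (hc 1 j) (by simp)))
    (pE_mul 1 (h i 2) (hc 2 j) (by simp))

lemma mul_sub_mem {a b c : S.GG} (h : ∀ i j, S.mat a i j - S.mat b i j ∈ S.pE 1)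
    (hc : c ∈ S.K0S) (i j : Fin 3) : S.mat (c * a) i j - S.mat (c * b) i j ∈ S.pE 1 := by
  rw [mat_mul_apply, mat_mul_apply, show ∀ x y z x' y' z' : S.E,
    x + y + z - (x' + y' + z') = (x - x') + (y - y') + (z - z') by intros; ring]
  simp only [← mul_sub]
  exact pE_add (pE_add (pE_mul 1 (hc i 0) (h 0 j) (by simp)) (pE_mul 1 (hc i 1) (h 1 j) (by simp)))
    (pE_mul 1 (hc i 2) (h 2 j) (by simp))

lemma NS_one_sub_mem {n : S.GG} (hn : n ∈ S.NS 1) (i j : Fin 3) :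
    S.mat n i j - S.mat 1 i j ∈ S.pE 1 := by
  obtain ⟨x, y, h1, h2, h3⟩ := mem_NS.1 hn
  have hx := trace_mem_pE h1 h2 1 (by omega)
  rw [h3, mat_one]
  fin_cases i <;> fin_cases j <;> simp [nM, hx, h2, pE_neg_iff, conj_mem_pE_iff]

lemma conj_NS_one_mem_I1S {k n : S.GG} (hk : k ∈ S.K0S) (hn : n ∈ S.NS 1) :
    k * n * k⁻¹ ∈ S.I1S := by
  have h := fun i j => sub_mul_mem (mul_sub_mem (NS_one_sub_mem hn) hk) (inv_mem hk) i j
  rw [mul_one, mul_inv_cancel] at h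
  have hK0 : k * n * k⁻¹ ∈ S.K0S :=
    mul_mem (mul_mem hk (IS_le_K0S (NS_le_IS (NS_mono (by norm_num) hn)))) (inv_mem hk)
  refine mem_I1S.2 ⟨mem_IS_of_20 hK0 ?_, fun j => ?_⟩
  · simpa [mat_one] using h 2 0
  · simpa [mat_one] using h j j

end Setting

namespace HeckeDatum

open Setting

variable {S : Setting} {𝔽 : Type} [Field 𝔽] {W : Type} [AddCommGroup W] [Module 𝔽 W]
  (D : HeckeDatum S 𝔽 W)

/-- `F w x` as a linear function of `w`. -/
def Flin (x : S.GG) : W →ₗ[𝔽] W where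
  toFun w := D.F w x
  map_add' v w := by
    simp only [D.F_apply_sum, ← Finset.sum_add_distrib]
    refine Finset.sum_congr rfl fun u _ => ?_
    unfold WeightDatum.std
    split_ifs
    · exact map_add _ _ _
    · exact (add_zero 0).symm
  map_smul' c w := by
    simp only [D.F_apply_sum, Finset.smul_sum, RingHom.id_apply]
    refine Finset.sum_congr rfl fun u _ => ?_
    unfold WeightDatum.std
    split_ifs
    · exact map_smul _ _ _
    · exact (smul_zero c).symm

/-- Evaluation at a point. -/
def evalLin (x : S.GG) : D.P →ₗ[𝔽] W := LinearMap.proj x ∘ₗ D.P.subtype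

/-- A functional annihilating the `K₀`-span of the functions `F w`. -/
def psi : D.P →ₗ[𝔽] W :=
  ∑ u ∈ S.rep0, D.evalLin (S.alphaE * u) -
    (∑ u ∈ S.rep0, D.Flin (S.alphaE * u * S.betaE)) ∘ₗ D.j ∘ₗ D.s S.betaPr ∘ₗ D.evalLin 1

lemma psi_apply (f : D.P) : D.psi f = ∑ u ∈ S.rep0, f.1 (S.alphaE * u) -
    ∑ u ∈ S.rep0, D.F (D.j (D.s S.betaPr (f.1 1))) (S.alphaE * u * S.betaE) := by
  simp only [psi, LinearMap.sub_apply, LinearMap.sum_apply, LinearMap.comp_apply]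
  rfl

/-- The space of functions on `K₁αK₀` annihilated by `psi` and its `K₀`-translates. -/
def kerSpace : Submodule 𝔽 D.P where
  carrier := {f | (∀ x, f.1 x ≠ 0 → ∃ k ∈ S.K1S, ∃ k' ∈ S.K0S, x = k * S.alphaE * k') ∧
    (∀ k ∈ S.K0S, ∀ n ∈ S.NS 1, ∀ x, f.1 (x * n * k) = f.1 (x * k)) ∧
    ∀ k ∈ S.K0S, D.psi (D.ρ k f) = 0}
  zero_mem' := ⟨fun x hx => absurd rfl hx, fun _ _ _ _ _ => rfl,
    fun k _ => by rw [map_zero, map_zero]⟩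
  add_mem' := by
    rintro f g ⟨hf, hf', hf''⟩ ⟨hg, hg', hg''⟩
    refine ⟨fun x hx => ?_, fun k hk n hn x => ?_, fun k hk => ?_⟩
    · by_cases h : f.1 x = 0
      · refine hg x fun h' => hx ?_
        change f.1 x + g.1 x = 0
        rw [h, h', add_zero]
      · exact hf x h
    · change f.1 _ + g.1 _ = f.1 _ + g.1 _
      rw [hf' k hk n hn x, hg' k hk n hn x]
    · rw [map_add, map_add, hf'' k hk, hg'' k hk, add_zero]
  smul_mem' := by
    rintro c f ⟨hf, hf', hf''⟩
    refine ⟨fun x hx => hf x fun h => hx ?_, fun k hk n hn x => ?_, fun k hk => ?_⟩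
    · change c • f.1 x = 0
      rw [h, smul_zero]
    · change c • f.1 _ = c • f.1 _
      rw [hf' k hk n hn x]
    · rw [map_smul, map_smul, hf'' k hk, smul_zero]

lemma psi_ρ_NS {f : D.P} (hf : ∀ n ∈ S.NS 1, ∀ x, f.1 (x * n) = f.1 x) {u : S.GG}
    (hu : u ∈ S.NS 0) : D.psi (D.ρ u f) = D.psi f := by
  have h1 : f.1 u = f.1 1 := by
    have := D.equivar f u (NS_le_K1S (NS_mono (by norm_num) hu)) 1
    rwa [mul_one, D.s_kone_apply (NS_zero_subset_Kone1 hu)] at this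
  rw [psi_apply, psi_apply]
  simp only [D.ρ_apply, one_mul, h1]
  congr 1
  have := S.rep0_spec.sum_comp (fun v => f.1 (S.alphaE * v))
    (fun a _ b hb => by rw [← mul_assoc, hf b hb]) (fun v => v * u)
    (fun a ha => mul_mem ha hu) (fun a ha a' ha' h => by
      have h' := NS_conj_mem (Or.inr rfl) (inv_mem hu) h
      rwa [show u⁻¹⁻¹ * ((a * u)⁻¹ * (a' * u) * u⁻¹) = a⁻¹ * a' by group] at h')
  simpa only [← mul_assoc] using this

lemma psi_FP [CharP 𝔽 S.p] {w : W} (hw : w ∈ D.L) : D.psi (D.FP w) = 0 := by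
  rw [psi_apply]
  simp only [coe_FP]
  rw [D.F_K1S w (one_mem _), map_zero, map_zero]
  have h1 : ∀ u ∈ S.rep0, D.F w (S.alphaE * u) = w := fun u hu => by
    rw [D.F_right hw _ (NS_le_I1S (rep0_mem hu)), D.F_alpha hw]
  have h2 : ∀ x, D.F 0 x = 0 := fun x => (D.Flin x).map_zero
  rw [Finset.sum_congr rfl h1, Finset.sum_const, ← Nat.cast_smul_eq_nsmul 𝔽, card_rep0, zero_smul]
  simp [h2]

lemma psi_beta_FP {w : W} (hw : w ∈ D.L) : D.psi (D.ρ S.betaE (D.FP w)) = 0 := by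
  rw [psi_apply]
  simp only [D.ρ_apply, coe_FP, one_mul]
  rw [D.F_beta hw, ← D.s_mul_apply betaPr_mem_K1S betaPr_mem_K1S, betaPr_mul_self, D.s_one_apply,
    D.j_L hw, sub_self]

lemma exists_ρ_FP {w : W} (hw : w ∈ D.L) {i : S.GG} (hi : i ∈ S.IS) :
    ∃ w' ∈ D.L, D.ρ i (D.FP w) = D.FP w' := by
  have key : ∀ x, ∀ n ∈ S.I1S, D.F w (x * n * i) = D.F w (x * i) := fun x n hn => by
    have h := IS_conj_I1S (inv_mem hi) hn
    rw [show x * n * i = x * i * (i⁻¹ * n * i⁻¹⁻¹) by group, D.F_right hw _ h]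
  have hL : D.F w (S.alphaE * i) ∈ D.L := by
    rw [D.mem_L_iff]
    intro n hn
    have h := NS_le_I1S (NS_mono (by norm_num) (alphaInv_conj_NS hn))
    rw [← D.F_equivar w n (NS_le_K1S hn), ← key _ _ h]
    congr 1
    group
  refine ⟨_, hL, Subtype.ext <| funext fun x => ?_⟩
  rw [D.ρ_apply, coe_FP, coe_FP]
  by_cases hx : ∃ k ∈ S.K1S, ∃ u ∈ S.NS 0, x = k * S.alphaE * u
  · obtain ⟨k, hk, u, hu, rfl⟩ := hx
    rw [D.F_apply hL hk (NS_le_I1S hu), key _ _ (NS_le_I1S hu), mul_assoc, D.F_equivar w k hk]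
  · have h0 : D.F (D.F w (S.alphaE * i)) x = 0 := by
      by_contra h
      exact hx (D.F_supp h)
    rw [h0]
    by_contra h
    obtain ⟨k, hk, u, hu, e⟩ := D.F_supp h
    have hI := mul_mem (NS_le_IS hu) (inv_mem hi)
    obtain ⟨v, hv, hα⟩ := exists_NS_alpha_conj (IS_le_K0S hI) (IS_00_notMem hI)
    refine hx ⟨_, mul_mem hk hα, v⁻¹, inv_mem hv, ?_⟩
    rw [eq_mul_inv_of_mul_eq e]
    group

lemma FP_mem_kerSpace [CharP 𝔽 S.p] {w : W} (hw : w ∈ D.L) : D.FP w ∈ D.kerSpace := by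
  have hinv : ∀ w ∈ D.L, ∀ k ∈ S.K0S, ∀ n ∈ S.NS 1, ∀ x,
      D.F w (x * n * k) = D.F w (x * k) := by
    intro w hw k hk n hn x
    have h := conj_NS_one_mem_I1S (inv_mem hk) hn
    rw [show x * n * k = x * k * (k⁻¹ * n * k⁻¹⁻¹) by group, D.F_right hw _ h]
  refine ⟨fun x hx => D.F_supp_K0 hx, hinv w hw, fun k hk => ?_⟩
  rcases bruhat_K0 hk with hI | ⟨u, hu, hI⟩
  · obtain ⟨w', hw', e⟩ := D.exists_ρ_FP hw hI
    rw [e, D.psi_FP hw']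
  · obtain ⟨w', hw', e⟩ := D.exists_ρ_FP hw hI
    have hk' : k = u⁻¹ * (S.betaE * (S.betaE * (u * k))) := by
      rw [← mul_assoc S.betaE, beta_mul_self]
      group
    rw [hk', D.ρ_mul_apply, D.ρ_mul_apply, e, D.psi_ρ_NS _ (inv_mem hu), D.psi_beta_FP hw']
    intro n hn x
    rw [D.ρ_apply, D.ρ_apply]
    exact hinv w' hw' _ beta_mem_K0S n hn x

lemma kerSpace_detect {t : D.P} (ht : t ∈ D.kerSpace)
    (h : ∀ u ∈ S.NS 0, t.1 (S.alphaE * u) = 0) : t = 0 := by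
  obtain ⟨hsupp, hinv, hpsi⟩ := ht
  have hα : t.1 S.alphaE = 0 := by simpa using h 1 (one_mem _)
  have hβ : t.1 S.betaE = 0 := by
    rw [← betaPr_mul_alpha, D.equivar t _ betaPr_mem_K1S, hα, map_zero]
  have h1 : t.1 1 = 0 := by
    obtain ⟨u0, ⟨hu0, hu0'⟩, huniq⟩ := S.rep0_spec.2 1 (one_mem (S.NS 0))
    have hpsi' := hpsi _ beta_mem_K0S
    rw [psi_apply] at hpsi'
    simp only [D.ρ_apply, one_mul] at hpsi'
    have hF0 : ∀ x, D.F 0 x = 0 := fun x => (D.Flin x).map_zero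
    rw [hβ, map_zero, map_zero, Finset.sum_eq_single_of_mem u0 hu0] at hpsi'
    · simp only [hF0, Finset.sum_const_zero, sub_zero] at hpsi'
      have hu1 : u0 ∈ S.NS 1 := by simpa using hu0'
      rw [hinv _ beta_mem_K0S _ hu1, alpha_mul_beta, ← mul_one S.betaPr,
        D.equivar t _ betaPr_mem_K1S] at hpsi'
      exact D.s_eq_zero betaPr_mem_K1S hpsi'
    · intro u hu hne
      have hu1 : u ∉ S.NS 1 := fun hu1 => hne (huniq u ⟨hu, by simpa using hu1⟩)
      have huN := rep0_mem hu
      rw [mul_assoc]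
      rcases alpha_K0S_cases (mul_mem (IS_le_K0S (NS_le_IS huN)) beta_mem_K0S) with
        hK | ⟨-, k', hk', v, hv, e⟩
      · refine absurd ((alpha_conj_NS_mem huN).1 ?_) hu1
        have := mul_mem hK (inv_mem S.betaPr_mem_K1S)
        rwa [← alpha_mul_beta, show S.alphaE * (u * S.betaE) * (S.alphaE * S.betaE)⁻¹ =
          S.alphaE * u * S.alphaE⁻¹ by group] at this
      · rw [e, mul_assoc, D.equivar t _ hk', h v hv, map_zero]
  ext x
  by_contra hx
  obtain ⟨k, hk, k', hk', rfl⟩ := hsupp x hx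
  refine hx ?_
  rw [mul_assoc, D.equivar t k hk]
  change D.s k (t.1 (S.alphaE * k')) = 0
  rcases alpha_K0S_cases hk' with hK | ⟨-, a, ha, v, hv, e⟩
  · have := D.equivar t _ hK 1
    rw [mul_one] at this
    rw [this, h1, map_zero, map_zero]
  · rw [e, mul_assoc, D.equivar t _ ha, h v hv, map_zero, map_zero]

lemma isTransfer_zero [CharP 𝔽 S.p] : D.IsTransfer 0 D.kerSpace where
  stable := by
    rintro k hk t ⟨ht, ht', ht''⟩
    refine ⟨fun x hx => ?_, fun k' hk' n hn x => ?_, fun k' hk' => ?_⟩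
    · rw [ρ_apply] at hx
      obtain ⟨a, ha, b, hb, e⟩ := ht _ hx
      exact ⟨a, ha, b * k⁻¹, mul_mem hb (inv_mem hk), by rw [← mul_assoc, ← e]; group⟩
    · rw [ρ_apply, ρ_apply, mul_assoc, mul_assoc x k' k]
      exact ht' _ (mul_mem hk' hk) n hn x
    · rw [← D.ρ_mul_apply]
      exact ht'' _ (mul_mem hk' hk)
  supp := fun t ht => ht.1
  detect := by
    intro t ht hne
    by_contra! h
    exact hne (D.kerSpace_detect ht h)
  mem := by
    intro w hw
    rw [Fc, zero_smul, add_zero]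
    exact D.FP_mem_kerSpace hw

end HeckeDatum

end U21

namespace U21

section Bridge

open Setting

variable {S : Setting} (C : Chamber S)

lemma Chamber.data_of_K1 (hK1 : (C.K : Set S.GG) = S.K1set) :
    C.K = S.K1S ∧ C.KoneS = S.Kone1 ∧ C.I1 = S.I1K1 ∧ C.I1' = S.I1'K1 ∧ C.βK = S.betaPr ∧
      C.nK = -1 := by
  have hK : C.K = S.K1S := SetLike.coe_injective (hK1.trans K1S_eq.symm)
  rcases C.cases with ⟨h0, -⟩ | ⟨-, h1, -, h2, h3, h4, h5, -, -⟩
  · exfalso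
    have hβ : S.betaE ∈ S.K1set := by
      rw [← hK1, h0]
      intro i j
      exact mem_pE_zero.1 (mem_K0S.1 beta_mem_K0S i j)
    have h20 : (1 : S.E) ∈ S.pE 1 := hβ.2.2.2.2.2.2.1
    exact one_notMem_pE h20
  · exact ⟨hK, h1, h2, h3, h4, h5⟩

variable {𝔽 : Type} [Field 𝔽] {W : Type} [AddCommGroup W] [Module 𝔽 W]
  (σ : Representation 𝔽 ↥C.K W)

lemma sigma'_apply {g : S.GG} (hg : g ∈ C.K) : sigma' C 𝔽 W σ g = σ ⟨g, hg⟩ := dif_pos hg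

/-- The weight datum attached to a weight of `K₁`. -/
def weightDatum (hK1 : (C.K : Set S.GG) = S.K1set) (hσ : IsWeight C 𝔽 W σ) {jσ : W →ₗ[𝔽] W}
    (hj : IsJ C 𝔽 W σ jσ) : WeightDatum S 𝔽 W where
  s := sigma' C 𝔽 W σ
  s_one := by
    rw [sigma'_apply C σ (one_mem _)]
    exact map_one σ
  s_mul g hg h hh := by
    rw [← (C.data_of_K1 hK1).1] at hg hh
    rw [sigma'_apply C σ hg, sigma'_apply C σ hh, sigma'_apply C σ (mul_mem hg hh), ← map_mul]
    rfl
  s_kone g hg := by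
    have hK : g ∈ C.K := by
      rw [(C.data_of_K1 hK1).1]
      exact (mem_Kone1_iff.1 hg).1
    rw [sigma'_apply C σ hK]
    exact hσ.2.2.2 g hK (by rwa [(C.data_of_K1 hK1).2.1])
  irr Z hZ := hσ.2.2.1 Z fun k w hw => by
    rw [← sigma'_apply C σ k.2]
    exact hZ k ((C.data_of_K1 hK1).1 ▸ k.2) w hw
  j := jσ
  j_fix w hw := hj.1 w (by rwa [(C.data_of_K1 hK1).2.2.1])
  j_aug w g hg := hj.2 w g (by rwa [(C.data_of_K1 hK1).2.2.2.1])

variable {C σ} (hK1 : (C.K : Set S.GG) = S.K1set) (hσ : IsWeight C 𝔽 W σ) {jσ : W →ₗ[𝔽] W}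
    (hj : IsJ C 𝔽 W σ jσ)

lemma stdFn_eq (g : S.GG) (v : W) : stdFn C 𝔽 W σ g v = (weightDatum C σ hK1 hσ hj).std g v := by
  ext x
  have hK := (C.data_of_K1 hK1).1
  by_cases h : x * g ∈ C.K
  · rw [WeightDatum.std_apply _ (hK ▸ h)]
    exact (dif_pos h).trans (by rw [← sigma'_apply C σ h]; rfl)
  · rw [WeightDatum.std_apply_eq_zero _ (hK ▸ h)]
    exact dif_neg h

/-- The Hecke datum attached to a weight of `K₁` and its Hecke operator. -/
def heckeDatum {T : Module.End 𝔽 ↥(IndSub C 𝔽 W σ)} (hT : IsHeckeT C 𝔽 W σ jσ T) :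
    HeckeDatum S 𝔽 W where
  __ := weightDatum C σ hK1 hσ hj
  P := IndSub C 𝔽 W σ
  mem_P f := by
    have hK := (C.data_of_K1 hK1).1
    change ((∀ (k : S.GG) (hk : k ∈ C.K) (g : S.GG), f (k * g) = σ ⟨k, hk⟩ (f g)) ∧
      ∃ s : Finset S.GG, ∀ g : S.GG, f g ≠ 0 → ∃ k ∈ C.K, ∃ t ∈ s, g = k * t) ↔
      (∀ k ∈ S.K1S, ∀ g, f (k * g) = sigma' C 𝔽 W σ k (f g)) ∧
      ∃ s : Finset S.GG, ∀ g : S.GG, f g ≠ 0 → ∃ k ∈ S.K1S, ∃ t ∈ s, g = k * t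
    rw [← hK]
    refine and_congr_left' ⟨fun h k hk g => ?_, fun h k hk g => ?_⟩
    · rw [h k hk g, sigma'_apply C σ hk]
    · rw [h k hk g, sigma'_apply C σ hk]
  ρ := indRep C 𝔽 W σ
  ρ_apply _ _ _ := rfl
  T := T
  T_equivar := hT.1
  T_std v f hf U2 U1 hU2 hU1 := by
    obtain ⟨-, -, -, -, hβ, hn⟩ := C.data_of_K1 hK1
    have h := hT.2 v f (by rw [hf, stdFn_eq hK1 hσ hj]) U2 U1 (by rw [hn]; exact hU2)
      (by rw [hn]; exact hU1)
    rw [h, hβ]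
    simp only [stdFn_eq hK1 hσ hj]
    rfl

end Bridge

/-- Suppose `K = K₁` and `q = p`.  For every weight `σ` of `K`, the
universal supersingular quotient `(ind_K^G σ)/(T_σ)` is not irreducible, where
`T_σ = T + 1` if `σ` is one-dimensional of the form `χ ∘ det`, and `T_σ = T` otherwise. -/
theorem stmt0
    (S : Setting) (C : Chamber S)
    (hK1 : (C.K : Set S.GG) = S.K1set) (hqp : S.q = S.p)
    (𝔽 : Type) [Field 𝔽] [IsAlgClosed 𝔽] [Algebra (ZMod S.p) 𝔽]
    [Algebra.IsAlgebraic (ZMod S.p) 𝔽]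
    (W : Type) [AddCommGroup W] [Module 𝔽 W]
    (σ : Representation 𝔽 ↥C.K W) (hσ : IsWeight C 𝔽 W σ)
    (jσ : W →ₗ[𝔽] W) (hj : IsJ C 𝔽 W σ jσ)
    (T Tσ : Module.End 𝔽 ↥(IndSub C 𝔽 W σ))
    (hT : IsHeckeT C 𝔽 W σ jσ T)
    (hTσ₁ : IsDetWeight C 𝔽 W σ → Tσ = T + 1)
    (hTσ₂ : ¬ IsDetWeight C 𝔽 W σ → Tσ = T) :
    ¬ QuotientIrreducible 𝔽 (indRep C 𝔽 W σ) (LinearMap.range Tσ) := by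
  have : Fact S.p.Prime := ⟨S.hp⟩
  have : CharP 𝔽 S.p := charP_of_injective_algebraMap (algebraMap (ZMod S.p) 𝔽).injective S.p
  have : Nontrivial W := hσ.1
  have hK := (C.data_of_K1 hK1).1
  let D := heckeDatum hK1 hσ hj hT
  suffices H : ∃ (c : 𝔽) (Q : Submodule 𝔽 D.P), D.IsTransfer c Q ∧ (c = 0 ∨ ∀ w, D.j w = w) ∧
      Tσ = D.Tc c by
    obtain ⟨c, Q, hQ, hc, rfl⟩ := H
    obtain ⟨N, hN, hle, hne, hne'⟩ := hQ.exists_intermediate hc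
    rintro ⟨-, h⟩
    rcases h N (fun g v hv => hN g v hv) hle with h | h
    · exact hne h
    · exact hne' h
  by_cases hdet : IsDetWeight C 𝔽 W σ
  · obtain ⟨χ, hχ⟩ := hdet.2
    have hχ' : ∀ g ∈ S.K1S, ∀ w, D.s g w = χ (S.mat g).det • w := by
      intro g hg w
      rw [← hK] at hg
      rw [← hχ g hg w, ← sigma'_apply C σ hg]
      rfl
    refine ⟨1, _, D.isTransfer_of_det hχ', Or.inr (D.j_eq_of_det hχ'), ?_⟩
    rw [hTσ₁ hdet, HeckeDatum.Tc, one_smul]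
    rfl
  · refine ⟨0, _, D.isTransfer_zero, Or.inl rfl, ?_⟩
    rw [hTσ₂ hdet, HeckeDatum.Tc, zero_smul, add_zero]
    rfl

end U21
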